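/- arXiv:1810.05669 — 2 statements merged into one kernel-verified Lean document; each statement's English description precedes it below -/
import Mathlib

section
/- Suppose Ω ⊂ ℂ^d is a bounded convex domain with C² boundary. If f : Ω → Ω is a holomorphic map and there exists ξ₀ ∈ ∂Ω such that ‖f(z) − z‖ / ‖z − ξ₀‖⁴ → 0 as z → ξ₀ in Ω, then f is the identity map of Ω. -/
open Set Filter Metric Topology MeasureTheory Asymptotics

noncomputable section

theorem Convex.mapsTo_ball_of_mapsTo_sphere {E : Type*} [NormedAddCommGroup E] [NormedSpace ℂ E]
    {Ω : Set E} (hΩo : IsOpen Ω) (hΩc : Convex ℝ Ω) {ψ : ℂ → E}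
    (hψ : DiffContOnCl ℂ ψ (ball 0 1)) (hb : ∀ ζ : ℂ, ‖ζ‖ = 1 → ζ ≠ 1 → ψ ζ ∈ Ω)
    (h1 : ψ 1 ∈ closure Ω) : MapsTo ψ (ball 0 1) Ω := by
  intro ζ₀ hζ₀
  by_contra hmem
  obtain ⟨l, hl⟩ := RCLike.geometric_hahn_banach_open_point (𝕜 := ℂ) hΩc hΩo hmem
  have hcl : ∀ y ∈ closure Ω, (l y).re ≤ (l (ψ ζ₀)).re := fun y hy ↦
    closure_minimal (fun a ha ↦ (hl a ha).le)
      (isClosed_le (Complex.continuous_re.comp l.continuous) continuous_const) hy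
  have hd : DiffContOnCl ℂ (fun ζ ↦ Complex.exp (l (ψ ζ))) (ball 0 1) :=
    Complex.differentiable_exp.comp_diffContOnCl (l.differentiable.comp_diffContOnCl hψ)
  have hle : ∀ ζ ∈ closure (ball (0 : ℂ) 1),
      ‖Complex.exp (l (ψ ζ))‖ ≤ Real.exp (l (ψ ζ₀)).re := by
    intro ζ hζ
    refine Complex.norm_le_of_forall_mem_frontier_norm_le isBounded_ball hd (fun w hw ↦ ?_) hζ
    rw [frontier_ball _ one_ne_zero, mem_sphere_zero_iff_norm] at hw
    rw [Complex.norm_exp, Real.exp_le_exp]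
    by_cases hw1 : w = 1
    · exact hw1 ▸ hcl _ h1
    · exact (hl _ (hb w hw hw1)).le
  have hmax : IsMaxOn (norm ∘ fun ζ ↦ Complex.exp (l (ψ ζ))) (ball 0 1) ζ₀ := by
    intro ζ hζ
    simpa [Complex.norm_exp] using hle ζ (subset_closure hζ)
  have heq := Complex.norm_eqOn_closure_of_isPreconnected_of_isMaxOn
    (convex_ball (0 : ℂ) 1).isPreconnected isOpen_ball hd hζ₀ hmax
    (show (-1 : ℂ) ∈ closure (ball 0 1) by
      rw [closure_ball _ one_ne_zero]; simp)
  simp only [Function.comp, Function.const, Complex.norm_exp, Real.exp_eq_exp] at heq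
  exact absurd heq (hl _ (hb (-1) (by simp) (by norm_num))).ne

/-- The `n`-th iterate of the relaxation `z ↦ z + μ (f z - z)` of a self-map `f`. -/
def relaxIterate {E : Type*} [AddCommGroup E] [Module ℂ E] (f : E → E) (μ : ℂ) (n : ℕ) (z : E) : E :=
  (fun y ↦ y + μ • (f y - y))^[n] z

section relaxIterate

variable {E : Type*} [NormedAddCommGroup E] [NormedSpace ℂ E]

@[simp] theorem relaxIterate_zero (f : E → E) (μ : ℂ) (z : E) : relaxIterate f μ 0 z = z := rfl

theorem relaxIterate_succ (f : E → E) (μ : ℂ) (n : ℕ) (z : E) :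
    relaxIterate f μ (n + 1) z =
      relaxIterate f μ n z + μ • (f (relaxIterate f μ n z) - relaxIterate f μ n z) :=
  Function.iterate_succ_apply' _ _ _

@[simp] theorem relaxIterate_zero_left (f : E → E) (n : ℕ) (z : E) : relaxIterate f 0 n z = z := by
  induction n with
  | zero => rfl
  | succ n ih => simp [relaxIterate_succ, ih]

theorem relaxIterate_mem_of_flat {Ω : Set E} (hΩo : IsOpen Ω) (hΩc : Convex ℝ Ω) {f : E → E}
    (hf : DifferentiableOn ℂ f Ω) (hfm : MapsTo f Ω Ω) {ξ v : E} (hξ : ξ ∈ closure Ω)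
    {c : ℝ} (hc : 0 < c)
    (hdisc : ∀ ζ : ℂ, ‖ζ‖ ≤ 1 → ζ ≠ 1 → ∀ e : E, ‖e‖ ≤ c * ‖1 - ζ‖ ^ 2 → ξ + (ζ - 1) • v + e ∈ Ω)
    {χ : ℂ → ℂ} (hχd : DifferentiableOn ℂ χ (ball 0 1))
    (hχc : ContinuousOn χ (closedBall 0 1 \ {1})) (hχ1 : χ 1 = 0)
    (hχr : ∀ ζ : ℂ, ‖ζ‖ = 1 → ζ ≠ 1 → ∃ x : ℝ, 0 ≤ x ∧ χ ζ = x)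
    (hχb : ∀ ζ : ℂ, ‖ζ‖ ≤ 1 → ‖χ ζ‖ * ‖1 - ζ‖ ^ 2 ≤ 16)
    {r η t : ℝ} (hr : 0 < r) (hη0 : 0 ≤ η)
    (hη : ∀ z ∈ Ω, ‖z - ξ‖ ≤ (‖v‖ + 2 * c) * r → ‖f z - z‖ ≤ η * ‖z - ξ‖ ^ 4)
    (ht : 0 ≤ t) (htr : 16 * t ≤ r ^ 2) {N : ℕ}
    (hN : N * (16 * t * η * (‖v‖ + 2 * c) ^ 4) ≤ c) {n : ℕ} (hn : n ≤ N) {ζ : ℂ}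
    (hζ : ‖ζ‖ ≤ 1) (hζ1 : ζ ≠ 1) :
    relaxIterate f (t * χ ζ) n (ξ + (ζ - 1) • v) ∈ Ω := by
  set C := ‖v‖ + 2 * c with hC
  have hC0 : 0 < C := by positivity
  set ψ : ℕ → ℂ → E := fun n ζ ↦ relaxIterate f (t * χ ζ) n (ξ + (ζ - 1) • v) with hψ
  have hψs : ∀ n ζ, ψ (n + 1) ζ = ψ n ζ + (t * χ ζ) • (f (ψ n ζ) - ψ n ζ) :=
    fun n ζ ↦ relaxIterate_succ _ _ _ _
  have hψ1 : ∀ n, ψ n 1 = ξ := fun n ↦ by simp [hψ, hχ1]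
  set K := 16 * t * η * C ^ 4 with hK
  have hK0 : 0 ≤ K := by positivity
  suffices H : ∀ n ≤ N, (∀ ζ : ℂ, ‖ζ‖ ≤ 1 → ζ ≠ 1 → ψ n ζ ∈ Ω) ∧
      ContinuousOn (ψ n) (closedBall 0 1 \ {1}) ∧ DifferentiableOn ℂ (ψ n) (ball 0 1) ∧
      ∀ ζ : ℂ, ‖ζ‖ ≤ 1 → ζ ≠ 1 → ‖1 - ζ‖ < r →
        ‖ψ n ζ - (ξ + (ζ - 1) • v)‖ ≤ n * K * ‖1 - ζ‖ ^ 2 from (H n hn).1 ζ hζ hζ1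
  clear hζ hζ1 hn ζ n
  intro n
  induction n with
  | zero =>
    intro _
    refine ⟨fun ζ h h1 ↦ by simpa [hψ] using hdisc ζ h h1 0 (by simp; positivity), ?_, ?_, ?_⟩
    · simp only [hψ, relaxIterate_zero]; fun_prop
    · simp only [hψ, relaxIterate_zero]; fun_prop
    · simp [hψ]
  | succ n ih =>
    intro hn
    obtain ⟨hmem, hcont, hdiff, hest⟩ := ih (by omega)
    have hball1 : ball (0 : ℂ) 1 ⊆ closedBall 0 1 \ {1} := fun ζ h ↦
      ⟨ball_subset_closedBall h, by rintro rfl; simp at h⟩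
    have hest' : ∀ ζ : ℂ, ‖ζ‖ ≤ 1 → ζ ≠ 1 → ‖1 - ζ‖ < r →
        ‖ψ (n + 1) ζ - (ξ + (ζ - 1) • v)‖ ≤ (n + 1 : ℕ) * K * ‖1 - ζ‖ ^ 2 := by
      intro ζ h h1 hζr
      have hnorm2 : ‖1 - ζ‖ ≤ 2 := (norm_sub_le _ _).trans (by simp; linarith)
      have hnK : n * K ≤ c := le_trans (by gcongr; omega) hN
      have e1 : ‖ψ n ζ - ξ‖ ≤ C * ‖1 - ζ‖ := by
        calc ‖ψ n ζ - ξ‖ = ‖(ψ n ζ - (ξ + (ζ - 1) • v)) + (ζ - 1) • v‖ := by congr 1; abel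
          _ ≤ n * K * ‖1 - ζ‖ ^ 2 + ‖1 - ζ‖ * ‖v‖ := by
            refine (norm_add_le _ _).trans (add_le_add (hest ζ h h1 hζr) ?_)
            rw [norm_smul, norm_sub_rev]
          _ ≤ c * ‖1 - ζ‖ ^ 2 + ‖1 - ζ‖ * ‖v‖ := by gcongr
          _ ≤ C * ‖1 - ζ‖ := by
            rw [hC]
            nlinarith [mul_le_mul_of_nonneg_left hnorm2 (mul_nonneg hc.le (norm_nonneg (1 - ζ)))]
      have e2 : ‖f (ψ n ζ) - ψ n ζ‖ ≤ η * (C * ‖1 - ζ‖) ^ 4 := by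
        refine (hη _ (hmem ζ h h1) (e1.trans (by gcongr))).trans (by gcongr)
      calc ‖ψ (n + 1) ζ - (ξ + (ζ - 1) • v)‖
          = ‖(ψ n ζ - (ξ + (ζ - 1) • v)) + (t * χ ζ) • (f (ψ n ζ) - ψ n ζ)‖ := by
            rw [hψs]; congr 1; abel
        _ ≤ n * K * ‖1 - ζ‖ ^ 2 + (t * ‖χ ζ‖) * (η * (C * ‖1 - ζ‖) ^ 4) := by
            refine (norm_add_le _ _).trans (add_le_add (hest ζ h h1 hζr) ?_)
            rw [norm_smul, norm_mul, Complex.norm_of_nonneg ht]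
            gcongr
        _ = n * K * ‖1 - ζ‖ ^ 2 + (‖χ ζ‖ * ‖1 - ζ‖ ^ 2) * (t * η * C ^ 4 * ‖1 - ζ‖ ^ 2) := by ring
        _ ≤ n * K * ‖1 - ζ‖ ^ 2 + 16 * (t * η * C ^ 4 * ‖1 - ζ‖ ^ 2) := by
            gcongr; exact hχb ζ h
        _ = (n + 1 : ℕ) * K * ‖1 - ζ‖ ^ 2 := by push_cast; rw [hK]; ring
    have hestc : ∀ ζ : ℂ, ‖ζ‖ ≤ 1 → ζ ≠ 1 → ‖1 - ζ‖ < r →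
        ‖ψ (n + 1) ζ - (ξ + (ζ - 1) • v)‖ ≤ c * ‖1 - ζ‖ ^ 2 := fun ζ h h1 hζr ↦
      (hest' ζ h h1 hζr).trans (by gcongr; exact le_trans (by gcongr) hN)
    have hcont' : ContinuousOn (ψ (n + 1)) (closedBall 0 1 \ {1}) := by
      have hfc : ContinuousOn (fun ζ ↦ f (ψ n ζ)) (closedBall 0 1 \ {1}) :=
        hf.continuousOn.comp hcont fun ζ h ↦ hmem ζ (by simpa using h.1) h.2
      refine (hcont.add ((continuousOn_const.mul hχc).smul (hfc.sub hcont))).congr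
        fun ζ _ ↦ hψs n ζ
    have hdiff' : DifferentiableOn ℂ (ψ (n + 1)) (ball 0 1) := by
      have hfc : DifferentiableOn ℂ (fun ζ ↦ f (ψ n ζ)) (ball 0 1) :=
        hf.comp hdiff fun ζ h ↦ hmem ζ (by simpa using (hball1 h).1) (hball1 h).2
      refine (hdiff.add ((hχd.const_mul _).smul (hfc.sub hdiff))).congr
        fun ζ _ ↦ hψs n ζ
    have hsphere : ∀ ζ : ℂ, ‖ζ‖ = 1 → ζ ≠ 1 → ψ (n + 1) ζ ∈ Ω := by
      intro ζ h h1
      rcases lt_or_ge ‖1 - ζ‖ r with hζr | hζr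
      · simpa using hdisc ζ h.le h1 _ (hestc ζ h.le h1 hζr)
      · obtain ⟨x, hx0, hx⟩ := hχr ζ h h1
        have hb := hχb ζ h.le
        rw [hx, Complex.norm_of_nonneg hx0] at hb
        have htx : t * x ≤ 1 := by
          have h2 : r ^ 2 ≤ ‖1 - ζ‖ ^ 2 := by gcongr
          have h3 : (t * x) * r ^ 2 ≤ r ^ 2 := by
            nlinarith [mul_le_mul_of_nonneg_left h2 (mul_nonneg ht hx0),
              mul_le_mul_of_nonneg_left hb ht]
          exact le_of_mul_le_mul_right (by linarith) (pow_pos hr 2)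
        have := hΩc.add_smul_sub_mem (hmem ζ h.le h1) (hfm (hmem ζ h.le h1))
          ⟨mul_nonneg ht hx0, htx⟩
        rw [hψs, hx, ← Complex.ofReal_mul, Complex.coe_smul]
        exact this
    have hcontcl : ContinuousOn (ψ (n + 1)) (closedBall 0 1) := by
      intro ζ h
      by_cases h1 : ζ = 1
      · subst h1
        have hlim : Tendsto (fun ζ : ℂ ↦ c * ‖1 - ζ‖ ^ 2 + ‖(ζ - 1) • v‖)
            (𝓝[closedBall 0 1] 1) (𝓝 0) := by
          have : Continuous fun ζ : ℂ ↦ c * ‖1 - ζ‖ ^ 2 + ‖(ζ - 1) • v‖ := by fun_prop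
          simpa using (this.tendsto 1).mono_left nhdsWithin_le_nhds
        rw [ContinuousWithinAt, hψ1, tendsto_iff_norm_sub_tendsto_zero]
        refine squeeze_zero' (Eventually.of_forall fun _ ↦ norm_nonneg _) ?_ hlim
        filter_upwards [self_mem_nhdsWithin, mem_nhdsWithin_of_mem_nhds (ball_mem_nhds 1 hr)]
          with w hw hwr
        by_cases hw1 : w = 1
        · rw [hw1, hψ1]; simp
        · have := hestc w (by simpa using hw) hw1 (by simpa [dist_eq_norm, norm_sub_rev] using hwr)
          calc ‖ψ (n + 1) w - ξ‖
              = ‖(ψ (n + 1) w - (ξ + (w - 1) • v)) + (w - 1) • v‖ := by congr 1; abel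
            _ ≤ _ := (norm_add_le _ _).trans (by gcongr)
      · have hopen : closedBall 0 1 \ {1} ∈ 𝓝[closedBall 0 1] ζ :=
          inter_mem_nhdsWithin _ (isOpen_compl_singleton.mem_nhds h1)
        exact (hcont' ζ ⟨h, h1⟩).mono_of_mem_nhdsWithin hopen
    have hball := hΩc.mapsTo_ball_of_mapsTo_sphere hΩo
      (⟨hdiff', by rwa [closure_ball _ one_ne_zero]⟩ : DiffContOnCl ℂ (ψ (n + 1)) (ball 0 1))
      hsphere (by rwa [hψ1])
    refine ⟨fun ζ h h1 ↦ ?_, hcont', hdiff', hest'⟩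
    rcases h.lt_or_eq with h | h
    · exact hball (by simpa using h)
    · exact hsphere ζ h h1

theorem hasDerivAt_relaxIterate {Ω : Set E} (hΩo : IsOpen Ω) {f : E → E}
    (hf : DifferentiableOn ℂ f Ω) {w : E} (hw : w ∈ Ω) (t : ℂ) (n : ℕ) :
    HasDerivAt (fun l : ℂ ↦ relaxIterate f (t * l) n w) ((n * t) • (f w - w)) 0 := by
  induction n with
  | zero => simpa using hasDerivAt_const (0 : ℂ) w
  | succ n ih =>
    have hfd : DifferentiableAt ℂ f (relaxIterate f (t * 0) n w) := by
      simpa using hf.differentiableAt (hΩo.mem_nhds hw)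
    have hfG := hfd.hasFDerivAt.comp_hasDerivAt (0 : ℂ) ih
    have hm : HasDerivAt (fun l : ℂ ↦ t * l) t 0 := by
      simpa using (hasDerivAt_id (0 : ℂ)).const_mul t
    have := ih.add (hm.smul (hfG.sub ih))
    refine (this.congr_deriv ?_).congr_of_eventuallyEq
      (Eventually.of_forall fun l ↦ relaxIterate_succ _ _ _ _)
    simp [add_mul, add_smul]

theorem differentiableOn_relaxIterate {Ω : Set E} {f : E → E} (hf : DifferentiableOn ℂ f Ω)
    {w : E} {t : ℂ} {U : Set ℂ} {N : ℕ}
    (h : ∀ n ≤ N, ∀ l ∈ U, relaxIterate f (t * l) n w ∈ Ω) :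
    ∀ n ≤ N, DifferentiableOn ℂ (fun l : ℂ ↦ relaxIterate f (t * l) n w) U := by
  intro n
  induction n with
  | zero => intro _; simp
  | succ n ih =>
    intro hn
    have hd := ih (by omega)
    have hfc : DifferentiableOn ℂ (fun l : ℂ ↦ f (relaxIterate f (t * l) n w)) U :=
      hf.comp hd fun l hl ↦ h n (by omega) l hl
    exact (hd.add ((differentiableOn_id.const_mul t).smul (hfc.sub hd))).congr
      fun l _ ↦ relaxIterate_succ _ _ _ _

/-- A function on the closed unit disc with value `l` at `0` and a double pole at `1` which is
real and nonnegative on the unit circle when `‖l‖ ≤ 1`. -/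
def circleWeight (l ζ : ℂ) : ℂ :=
  if ζ = 1 then 0
  else 1 + l.re + l.im * Complex.I * ((1 + ζ) / (1 - ζ)) - ((1 + ζ) / (1 - ζ)) ^ 2

@[simp] theorem circleWeight_one (l : ℂ) : circleWeight l 1 = 0 := if_pos rfl

@[simp] theorem circleWeight_zero (l : ℂ) : circleWeight l 0 = l := by
  simp only [circleWeight, zero_ne_one, if_false, add_zero, sub_zero, div_one, mul_one, one_pow]
  linear_combination Complex.re_add_im l

theorem differentiableOn_circleWeight (l : ℂ) : DifferentiableOn ℂ (circleWeight l) {1}ᶜ := by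
  have : DifferentiableOn ℂ (fun ζ : ℂ ↦ 1 + l.re + l.im * Complex.I * ((1 + ζ) / (1 - ζ))
      - ((1 + ζ) / (1 - ζ)) ^ 2) {1}ᶜ := by
    intro ζ hζ
    have h1 : 1 - ζ ≠ 0 := sub_ne_zero.2 (Ne.symm hζ)
    fun_prop (disch := assumption)
  exact this.congr fun ζ hζ ↦ if_neg hζ

theorem exists_nonneg_circleWeight_eq {l ζ : ℂ} (hl : ‖l‖ ≤ 1) (hζ : ‖ζ‖ = 1) (hζ1 : ζ ≠ 1) :
    ∃ x : ℝ, 0 ≤ x ∧ circleWeight l ζ = x := by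
  have h1 : 1 - ζ ≠ 0 := sub_ne_zero.2 hζ1.symm
  set W := (1 + ζ) / (1 - ζ) with hW
  have hWre : W.re = 0 := by
    have h0 : ζ ≠ 0 := by rintro rfl; simp at hζ
    have hconj : (starRingEnd ℂ) ζ = ζ⁻¹ := by
      rw [Complex.inv_def, Complex.normSq_eq_norm_sq, hζ]; simp
    have h2 : (starRingEnd ℂ) W = -W := by
      rw [hW, map_div₀, map_add, map_sub, map_one, hconj]
      have h3 : 1 - ζ⁻¹ ≠ 0 := by
        intro h; apply h1; field_simp at h; linear_combination -h
      have h4 : ζ - 1 ≠ 0 := sub_ne_zero.2 hζ1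
      field_simp
      ring
    have := congrArg Complex.re h2
    simp at this; linarith
  have hWy : W = W.im * Complex.I := by
    conv_lhs => rw [← Complex.re_add_im W, hWre]
    simp
  have hsq : l.re ^ 2 + l.im ^ 2 ≤ 1 := by
    have : ‖l‖ ^ 2 ≤ 1 := by nlinarith [norm_nonneg l]
    rw [Complex.sq_norm, Complex.normSq_apply] at this
    linarith
  refine ⟨1 + l.re - l.im * W.im + W.im ^ 2, ?_, ?_⟩
  · nlinarith [sq_nonneg (W.im - l.im / 2), sq_nonneg (l.re + 2)]
  · rw [circleWeight, if_neg hζ1, ← hW, hWy]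
    push_cast
    simp only [Complex.mul_I_im, Complex.ofReal_re]
    linear_combination (l.im * (W.im : ℂ) - (W.im : ℂ) ^ 2) * Complex.I_sq

theorem norm_circleWeight_mul_le {l ζ : ℂ} (hl : ‖l‖ ≤ 1) (hζ : ‖ζ‖ ≤ 1) :
    ‖circleWeight l ζ‖ * ‖1 - ζ‖ ^ 2 ≤ 16 := by
  by_cases hζ1 : ζ = 1
  · simp [hζ1]
  have h1 : 1 - ζ ≠ 0 := sub_ne_zero.2 (Ne.symm hζ1)
  have hre : ‖(l.re : ℂ)‖ ≤ 1 := by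
    rw [Complex.norm_real]; exact (Complex.abs_re_le_norm l).trans hl
  have him : ‖(l.im : ℂ)‖ ≤ 1 := by
    rw [Complex.norm_real]; exact (Complex.abs_im_le_norm l).trans hl
  have hm : ‖1 - ζ‖ ≤ 2 := (norm_sub_le _ _).trans (by simp; linarith)
  have hp : ‖1 + ζ‖ ≤ 2 := (norm_add_le _ _).trans (by simp; linarith)
  rw [circleWeight, if_neg hζ1, ← norm_pow, ← norm_mul]
  have : (1 + l.re + l.im * Complex.I * ((1 + ζ) / (1 - ζ)) - ((1 + ζ) / (1 - ζ)) ^ 2)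
      * (1 - ζ) ^ 2 = (1 + l.re) * (1 - ζ) ^ 2 + l.im * Complex.I * (1 + ζ) * (1 - ζ)
        - (1 + ζ) ^ 2 := by
    field_simp
  rw [this]
  calc _ ≤ ‖(1 + l.re) * (1 - ζ) ^ 2‖ + ‖l.im * Complex.I * (1 + ζ) * (1 - ζ)‖ + ‖(1 + ζ) ^ 2‖ :=
        (norm_sub_le _ _).trans (by gcongr; exact norm_add_le _ _)
    _ ≤ (1 + 1) * 2 ^ 2 + 1 * 1 * 2 * 2 + 2 ^ 2 := by
        simp only [norm_mul, norm_pow, Complex.norm_I]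
        gcongr
        exact (norm_add_le _ _).trans (by simpa using hre)
    _ ≤ 16 := by norm_num

theorem eq_self_of_flat {Ω : Set E} (hΩo : IsOpen Ω) (hΩb : Bornology.IsBounded Ω)
    (hΩc : Convex ℝ Ω) {f : E → E} (hf : DifferentiableOn ℂ f Ω) (hfm : MapsTo f Ω Ω) {ξ v : E}
    (hξ : ξ ∈ frontier Ω) (hlim : Tendsto (fun z ↦ ‖f z - z‖ / ‖z - ξ‖ ^ 4) (𝓝[Ω] ξ) (𝓝 0))
    {c : ℝ} (hc : 0 < c)
    (hdisc : ∀ ζ : ℂ, ‖ζ‖ ≤ 1 → ζ ≠ 1 → ∀ e : E, ‖e‖ ≤ c * ‖1 - ζ‖ ^ 2 → ξ + (ζ - 1) • v + e ∈ Ω) :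
    f (ξ - v) = ξ - v := by
  set w := ξ - v with hw
  have hwζ : ξ + ((0 : ℂ) - 1) • v = w := by rw [hw]; simp [sub_eq_add_neg]
  have hwΩ : w ∈ Ω := by
    have := hdisc 0 (by simp) (by simp) 0 (by simp; positivity)
    rwa [hwζ, add_zero] at this
  obtain ⟨M, hM0, hM⟩ := hΩb.exists_pos_norm_le
  have hC0 : 0 < ‖v‖ + 2 * c := by positivity
  have key : ∀ s : ℝ, 0 < s → s * ‖f w - w‖ ≤ 2 * M := by
    intro s hs
    set C := ‖v‖ + 2 * c with hC
    set η := c / (16 * s * C ^ 4) with hη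
    have hη0 : 0 < η := by positivity
    obtain ⟨ρ, hρ, hρη⟩ := (nhdsWithin_basis_ball.eventually_iff).1
      (hlim.eventually (ge_mem_nhds hη0))
    set r := ρ / (2 * C) with hr
    have hr0 : 0 < r := by positivity
    obtain ⟨N, hN⟩ := exists_nat_gt (16 * s / r ^ 2)
    have hN0 : (0 : ℝ) < N := lt_of_le_of_lt (by positivity) hN
    set t := s / N with ht
    have ht0 : 0 ≤ t := by positivity
    have hNt : N * t = s := by rw [ht]; field_simp
    have hmem : ∀ n ≤ N, ∀ l ∈ closedBall (0 : ℂ) 1, relaxIterate f (t * l) n w ∈ Ω := by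
      intro n hn l hl
      have hl' : ‖l‖ ≤ 1 := by simpa using hl
      have := relaxIterate_mem_of_flat hΩo hΩc hf hfm (frontier_subset_closure hξ) hc hdisc
        ((differentiableOn_circleWeight l).mono (fun ζ h ↦ by rintro rfl; simp at h))
        ((differentiableOn_circleWeight l).continuousOn.mono fun ζ h ↦ h.2)
        (circleWeight_one l) (fun ζ h h1 ↦ exists_nonneg_circleWeight_eq hl' h h1)
        (fun ζ h ↦ norm_circleWeight_mul_le hl' h) hr0 hη0.le ?_ ht0 ?_ (N := N) ?_ hn
        (ζ := 0) (by simp) (by simp)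
      · rwa [circleWeight_zero, hwζ] at this
      · intro z hz hzr
        have hzρ : ‖z - ξ‖ < ρ := by
          refine hzr.trans_lt ?_
          rw [← hC, hr]
          field_simp
          linarith
        have hne : z ≠ ξ := by
          rintro rfl
          exact (hΩo.frontier_eq ▸ hξ).2 hz
        have := hρη ⟨by simpa [dist_eq_norm] using hzρ, hz⟩
        rwa [div_le_iff₀ (pow_pos (norm_pos_iff.2 (sub_ne_zero.2 hne)) 4)] at this
      · rw [ht]
        rw [div_lt_iff₀ (by positivity)] at hN
        rw [← mul_div_assoc, div_le_iff₀ hN0]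
        linarith
      · rw [← hC, show (N : ℝ) * (16 * t * η * C ^ 4) = 16 * (N * t) * η * C ^ 4 by ring, hNt, hη]
        apply le_of_eq
        field_simp
    have hd := differentiableOn_relaxIterate hf hmem N le_rfl
    have hbound := Complex.norm_deriv_le_of_forall_mem_sphere_norm_le (R := 1) one_pos
      ((hd.mono (by rw [closure_ball _ one_ne_zero])).diffContOnCl) (C := M)
      (fun l hl ↦ hM _ (hmem N le_rfl l (sphere_subset_closedBall hl)))
    rw [(hasDerivAt_relaxIterate hΩo hf hwΩ t N).deriv, norm_smul, ← Complex.ofReal_natCast,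
      ← Complex.ofReal_mul, hNt, Complex.norm_of_nonneg hs.le] at hbound
    linarith
  by_contra hne
  have hpos : 0 < ‖f w - w‖ := norm_pos_iff.2 (sub_ne_zero.2 hne)
  have := key ((2 * M + 1) / ‖f w - w‖) (by positivity)
  rw [div_mul_cancel₀ _ hpos.ne'] at this
  linarith

end relaxIterate

theorem ContDiffAt.exists_le_add_fderiv_add_sq {E : Type*} [NormedAddCommGroup E] [NormedSpace ℝ E]
    {r : E → ℝ} {x : E} (hr : ContDiffAt ℝ 2 r x) :
    ∃ M : ℝ, 0 ≤ M ∧ ∀ᶠ h in 𝓝 (0 : E), r (x + h) ≤ r x + fderiv ℝ r x h + M * ‖h‖ ^ 2 := by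
  have hd : DifferentiableAt ℝ (fderiv ℝ r) x :=
    (hr.fderiv_right (m := 1) (by norm_num)).differentiableAt (by norm_num)
  obtain ⟨M, hM0, hM⟩ := hd.hasFDerivAt.isBigO_sub.exists_nonneg
  have hdiff : ∀ᶠ y in 𝓝 x, DifferentiableAt ℝ r y :=
    (hr.eventually (by simp)).mono fun y hy ↦ hy.differentiableAt (by norm_num)
  obtain ⟨δ, hδ, hball⟩ := Metric.eventually_nhds_iff_ball.1 (hM.bound.and hdiff)
  refine ⟨M, hM0, ?_⟩
  filter_upwards [ball_mem_nhds (0 : E) hδ] with h hh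
  rw [mem_ball_zero_iff] at hh
  have hsub : ∀ y ∈ closedBall x ‖h‖, y ∈ ball x δ := fun y hy ↦ closedBall_subset_ball hh hy
  have := (convex_closedBall x ‖h‖).norm_image_sub_le_of_norm_fderiv_le' (𝕜 := ℝ) (f := r)
    (φ := fderiv ℝ r x) (C := M * ‖h‖) (x := x) (y := x + h)
    (fun y hy ↦ (hball y (hsub y hy)).2)
    (fun y hy ↦ (hball y (hsub y hy)).1.trans (by
      gcongr; simpa [dist_eq_norm] using hy))
    (by simp) (by simp)
  rw [add_sub_cancel_left] at this
  have := (abs_le.1 this).2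
  linarith

theorem exists_tangent_discs {E : Type*} [NormedAddCommGroup E] [NormedSpace ℂ E] {Ω : Set E}
    {ξ u : E} (A : StrongDual ℝ E) {M : ℝ} (hM : 0 ≤ M)
    (hΩ : ∀ᶠ h in 𝓝 (0 : E), A h + M * ‖h‖ ^ 2 < 0 → ξ + h ∈ Ω)
    (hu : (A.extendRCLike : StrongDual ℂ E) u ≠ 0) :
    ∃ κ₀ : ℝ, 0 < κ₀ ∧ ∀ κ ∈ Ioo 0 κ₀, ∃ c : ℝ, 0 < c ∧ ∀ ζ : ℂ, ‖ζ‖ ≤ 1 → ζ ≠ 1 →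
      ∀ e : E, ‖e‖ ≤ c * ‖1 - ζ‖ ^ 2 →
        ξ + (ζ - 1) • (κ / (A.extendRCLike : StrongDual ℂ E) u) • u + e ∈ Ω := by
  set L : StrongDual ℂ E := A.extendRCLike with hL
  obtain ⟨δ, hδ, hball⟩ := Metric.eventually_nhds_iff_ball.1 hΩ
  set B := ‖u‖ / ‖L u‖ + 2 with hB
  have hB0 : 0 < B := by positivity
  set D := ‖A‖ + M * B ^ 2 + 1 with hD
  have hD0 : 0 < D := by positivity
  refine ⟨min 1 (min (δ / (2 * B)) (1 / (2 * D))), by positivity, ?_⟩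
  rintro κ ⟨hκ0, hκ⟩
  obtain ⟨hκ1, hκ2, hκ3⟩ : κ < 1 ∧ κ < δ / (2 * B) ∧ κ < 1 / (2 * D) := by
    simpa only [lt_min_iff] using hκ
  rw [lt_div_iff₀ (by positivity)] at hκ2 hκ3
  refine ⟨κ ^ 2, by positivity, fun ζ hζ hζ1 e he ↦ ?_⟩
  set x := ‖1 - ζ‖ with hx
  have hx0 : 0 < x := norm_pos_iff.2 (sub_ne_zero.2 hζ1.symm)
  have hx2 : x ≤ 2 := (norm_sub_le _ _).trans (by simp; linarith)
  set h := (ζ - 1) • (κ / L u) • u + e with hh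
  have hnv : ‖(ζ - 1) • (κ / L u) • u‖ = x * κ * (‖u‖ / ‖L u‖) := by
    rw [norm_smul, norm_smul, norm_div, Complex.norm_of_nonneg hκ0.le, norm_sub_rev]
    ring
  have hnh : ‖h‖ ≤ x * κ * B := by
    refine (norm_add_le _ _).trans ?_
    rw [hnv, hB]
    have : κ ^ 2 * x ^ 2 ≤ x * κ * 2 := by
      nlinarith [mul_pos hκ0 hx0, mul_le_mul hκ1.le hx2 hx0.le zero_le_one]
    linarith
  have hAh : A h ≤ -(κ * x ^ 2 / 2) + ‖A‖ * (κ ^ 2 * x ^ 2) := by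
    rw [hh, map_add]
    refine add_le_add ?_ ((le_abs_self _).trans ((A.le_opNorm e).trans (by gcongr)))
    have h1 : A ((ζ - 1) • (κ / L u) • u) = (L ((ζ - 1) • (κ / L u) • u)).re :=
      (StrongDual.re_extendRCLike_apply (𝕜 := ℂ) A _).symm
    rw [h1, map_smul, map_smul, smul_eq_mul, smul_eq_mul, div_mul_cancel₀ _ hu]
    have h2 : x ^ 2 = (1 - ζ.re) ^ 2 + ζ.im ^ 2 := by
      rw [hx, Complex.sq_norm, Complex.normSq_apply]; simp; ring
    have h3 : ζ.re ^ 2 + ζ.im ^ 2 ≤ 1 := by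
      have : ‖ζ‖ ^ 2 ≤ 1 := by nlinarith [norm_nonneg ζ]
      rw [Complex.sq_norm, Complex.normSq_apply] at this
      linarith
    simp only [Complex.mul_re, Complex.sub_re, Complex.one_re, Complex.ofReal_re,
      Complex.ofReal_im, mul_zero, sub_zero]
    nlinarith
  rw [add_assoc]
  refine hball h ?_ ?_
  · rw [mem_ball_zero_iff]
    refine hnh.trans_lt ?_
    nlinarith [mul_pos hκ0 hB0]
  · have hsq : M * ‖h‖ ^ 2 ≤ M * (x * κ * B) ^ 2 := by gcongr
    have : A h + M * ‖h‖ ^ 2 ≤ κ * x ^ 2 * (κ * D - 1 / 2) - κ ^ 2 * x ^ 2 := by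
      rw [hD]; nlinarith
    refine this.trans_lt ?_
    have h5 : κ * x ^ 2 * (κ * D - 1 / 2) ≤ 0 :=
      mul_nonpos_of_nonneg_of_nonpos (by positivity) (by linarith)
    have : 0 < κ ^ 2 * x ^ 2 := by positivity
    linarith

theorem ContinuousLinearMap.neg_of_nonpos_of_isOpen {E : Type*} [NormedAddCommGroup E]
    [NormedSpace ℝ E] {A : StrongDual ℝ E} (hA : A ≠ 0) {Ω : Set E} (hΩo : IsOpen Ω) {ξ : E}
    (h : ∀ z ∈ Ω, A (z - ξ) ≤ 0) {z : E} (hz : z ∈ Ω) : A (z - ξ) < 0 := by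
  have hopen : IsOpenMap A := A.isOpenMap_of_ne_zero hA
  have him : A '' Ω ⊆ Iic (A ξ) := by
    rintro _ ⟨y, hy, rfl⟩
    simpa using h y hy
  have := interior_maximal him (hopen _ hΩo) ⟨z, hz, rfl⟩
  rw [interior_Iic, mem_Iio] at this
  simpa using this

theorem Convex.fderiv_sub_nonpos {E : Type*} [NormedAddCommGroup E] [NormedSpace ℝ E] {Ω : Set E}
    (hΩo : IsOpen Ω) (hΩc : Convex ℝ Ω) {r : E → ℝ} {ξ : E} (hξ : ξ ∈ closure Ω)
    (hr : DifferentiableAt ℝ r ξ) (hle : ∀ z ∈ Ω, r z ≤ r ξ) {z : E} (hz : z ∈ Ω) :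
    fderiv ℝ r ξ (z - ξ) ≤ 0 := by
  have hmax : IsMaxOn r Ω ξ := hle
  refine hmax.localize.hasFDerivWithinAt_nonpos hr.hasFDerivAt.hasFDerivWithinAt
    (sub_mem_posTangentConeAt_of_openSegment_subset ?_)
  exact (hΩc.openSegment_closure_interior_subset_interior hξ
    (hΩo.interior_eq.symm ▸ hz)).trans interior_subset

/-- If `Ω ⊂ ℂ^d` is a bounded convex domain with `C²` boundary,
`f : Ω → Ω` is holomorphic and `f(z) = z + o(‖z - ξ₀‖⁴)` at some `ξ₀ ∈ ∂Ω`, then `f = id`. -/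
theorem statement0 {d : ℕ} (Ω : Set (EuclideanSpace ℂ (Fin d)))
    (hΩo : IsOpen Ω) (hΩne : Ω.Nonempty) (hΩb : Bornology.IsBounded Ω) (hΩc : Convex ℝ Ω)
    (hbd : ∃ (U : Set (EuclideanSpace ℂ (Fin d))) (r : EuclideanSpace ℂ (Fin d) → ℝ),
      IsOpen U ∧ closure Ω ⊆ U ∧ ContDiffOn ℝ 2 r U ∧
      Ω = {z | z ∈ U ∧ r z < 0} ∧ ∀ z ∈ frontier Ω, fderiv ℝ r z ≠ 0)
    (f : EuclideanSpace ℂ (Fin d) → EuclideanSpace ℂ (Fin d))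
    (hf : DifferentiableOn ℂ f Ω) (hfm : MapsTo f Ω Ω)
    (ξ₀ : EuclideanSpace ℂ (Fin d)) (hξ : ξ₀ ∈ frontier Ω)
    (hlim : Tendsto (fun z => ‖f z - z‖ / ‖z - ξ₀‖ ^ 4) (𝓝[Ω] ξ₀) (𝓝 0)) :
    EqOn f id Ω := by
  obtain ⟨U, r, hUo, hcU, hr, hΩ, hdr⟩ := hbd
  intro z hz
  have hξc := frontier_subset_closure hξ
  have hξΩ : ξ₀ ∉ Ω := (hΩo.frontier_eq ▸ hξ).2
  have hUξ := hUo.mem_nhds (hcU hξc)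
  have hrξ : ContDiffAt ℝ 2 r ξ₀ := hr.contDiffAt hUξ
  have hneg : ∀ y ∈ Ω, r y < 0 := fun y hy ↦ (hΩ ▸ hy : y ∈ {z | z ∈ U ∧ r z < 0}).2
  have hr0 : r ξ₀ = 0 := by
    apply le_antisymm
    · exact hrξ.continuousAt.continuousWithinAt.closure_le hξc continuousWithinAt_const
        fun y hy ↦ (hneg y hy).le
    · by_contra! h
      exact hξΩ (hΩ ▸ ⟨hcU hξc, h⟩)
  set A : StrongDual ℝ (EuclideanSpace ℂ (Fin d)) := fderiv ℝ r ξ₀ with hA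
  have hAneg : A (z - ξ₀) < 0 :=
    ContinuousLinearMap.neg_of_nonpos_of_isOpen (hdr _ hξ) hΩo (fun y hy ↦
      hΩc.fderiv_sub_nonpos hΩo hξc (hrξ.differentiableAt (by norm_num))
        (fun y hy ↦ hr0 ▸ (hneg y hy).le) hy) hz
  obtain ⟨M, hM0, hM⟩ := hrξ.exists_le_add_fderiv_add_sq
  have hloc : ∀ᶠ h in 𝓝 (0 : EuclideanSpace ℂ (Fin d)), A h + M * ‖h‖ ^ 2 < 0 → ξ₀ + h ∈ Ω := by
    have hU : ∀ᶠ h in 𝓝 (0 : EuclideanSpace ℂ (Fin d)), ξ₀ + h ∈ U := by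
      have : Tendsto (fun h ↦ ξ₀ + h) (𝓝 0) (𝓝 ξ₀) := by
        simpa using (continuous_const_add ξ₀).tendsto 0
      exact this hUξ
    filter_upwards [hM, hU] with h h1 h2 h3
    rw [hΩ]
    exact ⟨h2, by linarith⟩
  set u := ξ₀ - z with hu
  set a := (StrongDual.extendRCLike A : StrongDual ℂ (EuclideanSpace ℂ (Fin d))) u with ha
  have ha0 : a ≠ 0 := by
    intro h0
    have h1 := StrongDual.re_extendRCLike_apply (𝕜 := ℂ) A u
    rw [← ha, h0, hu, ← neg_sub z ξ₀, map_neg, map_zero] at h1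
    linarith
  obtain ⟨κ₀, hκ₀, hκ⟩ := exists_tangent_discs A hM0 hloc ha0
  have hfix : ∀ κ ∈ Ioo 0 κ₀, ξ₀ - (κ / a : ℂ) • u ∈ Ω ∧
      f (ξ₀ - (κ / a : ℂ) • u) = ξ₀ - (κ / a : ℂ) • u := by
    intro κ h
    obtain ⟨c, hc, hdisc⟩ := hκ κ h
    refine ⟨?_, eq_self_of_flat hΩo hΩb hΩc hf hfm hξ hlim hc hdisc⟩
    have := hdisc 0 (by simp) (by simp) 0 (by simp; positivity)
    simpa [sub_eq_add_neg] using this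
  set S : Set ℂ := {ζ | ξ₀ - ζ • u ∈ Ω} with hS
  have hSo : IsOpen S := hΩo.preimage (by fun_prop)
  have hSc : Convex ℝ S := by
    intro x hx y hy p q hp hq hpq
    have := hΩc hx hy hp hq hpq
    have h1 : p • (ξ₀ - x • u) + q • (ξ₀ - y • u) = (p + q) • ξ₀ - (p • x + q • y) • u := by
      rw [smul_sub p ξ₀, smul_sub q ξ₀, add_smul, add_smul, smul_assoc, smul_assoc,
        sub_add_sub_comm]
    rwa [h1, hpq, one_smul] at this
  set G : ℂ → EuclideanSpace ℂ (Fin d) := fun ζ ↦ f (ξ₀ - ζ • u) - (ξ₀ - ζ • u) with hG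
  have hGd : DifferentiableOn ℂ G S := by
    have hl : DifferentiableOn ℂ (fun ζ : ℂ ↦ ξ₀ - ζ • u) S := by fun_prop
    exact (hf.comp hl fun ζ h ↦ h).sub hl
  have hκm : κ₀ / 2 ∈ Ioo 0 κ₀ := ⟨by positivity, by linarith⟩
  have hfreq : ∃ᶠ ζ in 𝓝[≠] (((κ₀ / 2 : ℝ) : ℂ) / a), G ζ = 0 := by
    have ht : Tendsto (fun κ : ℝ ↦ (κ : ℂ) / a) (𝓝[≠] (κ₀ / 2)) (𝓝[≠] (((κ₀ / 2 : ℝ) : ℂ) / a)) := by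
      refine tendsto_nhdsWithin_iff.2 ⟨?_, ?_⟩
      · exact ((by fun_prop : Continuous fun κ : ℝ ↦ (κ : ℂ) / a).tendsto _).mono_left
          nhdsWithin_le_nhds
      · filter_upwards [self_mem_nhdsWithin] with κ h h'
        apply h
        have := (div_left_inj' ha0).1 h'
        exact_mod_cast this
    refine ht.frequently (Eventually.frequently ?_)
    filter_upwards [mem_nhdsWithin_of_mem_nhds (isOpen_Ioo.mem_nhds hκm)] with κ h
    exact sub_eq_zero.2 (hfix κ h).2
  have h0 := (hGd.analyticOnNhd hSo).eqOn_zero_of_preconnected_of_frequently_eq_zero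
    hSc.isPreconnected (hfix _ hκm).1 hfreq (show (1 : ℂ) ∈ S by simpa [hS, hu] using hz)
  simpa [hG, hu, sub_eq_zero] using h0

end
end

section
/- Suppose Ω ⊂ ℂ^d is a bounded convex domain with C^∞ boundary and f : Ω → Ω is a holomorphic map. If there exists ξ₀ ∈ ∂Ω with finite line type ℓ(ξ₀) < +∞ such that ‖f(z) − z‖ / ‖z − ξ₀‖^{4 − 1/ℓ(ξ₀)} → 0 as z → ξ₀ in Ω, then f is the identity map of Ω. -/
open Set Filter Metric Topology MeasureTheory Asymptotics

noncomputable section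

/-- The order of vanishing at `0 ∈ ℂ` of `g : ℂ → ℝ`: the largest `m` (possibly `∞`)
with `g = O(|t|^m)` as `t → 0`. -/
def vanishOrder (g : ℂ → ℝ) : ℕ∞ :=
  sSup ((fun m : ℕ => (m : ℕ∞)) '' {m : ℕ | (fun t => g t) =O[𝓝 (0:ℂ)] fun t => ‖t‖ ^ m})

/-- The line type of a boundary point `ξ`, relative to a defining function `r`: the supremum
over non-constant complex affine maps `ψ : ℂ → E` with `ψ 0 = ξ` of the order of vanishing
of `r ∘ ψ` at `0`. -/
def lineType {E : Type*} [NormedAddCommGroup E] [NormedSpace ℂ E]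
    (r : E → ℝ) (ξ : E) : ℕ∞ :=
  sSup { ν : ℕ∞ | ∃ b : E, b ≠ 0 ∧ ν = vanishOrder (fun t => r (ξ + t • b)) }

/-- The Cayley transform combined with the Schwarz lemma. -/
theorem norm_sub_le_of_re_pos {q : ℂ → ℂ} (hq : DifferentiableOn ℂ q (ball 0 1))
    (hpos : ∀ z ∈ ball (0 : ℂ) 1, 0 < (q z).re) {z : ℂ} (hz : z ∈ ball (0 : ℂ) 1) :
    ‖q z - q 0‖ ≤ ‖z‖ * ‖q z + (starRingEnd ℂ) (q 0)‖ := by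
  have h0 : 0 < (q 0).re := hpos 0 (by simp)
  have hne : ∀ w ∈ ball (0 : ℂ) 1, q w + (starRingEnd ℂ) (q 0) ≠ 0 := by
    intro w hw h
    have := congrArg Complex.re h
    simp at this
    linarith [hpos w hw]
  have hd : DifferentiableOn ℂ (fun w => (q w - q 0) / (q w + (starRingEnd ℂ) (q 0)))
      (ball 0 1) :=
    (hq.sub_const _).div (hq.add_const _) hne
  have hmap : MapsTo (fun w => (q w - q 0) / (q w + (starRingEnd ℂ) (q 0)))
      (ball 0 1) (closedBall ((fun w => (q w - q 0) / (q w + (starRingEnd ℂ) (q 0))) 0) 1) := by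
    intro w hw
    simp only [sub_self, zero_div, mem_closedBall, dist_zero_right, norm_div]
    apply div_le_one_of_le₀ _ (norm_nonneg _)
    rw [← sq_le_sq₀ (norm_nonneg _) (norm_nonneg _), ← Complex.normSq_eq_norm_sq,
      ← Complex.normSq_eq_norm_sq, Complex.normSq_apply, Complex.normSq_apply]
    simp
    nlinarith [hpos w hw]
  have := Complex.dist_le_div_mul_dist_of_mapsTo_ball hd hmap hz
  simp only [sub_self, zero_div, dist_zero_right, norm_div, div_one, one_mul] at this
  rwa [div_le_iff₀ (norm_pos_iff.2 (hne z hz))] at this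

theorem abs_re_sub_le_of_re_pos {q : ℂ → ℂ} (hq : DifferentiableOn ℂ q (ball 0 1))
    (hpos : ∀ z ∈ ball (0 : ℂ) 1, 0 < (q z).re) {z : ℂ} (hz : z ∈ ball (0 : ℂ) 1) :
    |(q z).re - (q 0).re| ≤ ‖z‖ * ((q z).re + (q 0).re) := by
  have h0 : 0 < (q 0).re := hpos 0 (by simp)
  have hz' := hpos z hz
  have hz1 : ‖z‖ < 1 := by simpa using hz
  have h := norm_sub_le_of_re_pos hq hpos hz
  rw [← sq_le_sq₀ (norm_nonneg _) (by positivity), mul_pow,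
      ← Complex.normSq_eq_norm_sq (q z - q 0), ← Complex.normSq_eq_norm_sq (q z + _),
      Complex.normSq_apply, Complex.normSq_apply] at h
  simp at h
  apply abs_le_of_sq_le_sq _ (by positivity)
  have h1 : ‖z‖ ^ 2 ≤ 1 := pow_le_one₀ (norm_nonneg _) hz1.le
  nlinarith [mul_nonneg (sub_nonneg.2 h1) (sq_nonneg ((q z).im - (q 0).im))]

/-- Derivative bound at the centre for holomorphic functions with positive real part. -/
theorem norm_deriv_le_two_mul_re {q : ℂ → ℂ} (hq : DifferentiableOn ℂ q (ball 0 1))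
    (hpos : ∀ z ∈ ball (0 : ℂ) 1, 0 < (q z).re) : ‖deriv q 0‖ ≤ 2 * (q 0).re := by
  have h0 : 0 < (q 0).re := hpos 0 (by simp)
  have hda : DifferentiableAt ℂ q 0 := hq.differentiableAt (ball_mem_nhds _ one_pos)
  have hlim := hda.hasDerivAt.tendsto_slope.norm
  have hc : Tendsto (fun z => ‖q z + (starRingEnd ℂ) (q 0)‖) (𝓝[≠] 0)
      (𝓝 ‖q 0 + (starRingEnd ℂ) (q 0)‖) :=
    ((hda.continuousAt.add continuousAt_const).norm).tendsto.mono_left nhdsWithin_le_nhds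
  have hval : ‖q 0 + (starRingEnd ℂ) (q 0)‖ = 2 * (q 0).re := by
    rw [Complex.add_conj, Complex.norm_real, Real.norm_of_nonneg (by positivity)]
  rw [← hval]
  refine le_of_tendsto_of_tendsto hlim hc ?_
  have : ball (0 : ℂ) 1 ∈ 𝓝[≠] (0 : ℂ) := mem_nhdsWithin_of_mem_nhds (ball_mem_nhds _ one_pos)
  filter_upwards [this, self_mem_nhdsWithin] with z hz hz0
  rw [slope_def_field, norm_div, sub_zero, div_le_iff₀ (norm_pos_iff.2 hz0), mul_comm]
  exact norm_sub_le_of_re_pos hq hpos hz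

/-- Harnack inequality towards the boundary along a radius. -/
theorem re_mul_one_sub_le_of_re_pos {q : ℂ → ℂ} (hq : DifferentiableOn ℂ q (ball 0 1))
    (hpos : ∀ z ∈ ball (0 : ℂ) 1, 0 < (q z).re) {t s : ℝ} (ht : 0 ≤ t) (hts : t ≤ s)
    (hs : s < 1) : (1 - s) * (q t).re ≤ 2 * (1 - t) * (q s).re := by
  have ht1 : 0 < 1 - t := by linarith
  have hmaps : MapsTo (fun z : ℂ => (t : ℂ) + (1 - t : ℝ) * z) (ball 0 1) (ball 0 1) := by
    intro z hz
    simp only [mem_ball, dist_zero_right] at hz ⊢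
    calc ‖(t : ℂ) + (1 - t : ℝ) * z‖ ≤ ‖(t : ℂ)‖ + ‖((1 - t : ℝ) : ℂ) * z‖ := norm_add_le _ _
      _ = t + (1 - t) * ‖z‖ := by
        rw [norm_mul, Complex.norm_real, Complex.norm_real, Real.norm_of_nonneg ht,
          Real.norm_of_nonneg ht1.le]
      _ < 1 := by nlinarith
  have hd : DifferentiableOn ℂ (fun z : ℂ => q ((t : ℂ) + (1 - t : ℝ) * z)) (ball 0 1) :=
    hq.comp (by fun_prop) hmaps
  have hσ0 : 0 ≤ (s - t) / (1 - t) := div_nonneg (by linarith) ht1.le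
  have hσ1 : (s - t) / (1 - t) < 1 := by rw [div_lt_one ht1]; linarith
  have hz : (((s - t) / (1 - t) : ℝ) : ℂ) ∈ ball (0 : ℂ) 1 := by
    rw [mem_ball, dist_zero_right, Complex.norm_real, Real.norm_of_nonneg hσ0]
    exact hσ1
  have h := abs_re_sub_le_of_re_pos hd (fun z hz => hpos _ (hmaps hz)) hz
  have hs' : (t : ℂ) + (1 - t : ℝ) * (((s - t) / (1 - t) : ℝ) : ℂ) = s := by
    rw [← Complex.ofReal_mul, mul_div_cancel₀ _ ht1.ne']; push_cast; ring
  rw [hs', Complex.norm_real, Real.norm_of_nonneg hσ0] at h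
  simp only [mul_zero, add_zero] at h
  have h2 := (abs_le.1 h).1
  rw [div_mul_eq_mul_div, ← neg_div, div_le_iff₀ ht1] at h2
  have hqs : 0 < (q s).re := hpos _ (by
    rw [mem_ball, dist_zero_right, Complex.norm_real, Real.norm_of_nonneg (ht.trans hts)]
    exact hs)
  nlinarith

theorem re_mul_one_sub_le_two_mul_re_zero {q : ℂ → ℂ} (hq : DifferentiableOn ℂ q (ball 0 1))
    (hpos : ∀ z ∈ ball (0 : ℂ) 1, 0 < (q z).re) {t : ℝ} (ht : 0 ≤ t) (ht1 : t < 1) :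
    (1 - t) * (q t).re ≤ 2 * (q 0).re := by
  have hz : (t : ℂ) ∈ ball (0 : ℂ) 1 := by
    rw [mem_ball, dist_zero_right, Complex.norm_real, Real.norm_of_nonneg ht]; exact ht1
  have h := (abs_le.1 (abs_re_sub_le_of_re_pos hq hpos hz)).2
  rw [Complex.norm_real, Real.norm_of_nonneg ht] at h
  nlinarith [hpos 0 (by simp), hpos t hz]

section Convex

variable {E : Type*} [NormedAddCommGroup E] [NormedSpace ℂ E]

theorem exists_re_pos_of_notMem {Ω : Set E} (hΩo : IsOpen Ω) (hΩc : Convex ℝ Ω) {x : E}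
    (hx : x ∉ Ω) : ∃ L : E →L[ℂ] ℂ, ∀ y ∈ Ω, 0 < (L (y - x)).re := by
  obtain ⟨L, hL⟩ := RCLike.geometric_hahn_banach_open_point (𝕜 := ℂ) hΩc hΩo hx
  refine ⟨-L, fun y hy => ?_⟩
  have := hL y hy
  simp only [RCLike.re_to_complex] at this
  simp [map_sub]
  linarith

/-- A holomorphic disc in a convex domain has a quarter of its first-order jet in the domain. -/
theorem add_smul_deriv_mem {Ω : Set E} (hΩo : IsOpen Ω) (hΩc : Convex ℝ Ω) {g : ℂ → E}
    (hg : DifferentiableOn ℂ g (ball 0 1)) (hgm : MapsTo g (ball 0 1) Ω) {ζ : ℂ} (hζ : ‖ζ‖ ≤ 1) :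
    g 0 + ζ • ((1 / 4 : ℂ) • deriv g 0) ∈ Ω := by
  by_contra hx
  obtain ⟨L, hL⟩ := exists_re_pos_of_notMem hΩo hΩc hx
  set x := g 0 + ζ • ((1 / 4 : ℂ) • deriv g 0) with hxdef
  have hq : DifferentiableOn ℂ (fun z => L (g z - x)) (ball 0 1) :=
    L.differentiable.comp_differentiableOn (hg.sub_const x)
  have hpos : ∀ z ∈ ball (0 : ℂ) 1, 0 < (L (g z - x)).re := fun z hz => hL _ (hgm hz)
  have h := norm_deriv_le_two_mul_re hq hpos
  have hda : HasDerivAt g (deriv g 0) 0 :=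
    (hg.differentiableAt (ball_mem_nhds _ one_pos)).hasDerivAt
  have hd : deriv (fun z => L (g z - x)) 0 = L (deriv g 0) :=
    (L.hasFDerivAt.comp_hasDerivAt (0 : ℂ) (hda.sub_const x)).deriv
  rw [hd] at h
  have h0 := hpos 0 (by simp)
  have e : L (g 0 - x) = -(ζ * ((1 / 4) * L (deriv g 0))) := by
    rw [hxdef]; simp [smul_eq_mul]
  have h1 : (L (g 0 - x)).re ≤ 1 / 4 * ‖L (deriv g 0)‖ := by
    refine (Complex.re_le_norm _).trans ?_
    rw [e, norm_neg, norm_mul, norm_mul]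
    have : ‖(1 / 4 : ℂ)‖ = 1 / 4 := by norm_num
    rw [this]
    have h3 : 0 ≤ 1 / 4 * ‖L (deriv g 0)‖ := by positivity
    nlinarith
  linarith

end Convex

section Taylor

/-- Taylor's formula with a crude remainder for a family of successive derivatives. -/
theorem abs_sub_taylor_le {η K : ℝ} (n : ℕ) : ∀ (g : ℕ → ℝ → ℝ),
    (∀ k, ∀ t ∈ Icc 0 η, HasDerivAt (g k) (g (k + 1) t) t) →
    (∀ t ∈ Icc 0 η, |g n t| ≤ K) → ∀ t ∈ Icc 0 η,
    |g 0 t - ∑ j ∈ Finset.range n, g j 0 / (j.factorial : ℝ) * t ^ j| ≤ K * t ^ n := by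
  induction n with
  | zero => intro g _ hK t ht; simpa using hK t ht
  | succ n ih =>
    intro g hg hK t ht
    have hIH := ih (fun k => g (k + 1)) (fun k => hg (k + 1)) hK
    have hK0 : 0 ≤ K := (abs_nonneg _).trans (hK t ht)
    set u : ℝ → ℝ := fun t => g 0 t - ∑ j ∈ Finset.range (n + 1),
      g j 0 / (j.factorial : ℝ) * t ^ j with hu
    have hu' : ∀ s ∈ Icc 0 η, HasDerivAt u (g 1 s - ∑ j ∈ Finset.range n,
        g (j + 1) 0 / (j.factorial : ℝ) * s ^ j) s := by
      intro s hs
      refine (hg 0 s hs).sub ?_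
      have h1 : HasDerivAt (fun t : ℝ => ∑ j ∈ Finset.range (n + 1),
          g j 0 / (j.factorial : ℝ) * t ^ j)
          (∑ j ∈ Finset.range (n + 1), g j 0 / (j.factorial : ℝ) * (j * s ^ (j - 1))) s :=
        HasDerivAt.fun_sum fun j _ => (hasDerivAt_pow j s).const_mul _
      have h2 : ∑ j ∈ Finset.range (n + 1), g j 0 / (j.factorial : ℝ) * (j * s ^ (j - 1)) =
          ∑ j ∈ Finset.range n, g (j + 1) 0 / (j.factorial : ℝ) * s ^ j := by
        rw [Finset.sum_range_succ']
        simp only [CharP.cast_eq_zero, zero_mul, mul_zero, add_zero]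
        refine Finset.sum_congr rfl fun j _ => ?_
        rw [Nat.factorial_succ]
        have : (j.factorial : ℝ) ≠ 0 := by positivity
        push_cast
        have : ((j : ℝ) + 1) ≠ 0 := by positivity
        field_simp
      rwa [h2] at h1
    have hsub : Icc (0 : ℝ) t ⊆ Icc 0 η := Icc_subset_Icc le_rfl ht.2
    have hb := (convex_Icc (0 : ℝ) t).norm_image_sub_le_of_norm_hasDerivWithin_le (C := K * t ^ n)
      (fun s hs => (hu' s (hsub hs)).hasDerivWithinAt)
      (fun s hs => (hIH s (hsub hs)).trans
        (mul_le_mul_of_nonneg_left (pow_le_pow_left₀ hs.1 hs.2 n) hK0))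
      (left_mem_Icc.2 ht.1) (right_mem_Icc.2 ht.1)
    have hu0 : u 0 = 0 := by
      simp only [hu]
      rw [Finset.sum_range_succ']
      simp
    rw [hu0, sub_zero, sub_zero, Real.norm_eq_abs, Real.norm_of_nonneg ht.1] at hb
    rw [pow_succ, ← mul_assoc]
    exact hb

/-- The coefficients of a polynomial are controlled by its values on an interval. -/
theorem exists_coeff_bound (n : ℕ) : ∃ C > 0, ∀ (a : ℕ → ℝ) (η M : ℝ), 0 ≤ η →
    (∀ t ∈ Icc 0 η, |∑ j ∈ Finset.range n, a j * t ^ j| ≤ M) →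
    ∀ j < n, |a j| * η ^ j ≤ C * M := by
  classical
  set x : Fin n → ℝ := fun i => (i + 1) / (n + 1) with hx
  have hxinj : Function.Injective x := by
    intro i j hij
    have h1 : (n : ℝ) + 1 ≠ 0 := by positivity
    simp only [hx] at hij
    field_simp at hij
    have : (i : ℝ) = j := by linarith
    exact Fin.ext (by exact_mod_cast this)
  set V := Matrix.vandermonde x with hV
  have hdet : IsUnit V.det := isUnit_iff_ne_zero.2 (Matrix.det_vandermonde_ne_zero_iff.2 hxinj)
  refine ⟨1 + ∑ j, ∑ i, |V⁻¹ j i|, by positivity, fun a η M hη hM j hj => ?_⟩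
  have hM0 : 0 ≤ M := (abs_nonneg _).trans (hM 0 (left_mem_Icc.2 hη))
  set b : Fin n → ℝ := fun j => a j * η ^ (j : ℕ) with hb
  have hval : ∀ i, |V.mulVec b i| ≤ M := by
    intro i
    have hxi : x i * η ∈ Icc 0 η := by
      have h0 : 0 ≤ x i := by simp only [hx]; positivity
      have h1 : x i ≤ 1 := by
        simp only [hx]
        rw [div_le_one (by positivity)]
        have : ((i : ℕ) : ℝ) < n := by exact_mod_cast i.2
        linarith
      exact ⟨by positivity, by nlinarith⟩
    convert hM _ hxi using 2
    rw [Matrix.mulVec, dotProduct, Finset.sum_range]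
    refine Finset.sum_congr rfl fun j _ => ?_
    simp only [hV, Matrix.vandermonde_apply, hb, mul_pow]
    ring
  have hbv : b = V⁻¹.mulVec (V.mulVec b) := by
    rw [Matrix.mulVec_mulVec, Matrix.nonsing_inv_mul _ hdet, Matrix.one_mulVec]
  have hj' : |b ⟨j, hj⟩| = |a j| * η ^ j := by
    simp only [hb, abs_mul, abs_of_nonneg (pow_nonneg hη j)]
  rw [← hj', hbv, Matrix.mulVec, dotProduct]
  calc |∑ i, V⁻¹ ⟨j, hj⟩ i * V.mulVec b i| ≤ ∑ i, |V⁻¹ ⟨j, hj⟩ i * V.mulVec b i| :=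
        Finset.abs_sum_le_sum_abs _ _
    _ ≤ ∑ i, |V⁻¹ ⟨j, hj⟩ i| * M := Finset.sum_le_sum fun i _ => by
        rw [abs_mul]; exact mul_le_mul_of_nonneg_left (hval i) (abs_nonneg _)
    _ = (∑ i, |V⁻¹ ⟨j, hj⟩ i|) * M := by rw [Finset.sum_mul]
    _ ≤ (1 + ∑ j, ∑ i, |V⁻¹ j i|) * M := by
        refine mul_le_mul_of_nonneg_right ?_ hM0
        have := Finset.single_le_sum (f := fun j => ∑ i, |V⁻¹ j i|)
          (fun j _ => Finset.sum_nonneg fun i _ => abs_nonneg _) (Finset.mem_univ ⟨j, hj⟩)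
        linarith

end Taylor

section DirDeriv

variable {E : Type*} [NormedAddCommGroup E] [NormedSpace ℝ E]

/-- Iterated directional derivatives, as functions of the point and the direction. -/
def dirDeriv (r : E → ℝ) : ℕ → E × E → ℝ
  | 0 => fun p => r p.1
  | k + 1 => fun p => fderiv ℝ (dirDeriv r k) p (p.2, 0)

variable {U : Set E} {r : E → ℝ}

theorem contDiffOn_dirDeriv (hU : IsOpen U) (hr : ContDiffOn ℝ (⊤ : ℕ∞) r U) (k : ℕ) :
    ContDiffOn ℝ (⊤ : ℕ∞) (dirDeriv r k) (U ×ˢ univ) := by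
  induction k with
  | zero => exact hr.comp contDiff_fst.contDiffOn fun p hp => hp.1
  | succ k ih =>
    exact (ih.fderiv_of_isOpen (hU.prod isOpen_univ) (m := (⊤ : ℕ∞)) (by simp)).clm_apply
      (by fun_prop)

theorem hasDerivAt_dirDeriv (hU : IsOpen U) (hr : ContDiffOn ℝ (⊤ : ℕ∞) r U) (k : ℕ) {y w : E}
    {t : ℝ} (ht : y + t • w ∈ U) :
    HasDerivAt (fun t : ℝ => dirDeriv r k (y + t • w, w))
      (dirDeriv r (k + 1) (y + t • w, w)) t := by
  have h1 : DifferentiableAt ℝ (dirDeriv r k) (y + t • w, w) :=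
    ((contDiffOn_dirDeriv hU hr k).differentiableOn (by simp)).differentiableAt
      ((hU.prod isOpen_univ).mem_nhds ⟨ht, mem_univ _⟩)
  have h2 : HasDerivAt (fun t : ℝ => (y + t • w, w)) (w, 0) t := by
    refine HasDerivAt.prodMk ?_ (hasDerivAt_const t w)
    simpa using ((hasDerivAt_id t).smul_const w).const_add y
  exact h1.hasFDerivAt.comp_hasDerivAt t h2

theorem dirDeriv_one (hU : IsOpen U) (hr : ContDiffOn ℝ (⊤ : ℕ∞) r U) {y w : E} (hy : y ∈ U) :
    dirDeriv r 1 (y, w) = fderiv ℝ r y w := by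
  have hd : DifferentiableAt ℝ r y :=
    (hr.differentiableOn (by simp)).differentiableAt (hU.mem_nhds hy)
  have : HasFDerivAt (dirDeriv r 0) ((fderiv ℝ r y).comp (ContinuousLinearMap.fst ℝ E E)) (y, w) :=
    HasFDerivAt.comp (y, w) hd.hasFDerivAt hasFDerivAt_fst
  change fderiv ℝ (dirDeriv r 0) (y, w) (w, 0) = _
  simp [this.fderiv]

/-- Taylor's formula along segments, locally uniformly in the base point and the direction. -/
theorem exists_taylor_dirDeriv [FiniteDimensional ℝ E] (hU : IsOpen U)
    (hr : ContDiffOn ℝ (⊤ : ℕ∞) r U) {ξ : E} (hξ : ξ ∈ U) (n : ℕ) :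
    ∃ K > 0, ∃ ρ > 0, ∀ y ∈ ball ξ ρ, ∀ w : E, ‖w‖ ≤ 1 → ∀ t ∈ Icc 0 ρ,
      y + t • w ∈ U ∧
      |r (y + t • w) - ∑ j ∈ Finset.range n, dirDeriv r j (y, w) / (j.factorial : ℝ) * t ^ j|
        ≤ K * t ^ n := by
  obtain ⟨ρ, hρ, hρU⟩ := nhds_basis_closedBall.mem_iff.1 (hU.mem_nhds hξ)
  have hcpt : IsCompact (closedBall ξ ρ ×ˢ closedBall (0 : E) 1) :=
    (isCompact_closedBall _ _).prod (isCompact_closedBall _ _)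
  obtain ⟨K, hK⟩ := hcpt.exists_bound_of_continuousOn (f := dirDeriv r n)
    ((contDiffOn_dirDeriv hU hr n).continuousOn.mono (prod_mono hρU (subset_univ _)))
  have hmem : ∀ y ∈ ball ξ (ρ / 2), ∀ w : E, ‖w‖ ≤ 1 → ∀ t ∈ Icc 0 (ρ / 2),
      y + t • w ∈ closedBall ξ ρ := by
    intro y hy w hw t ht
    rw [mem_ball, dist_eq_norm] at hy
    rw [mem_closedBall, dist_eq_norm]
    calc ‖y + t • w - ξ‖ = ‖(y - ξ) + t • w‖ := by congr 1; abel
      _ ≤ ‖y - ξ‖ + ‖t • w‖ := norm_add_le _ _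
      _ ≤ ρ / 2 + ρ / 2 := by
        rw [norm_smul, Real.norm_of_nonneg ht.1]
        have : t * ‖w‖ ≤ t := mul_le_of_le_one_right ht.1 hw
        linarith [ht.2]
      _ = ρ := by ring
  refine ⟨max K 1, by positivity, ρ / 2, by positivity, fun y hy w hw t ht =>
    ⟨hρU (hmem y hy w hw t ht), ?_⟩⟩
  have := abs_sub_taylor_le (K := max K 1) n (fun k t => dirDeriv r k (y + t • w, w))
    (fun k t ht => hasDerivAt_dirDeriv hU hr k (hρU (hmem y hy w hw t ht)))
    (fun t ht => (hK _ ⟨hmem y hy w hw t ht, by simpa using hw⟩).trans (le_max_left _ _)) t ht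
  simpa [dirDeriv] using this

end DirDeriv

section SmoothDomain

variable {E : Type*} [NormedAddCommGroup E] [NormedSpace ℝ E] {Ω U : Set E} {r : E → ℝ} {ξ : E}

theorem frontier_defining_function (hΩo : IsOpen Ω) (hUcl : closure Ω ⊆ U) (hUo : IsOpen U)
    (hr : ContDiffOn ℝ (⊤ : ℕ∞) r U) (hΩdef : Ω = {z | z ∈ U ∧ r z < 0})
    (hξ : ξ ∈ frontier Ω) : ξ ∈ U ∧ ξ ∉ Ω ∧ r ξ = 0 := by
  have hcl : ξ ∈ closure Ω := hξ.1
  have hU := hUcl hcl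
  have hn : ξ ∉ Ω := by
    have := hξ.2
    rwa [hΩo.interior_eq] at this
  refine ⟨hU, hn, le_antisymm ?_ ?_⟩
  · have hc : ContinuousAt r ξ := hr.continuousOn.continuousAt (hUo.mem_nhds hU)
    have : (𝓝[Ω] ξ).NeBot := mem_closure_iff_nhdsWithin_neBot.1 hcl
    have ht : Tendsto r (𝓝[Ω] ξ) (𝓝 (r ξ)) := hc.tendsto.mono_left nhdsWithin_le_nhds
    refine le_of_tendsto ht ?_
    filter_upwards [self_mem_nhdsWithin] with z hz
    rw [hΩdef] at hz
    exact hz.2.le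
  · by_contra h
    apply hn
    rw [hΩdef]
    exact ⟨hU, not_le.1 h⟩

theorem fderiv_neg_of_mem (hΩo : IsOpen Ω) (hΩc : Convex ℝ Ω) (hUcl : closure Ω ⊆ U)
    (hUo : IsOpen U) (hr : ContDiffOn ℝ (⊤ : ℕ∞) r U) (hΩdef : Ω = {z | z ∈ U ∧ r z < 0})
    (hξ : ξ ∈ frontier Ω) (hgrad : fderiv ℝ r ξ ≠ 0) {y : E} (hy : y ∈ Ω) :
    fderiv ℝ r ξ (y - ξ) < 0 := by
  obtain ⟨hU, hn, hr0⟩ := frontier_defining_function hΩo hUcl hUo hr hΩdef hξ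
  have hd : HasFDerivAt r (fderiv ℝ r ξ) ξ :=
    ((hr.differentiableOn (by simp)).differentiableAt (hUo.mem_nhds hU)).hasFDerivAt
  have hle : ∀ y ∈ Ω, fderiv ℝ r ξ (y - ξ) ≤ 0 := by
    intro y hy
    have h1 : HasDerivAt (fun t : ℝ => r (ξ + t • (y - ξ))) (fderiv ℝ r ξ (y - ξ)) 0 := by
      have h2 : HasDerivAt (fun t : ℝ => ξ + t • (y - ξ)) (y - ξ) 0 := by
        simpa using ((hasDerivAt_id (0 : ℝ)).smul_const (y - ξ)).const_add ξ
      refine HasFDerivAt.comp_hasDerivAt (0 : ℝ) ?_ h2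
      simpa using hd
    refine le_of_tendsto h1.tendsto_slope_zero_right ?_
    have : Ioo (0 : ℝ) 1 ∈ 𝓝[>] (0 : ℝ) := Ioo_mem_nhdsGT one_pos
    filter_upwards [this] with t ht
    have hm : ξ + t • (y - ξ) ∈ Ω := by
      have := hΩc.add_smul_sub_mem_interior' hξ.1 (by rwa [hΩo.interior_eq]) ⟨ht.1, ht.2.le⟩
      rwa [hΩo.interior_eq] at this
    rw [hΩdef] at hm
    simp only [zero_add, zero_smul, add_zero, hr0, sub_zero, smul_eq_mul]
    exact mul_nonpos_of_nonneg_of_nonpos (inv_nonneg.2 ht.1.le) hm.2.le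
  obtain ⟨n, hnn⟩ : ∃ n, 0 < fderiv ℝ r ξ n := by
    obtain ⟨n, hn⟩ := DFunLike.ne_iff.1 hgrad
    rcases lt_or_gt_of_ne hn with h | h
    · exact ⟨-n, by simpa using h⟩
    · exact ⟨n, by simpa using h⟩
  have hc : Tendsto (fun t : ℝ => y + t • n) (𝓝[>] 0) (𝓝 y) := by
    have : Continuous fun t : ℝ => y + t • n := by fun_prop
    simpa using (this.tendsto 0).mono_left nhdsWithin_le_nhds
  obtain ⟨t, ht, ht0⟩ := ((hc.eventually (hΩo.mem_nhds hy)).and self_mem_nhdsWithin).exists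
  have := hle _ ht
  rw [add_sub_right_comm, map_add, map_smul, smul_eq_mul] at this
  have h3 : 0 < t * fderiv ℝ r ξ n := mul_pos ht0 hnn
  linarith

theorem exists_interior_paraboloid [FiniteDimensional ℝ E] (hΩo : IsOpen Ω)
    (hUcl : closure Ω ⊆ U)
    (hUo : IsOpen U) (hr : ContDiffOn ℝ (⊤ : ℕ∞) r U) (hΩdef : Ω = {z | z ∈ U ∧ r z < 0})
    (hξ : ξ ∈ frontier Ω) :
    ∃ C > 0, ∀ y, C * ‖y - ξ‖ ^ 2 < -fderiv ℝ r ξ (y - ξ) → y ∈ Ω := by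
  obtain ⟨hU, hn, hr0⟩ := frontier_defining_function hΩo hUcl hUo hr hΩdef hξ
  obtain ⟨K, hK, ρ, hρ, hT⟩ := exists_taylor_dirDeriv hUo hr hU 2
  set A := ‖fderiv ℝ r ξ‖ with hA
  have hA0 : 0 ≤ A := norm_nonneg _
  refine ⟨K + A / ρ, by positivity, fun y hy => ?_⟩
  have hb : -fderiv ℝ r ξ (y - ξ) ≤ A * ‖y - ξ‖ :=
    (neg_le_abs _).trans ((fderiv ℝ r ξ).le_opNorm _)
  have hy0 : 0 < ‖y - ξ‖ := by
    rw [norm_pos_iff]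
    intro h
    simp [h] at hy
  have hlt : ‖y - ξ‖ ≤ ρ := by
    by_contra h
    push Not at h
    have h1 : A / ρ * ‖y - ξ‖ ^ 2 < A * ‖y - ξ‖ :=
      lt_of_le_of_lt (by nlinarith [sq_nonneg ‖y - ξ‖]) (hy.trans_le hb)
    rw [div_mul_eq_mul_div, div_lt_iff₀ hρ] at h1
    nlinarith [mul_nonneg (mul_nonneg hA0 hy0.le) (sub_nonneg.2 h.le)]
  have h := hT ξ (mem_ball_self hρ) (‖y - ξ‖⁻¹ • (y - ξ)) (by
    rw [norm_smul, norm_inv, norm_norm, inv_mul_cancel₀ hy0.ne']) ‖y - ξ‖ ⟨hy0.le, hlt⟩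
  rw [smul_smul, mul_inv_cancel₀ hy0.ne', one_smul, add_sub_cancel, Finset.sum_range_succ,
    Finset.sum_range_succ, Finset.sum_range_zero, dirDeriv_one hUo hr hU] at h
  have h0 : dirDeriv r 0 (ξ, ‖y - ξ‖⁻¹ • (y - ξ)) = 0 := hr0
  rw [h0, map_smul] at h
  simp only [zero_div, zero_mul, zero_add, Nat.factorial_one, Nat.cast_one, div_one, pow_one,
    smul_eq_mul] at h
  rw [mul_comm _ ‖y - ξ‖, ← mul_assoc, mul_inv_cancel₀ hy0.ne', one_mul] at h
  rw [hΩdef]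
  refine ⟨h.1, ?_⟩
  have h2 := (abs_le.1 h.2).2
  have h3 : 0 ≤ A / ρ * ‖y - ξ‖ ^ 2 := by positivity
  linarith

theorem exists_neg_defining_le (hΩo : IsOpen Ω) (hΩc : Convex ℝ Ω) (hUcl : closure Ω ⊆ U)
    (hUo : IsOpen U) (hr : ContDiffOn ℝ (⊤ : ℕ∞) r U) (hΩdef : Ω = {z | z ∈ U ∧ r z < 0})
    (hξ : ξ ∈ frontier Ω) (hgrad : fderiv ℝ r ξ ≠ 0) :
    ∃ C > 0, ∃ ρ > 0, ∀ y ∈ Ω, ‖y - ξ‖ < ρ → -r y ≤ C * -fderiv ℝ r ξ (y - ξ) := by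
  obtain ⟨hU, hn, hr0⟩ := frontier_defining_function hΩo hUcl hUo hr hΩdef hξ
  obtain ⟨n, hnn⟩ : ∃ n, fderiv ℝ r ξ n = 1 := by
    obtain ⟨n, hn⟩ := DFunLike.ne_iff.1 hgrad
    refine ⟨(fderiv ℝ r ξ n)⁻¹ • n, ?_⟩
    rw [map_smul, smul_eq_mul, inv_mul_cancel₀ hn]
  have hcd : ContDiffAt ℝ 1 r ξ := (hr.contDiffAt (hUo.mem_nhds hU)).of_le (by
    exact_mod_cast le_top)
  obtain ⟨K, t, ht, hL⟩ := hcd.exists_lipschitzOnWith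
  obtain ⟨ρ, hρ, hρt⟩ := nhds_basis_ball.mem_iff.1 (inter_mem ht (hUo.mem_nhds hU))
  set A := ‖fderiv ℝ r ξ‖ with hA
  have hA0 : 0 ≤ A := norm_nonneg _
  refine ⟨K * ‖n‖ + 1, by positivity, ρ / (1 + A * ‖n‖), by positivity, fun y hy hyρ => ?_⟩
  have hh := fderiv_neg_of_mem hΩo hΩc hUcl hUo hr hΩdef hξ hgrad hy
  set h := -fderiv ℝ r ξ (y - ξ) with hdef
  have hh0 : 0 < h := by linarith
  have hb : h ≤ A * ‖y - ξ‖ := (neg_le_abs _).trans ((fderiv ℝ r ξ).le_opNorm _)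
  rw [lt_div_iff₀ (by positivity)] at hyρ
  have hy1 : y ∈ ball ξ ρ := by
    rw [mem_ball, dist_eq_norm]
    refine lt_of_le_of_lt ?_ hyρ
    have : 0 ≤ ‖y - ξ‖ * (A * ‖n‖) := by positivity
    linarith
  have hy2 : y + h • n ∈ ball ξ ρ := by
    rw [mem_ball, dist_eq_norm, add_sub_right_comm]
    refine lt_of_le_of_lt (norm_add_le _ _) (lt_of_le_of_lt ?_ hyρ)
    rw [norm_smul, Real.norm_of_nonneg hh0.le]
    have := mul_le_mul_of_nonneg_right hb (norm_nonneg n)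
    linarith
  have hnot : y + h • n ∉ Ω := by
    intro hmem
    have := fderiv_neg_of_mem hΩo hΩc hUcl hUo hr hΩdef hξ hgrad hmem
    rw [add_sub_right_comm, map_add, map_smul, hnn, smul_eq_mul] at this
    linarith
  have hr2 : 0 ≤ r (y + h • n) := by
    by_contra hneg
    apply hnot
    rw [hΩdef]
    exact ⟨(hρt hy2).2, not_le.1 hneg⟩
  have hl := hL.dist_le_mul _ (hρt hy2).1 _ (hρt hy1).1
  rw [dist_eq_norm, dist_eq_norm, add_sub_cancel_left, norm_smul, Real.norm_of_nonneg hh0.le,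
    Real.norm_eq_abs] at hl
  have := le_abs_self (r (y + h • n) - r y)
  nlinarith
end SmoothDomain

section FiniteType

variable {E : Type*} [NormedAddCommGroup E] [NormedSpace ℂ E] {Ω U : Set E} {r : E → ℝ} {ξ : E}

theorem le_lineType {b : E} (hb : b ≠ 0) {n : ℕ} {K ρ : ℝ} (hρ : 0 < ρ)
    (h : ∀ u : ℂ, ‖u‖ = 1 → ∀ t ∈ Icc 0 ρ, |r (ξ + t • u • b)| ≤ K * t ^ n) :
    (n : ℕ∞) ≤ lineType r ξ := by
  refine le_trans ?_ (le_sSup ⟨b, hb, rfl⟩)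
  refine le_sSup ⟨n, ?_, rfl⟩
  refine IsBigO.of_bound K ?_
  filter_upwards [ball_mem_nhds (0 : ℂ) hρ] with ζ hζ
  rw [mem_ball, dist_zero_right] at hζ
  obtain ⟨u, hu, hζu⟩ : ∃ u : ℂ, ‖u‖ = 1 ∧ ζ = (‖ζ‖ : ℂ) * u := by
    rcases eq_or_ne ζ 0 with h0 | h0
    · exact ⟨1, by simp, by simp [h0]⟩
    · have : (‖ζ‖ : ℂ) ≠ 0 := by simpa using h0
      exact ⟨ζ / ‖ζ‖, by simp [h0], by field_simp⟩
  have := h u hu ‖ζ‖ ⟨norm_nonneg _, hζ.le⟩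
  rw [← Complex.coe_smul, smul_smul, ← hζu] at this
  simpa using this

theorem one_le_lineType [FiniteDimensional ℝ E] (hUo : IsOpen U)
    (hr : ContDiffOn ℝ (⊤ : ℕ∞) r U) (hξ : ξ ∈ U) (h0 : r ξ = 0) (hgrad : fderiv ℝ r ξ ≠ 0) :
    1 ≤ lineType r ξ := by
  obtain ⟨b', hb'⟩ := DFunLike.ne_iff.1 hgrad
  have hb0 : b' ≠ 0 := by rintro rfl; simp at hb'
  have hb1 : 0 < ‖b'‖ := norm_pos_iff.2 hb0
  obtain ⟨K, hK, ρ, hρ, hT⟩ := exists_taylor_dirDeriv hUo hr hξ 1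
  have := le_lineType (r := r) (ξ := ξ) (b := ‖b'‖⁻¹ • b') (n := 1) (K := K) (ρ := ρ)
    (smul_ne_zero (inv_ne_zero hb1.ne') hb0) hρ (fun u hu t ht => by
      have := (hT ξ (mem_ball_self hρ) (u • ‖b'‖⁻¹ • b') (by
        rw [norm_smul, norm_smul, hu, norm_inv, norm_norm, inv_mul_cancel₀ hb1.ne', one_mul])
        t ht).2
      simpa [dirDeriv, h0] using this)
  exact_mod_cast this

theorem exists_dirDeriv_ne_zero [FiniteDimensional ℝ E] (hUo : IsOpen U)
    (hr : ContDiffOn ℝ (⊤ : ℕ∞) r U) (hξ : ξ ∈ U) {ℓ : ℕ} (hℓ : lineType r ξ = ℓ)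
    {b : E} (hb : ‖b‖ = 1) :
    ∃ u : ℂ, ‖u‖ = 1 ∧ ∃ j < ℓ + 1, dirDeriv r j (ξ, u • b) ≠ 0 := by
  by_contra! hcon
  obtain ⟨K, hK, ρ, hρ, hT⟩ := exists_taylor_dirDeriv hUo hr hξ (ℓ + 1)
  have hb0 : b ≠ 0 := by rintro rfl; simp at hb
  have := le_lineType (r := r) (ξ := ξ) (b := b) (n := ℓ + 1) (K := K) (ρ := ρ)
    hb0 hρ (fun u hu t ht => by
      have := (hT ξ (mem_ball_self hρ) (u • b) (by rw [norm_smul, hu, hb, one_mul]) t ht).2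
      rw [Finset.sum_eq_zero, sub_zero] at this
      · exact this
      · intro j hj
        rw [hcon u hu j (Finset.mem_range.1 hj)]
        simp)
  rw [hℓ] at this
  have := Nat.cast_le.1 this
  omega

theorem exists_dirDeriv_lower_bound [FiniteDimensional ℝ E] (hUo : IsOpen U)
    (hr : ContDiffOn ℝ (⊤ : ℕ∞) r U) (hξ : ξ ∈ U) {ℓ : ℕ} (hℓ : lineType r ξ = ℓ) :
    ∃ m > 0, ∀ᶠ y in 𝓝 ξ, ∀ b : E, ‖b‖ = 1 →
      ∃ u : ℂ, ‖u‖ = 1 ∧ ∃ j < ℓ + 1, m ≤ |dirDeriv r j (y, u • b)| := by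
  have hcpt : IsCompact (sphere (0 : E) 1) := isCompact_sphere _ _
  have := hcpt.induction_on (p := fun S => ∃ m > (0 : ℝ), ∀ᶠ y in 𝓝 ξ, ∀ b ∈ S,
      ∃ u : ℂ, ‖u‖ = 1 ∧ ∃ j < ℓ + 1, m ≤ |dirDeriv r j (y, u • b)|)
    ⟨1, one_pos, by simp⟩ ?_ ?_ ?_
  · simpa using this
  · rintro S T hST ⟨m, hm, h⟩
    exact ⟨m, hm, h.mono fun y hy b hb => hy b (hST hb)⟩
  · rintro S T ⟨m, hm, h⟩ ⟨m', hm', h'⟩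
    refine ⟨min m m', lt_min hm hm', ?_⟩
    filter_upwards [h, h'] with y hy hy' b hb
    rcases hb with hb | hb
    · obtain ⟨u, hu, j, hj, hle⟩ := hy b hb
      exact ⟨u, hu, j, hj, (min_le_left _ _).trans hle⟩
    · obtain ⟨u, hu, j, hj, hle⟩ := hy' b hb
      exact ⟨u, hu, j, hj, (min_le_right _ _).trans hle⟩
  · intro b hb
    obtain ⟨u, hu, j, hj, hne⟩ := exists_dirDeriv_ne_zero hUo hr hξ hℓ (b := b) (by simpa using hb)
    have hpos : 0 < |dirDeriv r j (ξ, u • b)| := abs_pos.2 hne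
    have hc : ContinuousAt (fun p : E × E => |dirDeriv r j (p.1, u • p.2)|) (ξ, b) := by
      have h1 : ContinuousAt (dirDeriv r j) (ξ, u • b) :=
        (contDiffOn_dirDeriv hUo hr j).continuousOn.continuousAt
          ((hUo.prod isOpen_univ).mem_nhds ⟨hξ, mem_univ _⟩)
      have h2 : ContinuousAt (fun p : E × E => (p.1, u • p.2)) (ξ, b) := by fun_prop
      exact (ContinuousAt.comp (f := fun p : E × E => (p.1, u • p.2)) (x := (ξ, b)) h1 h2).abs
    have hev := hc.eventually (lt_mem_nhds (half_lt_self hpos))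
    rw [nhds_prod_eq] at hev
    obtain ⟨P, hP, Q, hQ, hPQ⟩ := eventually_prod_iff.1 hev
    refine ⟨{x | Q x}, mem_nhdsWithin_of_mem_nhds hQ, _, half_pos hpos, ?_⟩
    filter_upwards [hP] with y hy c hc
    exact ⟨u, hu, j, hj, (hPQ hy hc).le⟩

/-- Near a point of finite line type, affine discs in the domain are small. -/
theorem exists_norm_pow_le [FiniteDimensional ℝ E] (hΩo : IsOpen Ω) (hΩc : Convex ℝ Ω)
    (hΩb : Bornology.IsBounded Ω) (hUcl : closure Ω ⊆ U)
    (hUo : IsOpen U) (hr : ContDiffOn ℝ (⊤ : ℕ∞) r U) (hΩdef : Ω = {z | z ∈ U ∧ r z < 0})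
    (hξ : ξ ∈ frontier Ω) (hgrad : fderiv ℝ r ξ ≠ 0) {ℓ : ℕ} (hℓ : lineType r ξ = ℓ) :
    ∃ C > 0, ∃ ρ > 0, ∀ y ∈ Ω, ‖y - ξ‖ < ρ → ∀ v : E, (∀ ζ : ℂ, ‖ζ‖ ≤ 1 → y + ζ • v ∈ Ω) →
      ‖v‖ ^ ℓ ≤ C * -fderiv ℝ r ξ (y - ξ) := by
  obtain ⟨hU, -, hr0⟩ := frontier_defining_function hΩo hUcl hUo hr hΩdef hξ
  obtain ⟨C, hC, ρ₁, hρ₁, hneg⟩ := exists_neg_defining_le hΩo hΩc hUcl hUo hr hΩdef hξ hgrad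
  obtain ⟨m, hm, hlow⟩ := exists_dirDeriv_lower_bound hUo hr hU hℓ
  obtain ⟨ρ₂, hρ₂, hlow⟩ := nhds_basis_ball.eventually_iff.1 hlow
  obtain ⟨K, hK, ρ₃, hρ₃, hT⟩ := exists_taylor_dirDeriv hUo hr hU (ℓ + 1)
  obtain ⟨B, hB, hcoeff⟩ := exists_coeff_bound (ℓ + 1)
  obtain ⟨D, hD⟩ := hΩb.exists_norm_le
  set F : ℝ := (ℓ.factorial : ℝ) with hF
  have hF0 : 0 < F := by positivity
  -- the length up to which the Taylor polynomial dominates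
  set η₀ : ℝ := min (min 1 (ρ₁ / 2)) (min ρ₃ (m / (2 * F * B * K))) with hη₀
  have hη₀pos : 0 < η₀ := by positivity
  set D' : ℝ := max 1 (2 * |D|) with hD'
  have hD'1 : 1 ≤ D' := le_max_left _ _
  -- estimate for short vectors
  have key : ∀ y ∈ Ω, ‖y - ξ‖ < min (ρ₁ / 2) (min ρ₂ ρ₃) → ∀ v : E, ‖v‖ ≤ η₀ →
      (∀ ζ : ℂ, ‖ζ‖ ≤ 1 → y + ζ • v ∈ Ω) →
      ‖v‖ ^ ℓ ≤ (4 * F * B * C / m) * -fderiv ℝ r ξ (y - ξ) := by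
    intro y hy hyρ v hv hvΩ
    have hh : 0 < -fderiv ℝ r ξ (y - ξ) := by
      have := fderiv_neg_of_mem hΩo hΩc hUcl hUo hr hΩdef hξ hgrad hy
      linarith
    set h := -fderiv ℝ r ξ (y - ξ) with hdef
    have hρ1 : ‖y - ξ‖ < ρ₁ / 2 := hyρ.trans_le (min_le_left _ _)
    have hρ2 : ‖y - ξ‖ < ρ₂ := hyρ.trans_le ((min_le_right _ _).trans (min_le_left _ _))
    have hρ3 : ‖y - ξ‖ < ρ₃ := hyρ.trans_le ((min_le_right _ _).trans (min_le_right _ _))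
    have hv1 : ‖v‖ ≤ 1 := hv.trans ((min_le_left _ _).trans (min_le_left _ _))
    have hv2 : ‖v‖ ≤ ρ₁ / 2 := hv.trans ((min_le_left _ _).trans (min_le_right _ _))
    have hv3 : ‖v‖ ≤ ρ₃ := hv.trans ((min_le_right _ _).trans (min_le_left _ _))
    have hv4 : ‖v‖ ≤ m / (2 * F * B * K) :=
      hv.trans ((min_le_right _ _).trans (min_le_right _ _))
    rcases (norm_nonneg v).eq_or_lt' with hv0 | hv0
    · rcases Nat.eq_zero_or_pos ℓ with hl | hl
      · exfalso
        have := one_le_lineType hUo hr hU hr0 hgrad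
        rw [hℓ, hl] at this
        simp at this
      · rw [hv0, zero_pow hl.ne']
        positivity
    have hval : ∀ ζ : ℂ, ‖ζ‖ ≤ 1 → |r (y + ζ • v)| ≤ 2 * C * h := by
      intro ζ hζ
      have hp := hvΩ ζ hζ
      have hmn := hvΩ (-ζ) (by rwa [norm_neg])
      have h1 := fderiv_neg_of_mem hΩo hΩc hUcl hUo hr hΩdef hξ hgrad hmn
      have h2 := hneg _ hp (by
        rw [add_sub_right_comm]
        refine (norm_add_le _ _).trans_lt ?_
        rw [norm_smul]
        have := mul_le_of_le_one_left (norm_nonneg v) hζ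
        linarith)
      rw [add_sub_right_comm, map_add] at h1 h2
      rw [neg_smul, map_neg] at h1
      have hrn : r (y + ζ • v) < 0 := by
        rw [hΩdef] at hp
        exact hp.2
      rw [abs_of_neg hrn]
      have : C * -(fderiv ℝ r ξ (y - ξ) + fderiv ℝ r ξ (ζ • v)) ≤ C * (2 * h) :=
        mul_le_mul_of_nonneg_left (by linarith) hC.le
      linarith
    obtain ⟨u, hu, j, hj, hmj⟩ := hlow (x := y) (by rwa [mem_ball, dist_eq_norm])
      (‖v‖⁻¹ • v) (by rw [norm_smul, norm_inv, norm_norm, inv_mul_cancel₀ hv0.ne'])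
    set w : E := u • ‖v‖⁻¹ • v with hw
    have hw1 : ‖w‖ = 1 := by
      rw [hw, norm_smul, norm_smul, norm_inv, norm_norm, inv_mul_cancel₀ hv0.ne', hu, one_mul]
    have hpoly : ∀ t ∈ Icc 0 ‖v‖, |∑ j ∈ Finset.range (ℓ + 1),
        dirDeriv r j (y, w) / (j.factorial : ℝ) * t ^ j| ≤ 2 * C * h + K * ‖v‖ ^ (ℓ + 1) := by
      intro t ht
      have h1 := (hT y (by rwa [mem_ball, dist_eq_norm]) w hw1.le t ⟨ht.1, ht.2.trans hv3⟩).2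
      have h2 : |r (y + t • w)| ≤ 2 * C * h := by
        have e : t • w = ((t / ‖v‖ : ℝ) * u : ℂ) • v := by
          rw [hw, ← Complex.coe_smul, ← Complex.coe_smul, smul_smul, smul_smul]
          congr 1
          push_cast
          ring
        rw [e]
        apply hval
        rw [norm_mul, hu, mul_one, Complex.norm_real, Real.norm_of_nonneg (by
          exact div_nonneg ht.1 hv0.le)]
        exact div_le_one_of_le₀ ht.2 hv0.le
      have h3 : K * t ^ (ℓ + 1) ≤ K * ‖v‖ ^ (ℓ + 1) :=
        mul_le_mul_of_nonneg_left (pow_le_pow_left₀ ht.1 ht.2 _) hK.le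
      rw [abs_le] at h1 h2 ⊢
      constructor <;> linarith [h1.1, h1.2, h2.1, h2.2]
    have hc := hcoeff _ _ _ hv0.le hpoly j hj
    have hjF : (j.factorial : ℝ) ≤ F := by
      exact Nat.cast_le.2 (Nat.factorial_le (Nat.lt_succ_iff.1 hj))
    have hj0 : (0 : ℝ) < j.factorial := by positivity
    have hlow2 : m / F ≤ |dirDeriv r j (y, w) / (j.factorial : ℝ)| := by
      rw [abs_div, abs_of_pos hj0]
      exact div_le_div₀ (abs_nonneg _) hmj hj0 hjF
    have hpow : ‖v‖ ^ ℓ ≤ ‖v‖ ^ j :=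
      pow_le_pow_of_le_one hv0.le hv1 (Nat.lt_succ_iff.1 hj)
    have h5 : m / F * ‖v‖ ^ ℓ ≤ B * (2 * C * h + K * ‖v‖ ^ (ℓ + 1)) :=
      (mul_le_mul hlow2 hpow (by positivity) (abs_nonneg _)).trans hc
    have h6 : 2 * F * B * K * ‖v‖ ≤ m := by
      rw [le_div_iff₀ (by positivity)] at hv4
      linarith
    have h7 : 2 * F * B * K * ‖v‖ * ‖v‖ ^ ℓ ≤ m * ‖v‖ ^ ℓ :=
      mul_le_mul_of_nonneg_right h6 (by positivity)
    rw [div_mul_eq_mul_div, div_le_iff₀ hF0, pow_succ] at h5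
    rw [div_mul_eq_mul_div, le_div_iff₀ hm]
    linarith
  refine ⟨(4 * F * B * C / m) * (D' / η₀) ^ ℓ, by positivity, min (ρ₁ / 2) (min ρ₂ ρ₃),
    by positivity, fun y hy hyρ v hv => ?_⟩
  have hvD : ‖v‖ ≤ D' := by
    have h1 := hD _ (hv 1 (by simp))
    have h2 := hD _ hy
    have : ‖v‖ ≤ ‖y + (1 : ℂ) • v‖ + ‖y‖ := by
      simpa using norm_sub_le (y + (1 : ℂ) • v) y
    exact (by linarith [le_abs_self D] : ‖v‖ ≤ 2 * |D|).trans (le_max_right _ _)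
  have hη1 : η₀ ≤ 1 := (min_le_left _ _).trans (min_le_left _ _)
  have hs0 : 0 < η₀ / D' := by positivity
  have hs1 : η₀ / D' ≤ 1 := by
    rw [div_le_one (by positivity)]
    exact hη1.trans hD'1
  have hsv : ‖(η₀ / D') • v‖ = η₀ / D' * ‖v‖ := by
    rw [norm_smul, Real.norm_of_nonneg hs0.le]
  have := key y hy hyρ ((η₀ / D') • v) (by
    rw [hsv, div_mul_eq_mul_div, div_le_iff₀ (by positivity)]
    exact mul_le_mul_of_nonneg_left hvD hη₀pos.le) (fun ζ hζ => by
      rw [← Complex.coe_smul, smul_smul]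
      apply hv
      rw [norm_mul, Complex.norm_real, Real.norm_of_nonneg hs0.le]
      nlinarith [norm_nonneg ζ])
  rw [hsv, mul_pow] at this
  calc ‖v‖ ^ ℓ = (D' / η₀) ^ ℓ * ((η₀ / D') ^ ℓ * ‖v‖ ^ ℓ) := by
        rw [← mul_assoc, ← mul_pow, div_mul_div_cancel₀ hη₀pos.ne', div_self (by positivity),
          one_pow, one_mul]
    _ ≤ (D' / η₀) ^ ℓ * ((4 * F * B * C / m) * -fderiv ℝ r ξ (y - ξ)) :=
        mul_le_mul_of_nonneg_left this (by positivity)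
    _ = _ := by ring

end FiniteType

section Discs

variable {E : Type*} [NormedAddCommGroup E] [NormedSpace ℂ E] {Ω : Set E}

theorem mapsTo_closedBall_of_sphere (hΩo : IsOpen Ω) (hΩc : Convex ℝ Ω) {ψ : ℂ → E}
    (hψ : DiffContOnCl ℂ ψ (ball 0 1)) (hs : MapsTo ψ (sphere 0 1) Ω) :
    MapsTo ψ (closedBall 0 1) Ω := by
  intro z hz
  by_contra hx
  obtain ⟨L, hL⟩ := exists_re_pos_of_notMem hΩo hΩc hx
  have hu : DiffContOnCl ℂ (fun ζ => Complex.exp (-L (ψ ζ - ψ z))) (ball 0 1) := by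
    have h1 : Differentiable ℂ fun x : E => Complex.exp (-L (x - ψ z)) := by fun_prop
    exact h1.comp_diffContOnCl hψ
  have hcpt : IsCompact (sphere (0 : ℂ) 1) := isCompact_sphere _ _
  obtain ⟨w, hw, hmax⟩ := hcpt.exists_isMaxOn (NormedSpace.sphere_nonempty.2 zero_le_one)
    (hu.continuousOn.norm.mono (by
      rw [closure_ball _ one_ne_zero]; exact sphere_subset_closedBall))
  have h1 := Complex.norm_le_of_forall_mem_frontier_norm_le isBounded_ball hu
    (C := ‖Complex.exp (-L (ψ w - ψ z))‖) (fun ζ hζ => hmax (by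
      rwa [frontier_ball _ one_ne_zero] at hζ)) (z := z) (by
      rwa [closure_ball _ one_ne_zero])
  rw [Complex.norm_exp, Complex.norm_exp] at h1
  have h2 := hL _ (hs hw)
  have h3 := Real.exp_le_exp.1 h1
  simp at h3 h2
  linarith

theorem exists_circle_multiplier {s : ℝ} (hs : 1 / 2 ≤ s) (hs1 : s < 1) {c : ℂ}
    (hc : ‖c‖ ≤ (1 - s) ^ 2 / 16) :
    ∃ β : ℂ, ‖β‖ ≤ 1 / 4 ∧ 1 / 2 + β * s + (starRingEnd ℂ) β / s = c := by
  have hs0 : 0 < s := by linarith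
  set δ := 1 - s with hδ
  have hδ0 : 0 < δ := by linarith
  have hre : |c.re| ≤ δ ^ 2 / 16 := (Complex.abs_re_le_norm c).trans hc
  have him : |c.im| ≤ δ ^ 2 / 16 := (Complex.abs_im_le_norm c).trans hc
  have hp : 0 < s ^ 2 + 1 := by positivity
  have hq : 0 < 1 - s ^ 2 := by nlinarith
  refine ⟨⟨-((1 / 2 - c.re) * s / (s ^ 2 + 1)), -(c.im * s / (1 - s ^ 2))⟩, ?_, ?_⟩
  · have hx : |(1 / 2 - c.re) * s / (s ^ 2 + 1)| ≤ 1 / 4 * (1 - δ ^ 2 / 4) := by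
      rw [abs_div, abs_mul, abs_of_pos hs0, abs_of_pos hp, div_le_iff₀ hp]
      have h1 : |1 / 2 - c.re| ≤ 1 / 2 + δ ^ 2 / 16 := by
        rw [abs_le] at hre ⊢; constructor <;> linarith [hre.1, hre.2, sq_nonneg δ]
      have h2 : |1 / 2 - c.re| * s ≤ (1 / 2 + δ ^ 2 / 16) * s :=
        mul_le_mul_of_nonneg_right h1 hs0.le
      have h3 : (1 / 2 + δ ^ 2 / 16) * s ≤ 1 / 4 * (1 - δ ^ 2 / 4) * (s ^ 2 + 1) := by
        have : s = 1 - δ := by rw [hδ]; ring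
        have hδ1 : δ ≤ 1 / 2 := by linarith
        rw [this]
        nlinarith [sq_nonneg δ, mul_nonneg (sq_nonneg δ) hδ0.le, mul_nonneg (sq_nonneg δ) (sub_nonneg.2 hδ1), mul_nonneg (mul_nonneg (sq_nonneg δ) hδ0.le) (sub_nonneg.2 hδ1)]
      exact h2.trans h3
    have hy : |c.im * s / (1 - s ^ 2)| ≤ δ / 16 := by
      rw [abs_div, abs_mul, abs_of_pos hs0, abs_of_pos hq, div_le_iff₀ hq]
      have h2 : |c.im| * s ≤ δ ^ 2 / 16 * s := mul_le_mul_of_nonneg_right him hs0.le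
      have : s = 1 - δ := by rw [hδ]; ring
      rw [this] at h2 ⊢
      have hδ1 : δ ≤ 1 / 2 := by linarith
      nlinarith [sq_nonneg δ, mul_nonneg (sq_nonneg δ) hδ0.le]
    rw [← sq_le_sq₀ (norm_nonneg _) (by norm_num), ← Complex.normSq_eq_norm_sq,
      Complex.normSq_apply]
    simp only
    have hx2 := sq_le_sq' (by linarith [abs_nonneg ((1 / 2 - c.re) * s / (s ^ 2 + 1))]) hx
    have hy2 := sq_le_sq' (by linarith [abs_nonneg (c.im * s / (1 - s ^ 2))]) hy
    rw [sq_abs] at hx2 hy2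
    have hδ1 : δ ≤ 1 / 2 := by linarith
    nlinarith [sq_nonneg δ, mul_nonneg (sq_nonneg δ) (sub_nonneg.2 (by nlinarith : δ ^ 2 ≤ 1))]
  · apply Complex.ext
    · simp [Complex.div_ofReal_re]
      field_simp
      ring
    · simp [Complex.div_ofReal_im]
      field_simp
      ring

/-- One step of the flow: a holomorphic disc through `p` and `y` can be deformed to a disc through
`p` and a point close to `y + c • (f y - y)`. -/
theorem exists_disc_step [CompleteSpace E] (hΩo : IsOpen Ω) (hΩc : Convex ℝ Ω) {D : ℝ}
    (hD : ∀ x ∈ Ω, ∀ y ∈ Ω, ‖x - y‖ ≤ D) {f : E → E} (hf : DifferentiableOn ℂ f Ω)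
    (hfm : MapsTo f Ω Ω) {φ : ℂ → E} (hφ : DiffContOnCl ℂ φ (ball 0 1))
    (hφm : MapsTo φ (closedBall 0 1) Ω) {s : ℝ} (hs : 1 / 2 ≤ s) (hs1 : s < 1)
    {ρ η : ℝ} (hρ : 0 < ρ) (hρ1 : ρ ≤ 1) (hball : ball (φ 0) ρ ⊆ Ω) (hη : 0 < η)
    (hη1 : η ≤ 1 / 2)
    (hA : ‖f (φ 0) - φ 0‖ + ‖deriv (fun ζ => f (φ ζ) - φ ζ) 0‖ ≤ η * ρ / 2) {c : ℂ}
    (hc : ‖c‖ ≤ (1 - s) ^ 2 / 16) :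
    ∃ ψ : ℂ → E, DiffContOnCl ℂ ψ (ball 0 1) ∧ MapsTo ψ (closedBall 0 1) Ω ∧ ψ 0 = φ 0 ∧
      ‖ψ s - (φ s + c • (f (φ s) - φ s))‖ ≤ η * (2 * D + 1) := by
  obtain ⟨β, hβ, hβc⟩ := exists_circle_multiplier hs hs1 hc
  have hs0 : 0 < s := by linarith
  have hcl : closure (ball (0 : ℂ) 1) = closedBall 0 1 := closure_ball _ one_ne_zero
  set γ : ℂ → E := fun ζ => f (φ ζ) - φ ζ with hγ
  have hfφ : DiffContOnCl ℂ (fun ζ => f (φ ζ)) (ball 0 1) :=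
    ⟨hf.comp hφ.differentiableOn fun z hz => hφm (ball_subset_closedBall hz),
      hcl ▸ hf.continuousOn.comp (hcl ▸ hφ.continuousOn) hφm⟩
  have hγd : DiffContOnCl ℂ γ (ball 0 1) := hfφ.sub hφ
  have hγ0 : DifferentiableAt ℂ γ 0 :=
    hγd.differentiableAt isOpen_ball (mem_ball_self one_pos)
  have hds : DiffContOnCl ℂ (dslope γ 0) (ball 0 1) :=
    ⟨(Complex.differentiableOn_dslope (ball_mem_nhds _ one_pos)).2 hγd.differentiableOn,
      (continuousOn_dslope (hcl ▸ closedBall_mem_nhds _ one_pos)).2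
        ⟨hγd.continuousOn, hγ0⟩⟩
  set β' := (starRingEnd ℂ) β with hβ'
  have hβ'n : ‖β'‖ ≤ 1 / 4 := by rwa [hβ', RCLike.norm_conj]
  set ψ₀ : ℂ → E := fun ζ => φ ζ + (1 / 2 + β * ζ) • γ ζ + β' • dslope γ 0 ζ with hψ₀
  have hψ₀d : DiffContOnCl ℂ ψ₀ (ball 0 1) := by
    have h1 : DiffContOnCl ℂ (fun ζ : ℂ => 1 / 2 + β * ζ) (ball 0 1) :=
      Differentiable.diffContOnCl (by fun_prop)
    exact (hφ.add (h1.smul hγd)).add (hds.const_smul β')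
  set e₀ : E := ψ₀ 0 - φ 0 with he₀
  have he₀n : ‖e₀‖ ≤ η * ρ / 4 := by
    have : e₀ = (1 / 2 : ℂ) • γ 0 + β' • deriv γ 0 := by
      simp only [he₀, hψ₀, dslope_same, mul_zero, add_zero]
      abel
    rw [this]
    refine (norm_add_le _ _).trans ?_
    rw [norm_smul, norm_smul]
    have h1 : ‖(1 / 2 : ℂ)‖ = 1 / 2 := by norm_num
    have h2 : ‖β'‖ * ‖deriv γ 0‖ ≤ 1 / 2 * ‖deriv γ 0‖ :=
      mul_le_mul_of_nonneg_right (by linarith) (norm_nonneg _)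
    rw [h1]
    have h3 : ‖γ 0‖ + ‖deriv γ 0‖ ≤ η * ρ / 2 := hA
    linarith
  set p' : E := φ 0 - ((1 - η) / η) • e₀ with hp'
  have hηr : 0 ≤ (1 - η) / η := div_nonneg (by linarith) hη.le
  have hηr' : (1 - η) / η ≤ 1 / η := by gcongr; linarith
  have hsmall : ∀ e : E, ‖e‖ ≤ η * ρ / 4 → ‖((1 - η) / η) • e‖ ≤ ρ / 4 := by
    intro e he
    rw [norm_smul, Real.norm_of_nonneg hηr]
    calc (1 - η) / η * ‖e‖ ≤ 1 / η * (η * ρ / 4) := by gcongr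
      _ = ρ / 4 := by field_simp
  have hp'n : ‖p' - φ 0‖ ≤ ρ / 4 := by
    rw [hp', sub_sub_cancel_left, norm_neg]
    exact hsmall _ he₀n
  have hγ0n : ‖γ 0‖ ≤ η * ρ / 2 := by
    have : ‖γ 0‖ + ‖deriv γ 0‖ ≤ η * ρ / 2 := hA
    linarith [norm_nonneg (deriv γ 0)]
  have hslope : ∀ ζ : ℂ, ζ ≠ 0 → ψ₀ ζ = φ ζ + (1 / 2 + β * ζ + β' / ζ) • γ ζ
      - (β' / ζ) • γ 0 := by
    intro ζ hζ
    change φ ζ + (1 / 2 + β * ζ) • γ ζ + β' • dslope γ 0 ζ = _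
    rw [dslope_of_ne _ hζ, slope_def_module, sub_zero, smul_smul, ← div_eq_mul_inv]
    module
  set ψ : ℂ → E := fun ζ => (1 - η) • ψ₀ ζ + η • p' with hψ
  have hψd : DiffContOnCl ℂ ψ (ball 0 1) := (hψ₀d.const_smul (1 - η)).add_const _
  have hψm : MapsTo ψ (closedBall 0 1) Ω := by
    refine mapsTo_closedBall_of_sphere hΩo hΩc hψd fun ζ hζ => ?_
    have hζ1 : ‖ζ‖ = 1 := by simpa using hζ
    have hζ0 : ζ ≠ 0 := by rintro rfl; simp at hζ1
    have hζΩ : φ ζ ∈ Ω := hφm (sphere_subset_closedBall hζ)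
    set κ : ℝ := 1 / 2 + 2 * (β * ζ).re with hκ
    have hκc : 1 / 2 + β * ζ + β' / ζ = κ := by
      have : β' / ζ = (starRingEnd ℂ) (β * ζ) := by
        rw [div_eq_mul_inv, Complex.inv_def, Complex.normSq_eq_norm_sq, hζ1, map_mul]
        simp [hβ']
      rw [this, add_assoc, Complex.add_conj, hκ]
      push_cast
      ring
    have hre : |(β * ζ).re| ≤ 1 / 4 :=
      (Complex.abs_re_le_norm _).trans (by rw [norm_mul, hζ1, mul_one]; exact hβ)
    rw [abs_le] at hre
    have hw : φ ζ + κ • γ ζ ∈ Ω := by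
      have := hΩc hζΩ (hfm hζΩ) (a := 1 - κ) (b := κ) (by linarith [hre.2]) (by linarith [hre.1])
        (by ring)
      convert this using 1
      simp only [hγ, smul_sub, sub_smul, one_smul]
      abel
    have hq : p' - ((1 - η) / η) • (β' / ζ) • γ 0 ∈ Ω := by
      apply hball
      rw [mem_ball, dist_eq_norm, sub_right_comm]
      refine (norm_sub_le _ _).trans_lt ?_
      have := hsmall ((β' / ζ) • γ 0) (by
        rw [norm_smul, norm_div, hζ1, div_one]
        have := mul_le_mul hβ'n hγ0n (norm_nonneg _) (by norm_num)
        linarith [mul_pos hη hρ])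
      linarith
    have := hΩc hw hq (a := 1 - η) (b := η) (by linarith) hη.le (by ring)
    convert this using 1
    change (1 - η) • ψ₀ ζ + η • p' = _
    rw [hslope ζ hζ0, hκc, Complex.coe_smul, smul_sub (1 - η), smul_sub η p', smul_smul η,
      mul_div_cancel₀ _ hη.ne']
    abel
  have hψ0 : ψ 0 = φ 0 := by
    have h1 : ψ₀ 0 = φ 0 + e₀ := by rw [he₀]; abel
    simp only [hψ]
    rw [h1, hp', smul_sub, smul_smul, mul_div_cancel₀ _ hη.ne', smul_add, sub_smul (1 : ℝ) η (φ 0),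
      one_smul]
    abel
  refine ⟨ψ, hψd, hψm, hψ0, ?_⟩
  have hsb : (s : ℂ) ∈ closedBall (0 : ℂ) 1 := by
    rw [mem_closedBall, dist_zero_right, Complex.norm_real, Real.norm_of_nonneg hs0.le]
    exact hs1.le
  have hs0' : (s : ℂ) ≠ 0 := by exact_mod_cast hs0.ne'
  have hp'Ω : p' ∈ Ω := hball (by rw [mem_ball, dist_eq_norm]; linarith)
  have h1 : ψ s - (φ s + c • γ s) = η • (p' - ψ₀ s) - (β' / s) • γ 0 := by
    have h2 := hslope s hs0'
    rw [hβc] at h2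
    have h3 : φ s + c • γ s = ψ₀ s + (β' / s) • γ 0 := by rw [h2]; abel
    rw [h3]
    simp only [hψ, smul_sub, sub_smul, one_smul]
    abel
  have h2 : (1 - η) • (p' - ψ₀ s) = p' - ψ s := by
    simp only [hψ, smul_sub, sub_smul, one_smul]
    abel
  have h3 : ‖p' - ψ₀ s‖ ≤ 2 * D := by
    have := hD _ hp'Ω _ (hψm hsb)
    rw [← h2, norm_smul, Real.norm_of_nonneg (by linarith)] at this
    nlinarith [norm_nonneg (p' - ψ₀ s)]
  have h4 : ‖(β' / s) • γ 0‖ ≤ η := by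
    rw [norm_smul, norm_div, Complex.norm_real, Real.norm_of_nonneg hs0.le]
    have h5 : ‖β'‖ / s ≤ 1 / 2 := by rw [div_le_iff₀ hs0]; linarith
    have h6 := mul_le_mul h5 hγ0n (norm_nonneg _) (by norm_num)
    nlinarith
  change ‖ψ s - (φ s + c • γ s)‖ ≤ _
  rw [h1]
  refine (norm_sub_le _ _).trans ?_
  rw [norm_smul, Real.norm_of_nonneg hη.le]
  nlinarith

end Discs

/-- The convex geometry of a bounded domain near a smooth boundary point `ξ` of line type `ℓ`;
`{y | (Λ (y - ξ)).re = 0}` is the supporting hyperplane at `ξ`. -/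
structure IsFiniteTypePoint {E : Type*} [NormedAddCommGroup E] [NormedSpace ℂ E] (Ω : Set E)
    (Λ : E →L[ℂ] ℂ) (ξ : E) (ℓ : ℕ) : Prop where
  isOpen : IsOpen Ω
  convex : Convex ℝ Ω
  bounded : Bornology.IsBounded Ω
  pos : ∀ y ∈ Ω, 0 < (Λ (y - ξ)).re
  ne_zero : ℓ ≠ 0
  finite_type : ∃ C > 0, ∃ ρ > 0, ∀ y ∈ Ω, ‖y - ξ‖ < ρ → ∀ v : E,
    (∀ ζ : ℂ, ‖ζ‖ ≤ 1 → y + ζ • v ∈ Ω) → ‖v‖ ^ ℓ ≤ C * (Λ (y - ξ)).re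
  paraboloid : ∃ C > 0, ∀ y, C * ‖y - ξ‖ ^ 2 < (Λ (y - ξ)).re → y ∈ Ω

section Growth

variable {E : Type*} [NormedAddCommGroup E] [NormedSpace ℂ E] {Ω : Set E} {Λ : E →L[ℂ] ℂ} {ξ : E}
  {ℓ : ℕ}

theorem ofReal_mem_ball {t : ℝ} (ht : 0 ≤ t) (ht1 : t < 1) : (t : ℂ) ∈ ball (0 : ℂ) 1 := by
  rw [mem_ball, dist_zero_right, Complex.norm_real, Real.norm_of_nonneg ht]; exact ht1

theorem hasDerivAt_comp_ofReal {φ : ℂ → E} {v : E} {x : ℝ} (h : HasDerivAt φ v (x : ℂ)) :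
    HasDerivAt (fun t : ℝ => φ t) v x := by
  simpa [Function.comp_def] using h.scomp x (Complex.ofRealCLM.hasDerivAt (x := x))

theorem differentiableOn_functional {φ : ℂ → E} (hφ : DifferentiableOn ℂ φ (ball 0 1)) :
    DifferentiableOn ℂ (fun z => Λ (φ z - ξ)) (ball 0 1) :=
  Λ.differentiable.comp_differentiableOn (hφ.sub_const ξ)

namespace IsFiniteTypePoint

theorem exists_deriv_le (H : IsFiniteTypePoint Ω Λ ξ ℓ) : ∃ C > 0, ∃ ρ > 0, ∀ φ : ℂ → E,
    DifferentiableOn ℂ φ (ball 0 1) → MapsTo φ (ball 0 1) Ω → ∀ t : ℝ, 0 ≤ t → t < 1 →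
    ‖φ t - ξ‖ < ρ → (1 - t) * ‖deriv φ t‖ < C * (Λ (φ t - ξ)).re ^ (ℓ : ℝ)⁻¹ := by
  obtain ⟨C, hC, ρ, hρ, hA⟩ := H.finite_type
  refine ⟨4 * C ^ (ℓ : ℝ)⁻¹ + 1, by positivity, ρ, hρ, fun φ hφ hφm t ht ht1 htρ => ?_⟩
  have ht1' : 0 < 1 - t := by linarith
  have hmaps : MapsTo (fun z : ℂ => (t : ℂ) + (1 - t : ℝ) * z) (ball 0 1) (ball 0 1) := by
    intro z hz
    simp only [mem_ball, dist_zero_right] at hz ⊢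
    calc ‖(t : ℂ) + (1 - t : ℝ) * z‖ ≤ ‖(t : ℂ)‖ + ‖((1 - t : ℝ) : ℂ) * z‖ := norm_add_le _ _
      _ = t + (1 - t) * ‖z‖ := by
        rw [norm_mul, Complex.norm_real, Complex.norm_real, Real.norm_of_nonneg ht,
          Real.norm_of_nonneg ht1'.le]
      _ < 1 := by nlinarith
  have hg : DifferentiableOn ℂ (fun z : ℂ => φ ((t : ℂ) + (1 - t : ℝ) * z)) (ball 0 1) :=
    hφ.comp (by fun_prop) hmaps
  have hder : deriv (fun z : ℂ => φ ((t : ℂ) + (1 - t : ℝ) * z)) 0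
      = ((1 - t : ℝ) : ℂ) • deriv φ t := by
    have h1 : HasDerivAt φ (deriv φ t) ((t : ℂ) + (1 - t : ℝ) * 0) := by
      rw [mul_zero, add_zero]
      exact (hφ.differentiableAt (isOpen_ball.mem_nhds (ofReal_mem_ball ht ht1))).hasDerivAt
    have h2 : HasDerivAt (fun z : ℂ => (t : ℂ) + (1 - t : ℝ) * z) ((1 - t : ℝ) : ℂ) 0 := by
      simpa using ((hasDerivAt_id (0 : ℂ)).const_mul ((1 - t : ℝ) : ℂ)).const_add (t : ℂ)
    exact (h1.scomp (0 : ℂ) h2).deriv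
  have hmem := hφm (ofReal_mem_ball ht ht1)
  have hpos := H.pos _ hmem
  have h := hA (φ t) hmem htρ ((1 / 4 : ℂ) • ((1 - t : ℝ) : ℂ) • deriv φ t) (fun ζ hζ => by
    have := add_smul_deriv_mem H.isOpen H.convex hg (fun z hz => hφm (hmaps hz)) hζ
    rwa [hder, mul_zero, add_zero] at this)
  have h3 : ‖(1 / 4 : ℂ) • ((1 - t : ℝ) : ℂ) • deriv φ t‖ = (1 - t) * ‖deriv φ t‖ / 4 := by
    rw [norm_smul, norm_smul, Complex.norm_real, Real.norm_of_nonneg ht1'.le]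
    norm_num
    ring
  rw [h3] at h
  have h4 := Real.rpow_le_rpow (by positivity) h (inv_nonneg.2 (Nat.cast_nonneg ℓ))
  rw [Real.pow_rpow_inv_natCast (by positivity) H.ne_zero, Real.mul_rpow hC.le hpos.le] at h4
  have h5 : 0 < (Λ (φ t - ξ)).re ^ (ℓ : ℝ)⁻¹ := Real.rpow_pos_of_pos hpos _
  linarith

theorem exists_growth_from_centre (H : IsFiniteTypePoint Ω Λ ξ ℓ) : ∃ A > 0, ∃ ρ > 0,
    ∀ φ : ℂ → E, DifferentiableOn ℂ φ (ball 0 1) → MapsTo φ (ball 0 1) Ω →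
    ∀ t : ℝ, 0 ≤ t → t < 1 →
    ‖φ 0 - ξ‖ + A * ((Λ (φ 0 - ξ)).re / (1 - t)) ^ (ℓ : ℝ)⁻¹ < ρ →
    ‖φ t - φ 0‖ ≤ A * ((Λ (φ 0 - ξ)).re / (1 - t)) ^ (ℓ : ℝ)⁻¹ := by
  obtain ⟨C, hC, ρ, hρ, hA⟩ := H.exists_deriv_le
  set θ : ℝ := (ℓ : ℝ)⁻¹ with hθ
  have hℓ : (0 : ℝ) < ℓ := Nat.cast_pos.2 (Nat.pos_of_ne_zero H.ne_zero)
  have hθ0 : 0 < θ := inv_pos.2 hℓ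
  refine ⟨C * 2 ^ θ / θ, by positivity, ρ, hρ, fun φ hφ hφm t ht ht1 hsmall => ?_⟩
  set h₀ := (Λ (φ 0 - ξ)).re with hh₀
  have hh₀pos : 0 < h₀ := H.pos _ (hφm (by simp))
  set A := C * 2 ^ θ / θ with hAdef
  have hA0 : 0 < A := by positivity
  have hdiff : ∀ x ∈ Icc 0 t, HasDerivAt (fun x : ℝ => φ x - φ 0) (deriv φ x) x := by
    intro x hx
    have h1 : HasDerivAt φ (deriv φ x) (x : ℂ) := (hφ.differentiableAt (isOpen_ball.mem_nhds
      (ofReal_mem_ball hx.1 (hx.2.trans_lt ht1)))).hasDerivAt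
    exact (hasDerivAt_comp_ofReal h1).sub_const _
  have hB : ∀ x ∈ Icc 0 t, HasDerivAt (fun x : ℝ => A * h₀ ^ θ * (1 - x) ^ (-θ))
      (A * h₀ ^ θ * (θ * (1 - x) ^ (-θ - 1))) x := by
    intro x hx
    have hx1 : 0 < 1 - x := by linarith [hx.2]
    have h1 : HasDerivAt (fun x : ℝ => 1 - x) (-1) x := by
      simpa using (hasDerivAt_id x).const_sub 1
    have := (h1.rpow_const (p := -θ) (Or.inl hx1.ne')).const_mul (A * h₀ ^ θ)
    exact this.congr_deriv (by ring)
  have hBval : ∀ x, x < 1 → A * h₀ ^ θ * (1 - x) ^ (-θ) = A * (h₀ / (1 - x)) ^ θ := by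
    intro x hx
    rw [Real.div_rpow hh₀pos.le (by linarith), Real.rpow_neg (by linarith)]
    ring
  have := image_norm_le_of_norm_deriv_right_lt_deriv_boundary'
    (f := fun x : ℝ => φ x - φ 0) (f' := fun x => deriv φ x) (a := 0) (b := t)
    (B := fun x : ℝ => A * h₀ ^ θ * (1 - x) ^ (-θ))
    (B' := fun x : ℝ => A * h₀ ^ θ * (θ * (1 - x) ^ (-θ - 1)))
    (fun x hx => (hdiff x hx).continuousAt.continuousWithinAt)
    (fun x hx => (hdiff x (Ico_subset_Icc_self hx)).hasDerivWithinAt)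
    (by simp; positivity)
    (fun x hx => (hB x hx).continuousAt.continuousWithinAt)
    (fun x hx => (hB x (Ico_subset_Icc_self hx)).hasDerivWithinAt)
    (fun x hx hxB => ?_) (right_mem_Icc.2 ht)
  · simp only [hBval t ht1] at this
    exact this
  · have hx1 : x < 1 := hx.2.trans ht1
    have hx0 : 0 < 1 - x := by linarith
    simp only [hBval x hx1] at hxB
    have hmono : A * (h₀ / (1 - x)) ^ θ ≤ A * (h₀ / (1 - t)) ^ θ := by
      have : 0 < 1 - t := by linarith
      have := hx.2.le
      gcongr
    have hξ : ‖φ x - ξ‖ < ρ := by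
      calc ‖φ x - ξ‖ = ‖(φ x - φ 0) + (φ 0 - ξ)‖ := by congr 1; abel
        _ ≤ ‖φ x - φ 0‖ + ‖φ 0 - ξ‖ := norm_add_le _ _
        _ < ρ := by rw [hxB]; linarith
    have h1 := hA φ hφ hφm x hx.1 hx1 hξ
    have h2 := re_mul_one_sub_le_two_mul_re_zero (differentiableOn_functional (Λ := Λ) (ξ := ξ) hφ)
      (fun z hz => H.pos _ (hφm hz)) hx.1 hx1
    have hp := H.pos _ (hφm (ofReal_mem_ball hx.1 hx1))
    have h3 : (Λ (φ x - ξ)).re ≤ 2 * (h₀ / (1 - x)) := by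
      rw [← mul_div_assoc, le_div_iff₀ hx0]
      linarith
    have h4 : (Λ (φ x - ξ)).re ^ θ ≤ 2 ^ θ * (h₀ / (1 - x)) ^ θ := by
      rw [← Real.mul_rpow (by norm_num) (by positivity)]
      exact Real.rpow_le_rpow hp.le h3 hθ0.le
    have h5 : (1 - x) * ‖deriv φ x‖ < C * (2 ^ θ * (h₀ / (1 - x)) ^ θ) :=
      h1.trans_le (mul_le_mul_of_nonneg_left h4 hC.le)
    have h6 : A * h₀ ^ θ * (θ * (1 - x) ^ (-θ - 1)) =
        C * (2 ^ θ * (h₀ / (1 - x)) ^ θ) / (1 - x) := by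
      rw [Real.rpow_sub_one hx0.ne', Real.rpow_neg hx0.le, Real.div_rpow hh₀pos.le hx0.le, hAdef]
      field_simp
    rw [h6, lt_div_iff₀ hx0]
    linarith

theorem exists_growth_near_end (H : IsFiniteTypePoint Ω Λ ξ ℓ) : ∃ A > 0, ∃ ρ > 0,
    ∀ φ : ℂ → E, DifferentiableOn ℂ φ (ball 0 1) → MapsTo φ (ball 0 1) Ω →
    ∀ t s Q : ℝ, 0 ≤ t → t ≤ s → s < 1 → 1 - t ≤ Q * (1 - s) →
    ‖φ t - ξ‖ + A * Q * (2 * Q * (Λ (φ s - ξ)).re) ^ (ℓ : ℝ)⁻¹ < ρ →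
    ‖φ s - φ t‖ ≤ A * Q * (2 * Q * (Λ (φ s - ξ)).re) ^ (ℓ : ℝ)⁻¹ := by
  obtain ⟨C, hC, ρ, hρ, hA⟩ := H.exists_deriv_le
  set θ : ℝ := (ℓ : ℝ)⁻¹ with hθ
  have hℓ : (0 : ℝ) < ℓ := Nat.cast_pos.2 (Nat.pos_of_ne_zero H.ne_zero)
  have hθ0 : 0 < θ := inv_pos.2 hℓ
  refine ⟨C, hC, ρ, hρ, fun φ hφ hφm t s Q ht hts hs hQ hsmall => ?_⟩
  have hs0 : 0 < 1 - s := by linarith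
  have hsΩ := hφm (ofReal_mem_ball (ht.trans hts) hs)
  set hs' := (Λ (φ s - ξ)).re with hhs
  have hhspos : 0 < hs' := H.pos _ hsΩ
  have hQ1 : 1 ≤ Q := by
    by_contra hlt
    nlinarith
  set S := C * (2 * Q * hs') ^ θ / (1 - s) with hS
  have hS0 : 0 ≤ S := by positivity
  have hSle : S * (s - t) ≤ C * Q * (2 * Q * hs') ^ θ := by
    rw [hS, div_mul_eq_mul_div, div_le_iff₀ hs0]
    have : 0 ≤ C * (2 * Q * hs') ^ θ := by positivity
    nlinarith
  have hdiff : ∀ x ∈ Icc t s, HasDerivAt (fun x : ℝ => φ x - φ t) (deriv φ x) x := by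
    intro x hx
    have h1 : HasDerivAt φ (deriv φ x) (x : ℂ) := (hφ.differentiableAt (isOpen_ball.mem_nhds
      (ofReal_mem_ball (ht.trans hx.1) (hx.2.trans_lt hs)))).hasDerivAt
    exact (hasDerivAt_comp_ofReal h1).sub_const _
  have hB : ∀ x, HasDerivAt (fun x : ℝ => S * (x - t)) S x := fun x => by
    simpa using ((hasDerivAt_id x).sub_const t).const_mul S
  have := image_norm_le_of_norm_deriv_right_lt_deriv_boundary
    (f := fun x : ℝ => φ x - φ t) (f' := fun x => deriv φ x) (a := t) (b := s)
    (B := fun x : ℝ => S * (x - t)) (B' := fun _ => S)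
    (fun x hx => (hdiff x hx).continuousAt.continuousWithinAt)
    (fun x hx => (hdiff x (Ico_subset_Icc_self hx)).hasDerivWithinAt)
    (by simp) hB (fun x hx hxB => ?_) (right_mem_Icc.2 hts)
  · exact this.trans hSle
  · have hx1 : x < 1 := hx.2.trans hs
    have hxt : 0 ≤ x := ht.trans hx.1
    have hx0 : 0 < 1 - x := by linarith
    have hξ : ‖φ x - ξ‖ < ρ := by
      have hle : S * (x - t) ≤ S * (s - t) := by
        have := hx.2.le
        gcongr
      calc ‖φ x - ξ‖ = ‖(φ x - φ t) + (φ t - ξ)‖ := by congr 1; abel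
        _ ≤ ‖φ x - φ t‖ + ‖φ t - ξ‖ := norm_add_le _ _
        _ < ρ := by rw [hxB]; linarith
    have h1 := hA φ hφ hφm x hxt hx1 hξ
    have h2 := re_mul_one_sub_le_of_re_pos (differentiableOn_functional (Λ := Λ) (ξ := ξ) hφ)
      (fun z hz => H.pos _ (hφm hz)) hxt hx.2.le hs
    have hp := H.pos _ (hφm (ofReal_mem_ball hxt hx1))
    have h3 : (Λ (φ x - ξ)).re ≤ 2 * Q * hs' := by
      have h4 : 1 - x ≤ Q * (1 - s) := by linarith [hx.1]
      have h5 : 2 * (1 - x) * hs' ≤ 2 * (Q * (1 - s)) * hs' := by gcongr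
      have h6 : (1 - s) * (Λ (φ x - ξ)).re ≤ (1 - s) * (2 * Q * hs') := by linarith
      exact le_of_mul_le_mul_left h6 hs0
    have h4 : (Λ (φ x - ξ)).re ^ θ ≤ (2 * Q * hs') ^ θ := Real.rpow_le_rpow hp.le h3 hθ0.le
    have h5 : (1 - s) * ‖deriv φ x‖ ≤ (1 - x) * ‖deriv φ x‖ := by
      have := hx.2.le
      gcongr
    rw [hS, lt_div_iff₀ hs0]
    have h6 := mul_le_mul_of_nonneg_left h4 hC.le
    linarith

end IsFiniteTypePoint

end Growth

section Boundary

variable {E : Type*} [NormedAddCommGroup E] [NormedSpace ℂ E] {Ω : Set E} {Λ : E →L[ℂ] ℂ} {ξ : E}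
  {ℓ : ℕ}

namespace IsFiniteTypePoint

/-- Points on discs with centres converging to `ξ` can only accumulate on the boundary
at `ξ` itself. -/
theorem eq_of_tendsto_disc (H : IsFiniteTypePoint Ω Λ ξ ℓ) {ι : Type*} {l : Filter ι} [l.NeBot]
    {T : ι → ℝ} (hT : Tendsto T l atTop) {φ : ι → ℂ → E}
    (hφ : ∀ i, DifferentiableOn ℂ (φ i) (ball 0 1)) (hφm : ∀ i, MapsTo (φ i) (ball 0 1) Ω)
    (h0 : Tendsto (fun i => φ i 0) l (𝓝 ξ)) {K : ℝ} (hK : 0 < K)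
    (hKT : ∀ᶠ i in l, (Λ (φ i 0 - ξ)).re ≤ K / T i) {g : ℝ} (hg : 0 < g) {η : E}
    (hη : Tendsto (fun i => φ i (T i / (T i + g) : ℝ)) l (𝓝 η)) (hηΩ : η ∉ Ω) : η = ξ := by
  obtain ⟨A₁, hA₁, ρ₁, hρ₁, hgrow₁⟩ := H.exists_growth_from_centre
  obtain ⟨A₂, hA₂, ρ₂, hρ₂, hgrow₂⟩ := H.exists_growth_near_end
  obtain ⟨C, hC, hpar⟩ := H.paraboloid
  obtain ⟨L, hL⟩ := exists_re_pos_of_notMem H.isOpen H.convex hηΩ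
  have hℓ : (0 : ℝ) < ℓ := Nat.cast_pos.2 (Nat.pos_of_ne_zero H.ne_zero)
  set θ : ℝ := (ℓ : ℝ)⁻¹ with hθ
  have hθ0 : 0 < θ := inv_pos.2 hℓ
  set s : ι → ℝ := fun i => T i / (T i + g) with hs
  set δ : ℝ → ℝ := fun M => A₁ * (K / M) ^ θ with hδ
  have hδ0 : Tendsto δ atTop (𝓝 0) := by
    have h1 : Tendsto (fun M : ℝ => K / M) atTop (𝓝 0) := tendsto_const_nhds.div_atTop tendsto_id
    have h2 := (h1.rpow_const (p := θ) (Or.inr hθ0.le)).const_mul A₁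
    rwa [Real.zero_rpow hθ0.ne', mul_zero] at h2
  have h0n : Tendsto (fun i => ‖φ i 0 - ξ‖) l (𝓝 0) := by
    have := (h0.sub_const ξ).norm
    rwa [sub_self, norm_zero] at this
  have hsb : ∀ᶠ i in l, 0 < T i ∧ 0 ≤ s i ∧ s i < 1 := by
    filter_upwards [hT.eventually_gt_atTop 0] with i hi
    refine ⟨hi, by positivity, ?_⟩
    simp only [hs]
    rw [div_lt_one (by positivity)]
    linarith
  -- the radius `1 - M / T` and its hyperbolic distance to `s`
  have hrad : ∀ M, g ≤ M → ∀ᶠ i in l, 0 ≤ 1 - M / T i ∧ 1 - M / T i ≤ s i ∧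
      1 - (1 - M / T i) ≤ 2 * M / g * (1 - s i) := by
    intro M hM
    filter_upwards [hT.eventually_ge_atTop (max M g)] with i hi
    have hM0 : 0 < M := hg.trans_le hM
    have hiM : M ≤ T i := (le_max_left _ _).trans hi
    have hig : g ≤ T i := (le_max_right _ _).trans hi
    have hTi : 0 < T i := hM0.trans_le hiM
    have h1s : 1 - s i = g / (T i + g) := by
      simp only [hs]
      field_simp
      ring
    refine ⟨?_, ?_, ?_⟩
    · rw [sub_nonneg, div_le_one hTi]
      exact hiM
    · have : g / (T i + g) ≤ M / T i := by
        apply div_le_div₀ hM0.le hM hTi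
        linarith
      linarith
    · rw [h1s, sub_sub_cancel, div_mul_div_comm, div_le_div_iff₀ hTi (by positivity)]
      nlinarith [mul_pos hM0 hg]
  have hstep1 : ∀ M, g ≤ M → δ M < ρ₁ → ∀ᶠ i in l,
      ‖φ i (1 - M / T i : ℝ) - φ i 0‖ ≤ δ M := by
    intro M hM hδM
    have hM0 : 0 < M := hg.trans_le hM
    filter_upwards [hrad M hM, hsb, hKT, h0n.eventually (gt_mem_nhds (sub_pos.2 hδM))]
      with i hi hi2 hi3 hi4
    have hpos := H.pos _ (hφm i (mem_ball_self one_pos))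
    have hle : A₁ * ((Λ (φ i 0 - ξ)).re / (1 - (1 - M / T i))) ^ θ ≤ δ M := by
      simp only [hδ]
      have : (Λ (φ i 0 - ξ)).re / (1 - (1 - M / T i)) ≤ K / M := by
        rw [sub_sub_cancel, div_div_eq_mul_div]
        rw [le_div_iff₀ hi2.1] at hi3
        gcongr
      have h0 : 0 ≤ (Λ (φ i 0 - ξ)).re / (1 - (1 - M / T i)) := by
        rw [sub_sub_cancel]
        have := hi2.1
        positivity
      gcongr
    refine (hgrow₁ (φ i) (hφ i) (hφm i) _ hi.1 (hi.2.1.trans_lt hi2.2.2) ?_).trans hle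
    linarith
  have hclose : ∀ M, g ≤ M → δ M < ρ₁ → ∀ᶠ i in l,
      ‖φ i (1 - M / T i : ℝ) - ξ‖ ≤ δ M + ‖φ i 0 - ξ‖ := by
    intro M hM hδM
    filter_upwards [hstep1 M hM hδM] with i hi
    calc ‖φ i (1 - M / T i : ℝ) - ξ‖ = ‖(φ i (1 - M / T i : ℝ) - φ i 0) + (φ i 0 - ξ)‖ := by
          congr 1; abel
      _ ≤ _ := (norm_add_le _ _).trans (by linarith)
  -- the supporting functional at `η` vanishes at `ξ`
  have hLξ : (L (ξ - η)).re ≤ 0 := by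
    have hlim : Tendsto (fun M => ‖L‖ * δ M) atTop (𝓝 0) := by
      simpa using hδ0.const_mul ‖L‖
    refine ge_of_tendsto hlim ?_
    filter_upwards [eventually_ge_atTop g, hδ0.eventually (gt_mem_nhds hρ₁)] with M hM hδM
    have hlim2 : Tendsto (fun i => 2 * (2 * M / g) * (L (φ i (s i) - η)).re +
        ‖L‖ * (δ M + ‖φ i 0 - ξ‖)) l (𝓝 (‖L‖ * δ M)) := by
      have h1 : Tendsto (fun i => (L (φ i (s i) - η)).re) l (𝓝 0) := by
        have h2 : Continuous fun x : E => (L (x - η)).re := by fun_prop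
        have h3 : Tendsto (fun i => (L (φ i (s i) - η)).re) l (𝓝 (L (η - η)).re) :=
          (h2.tendsto η).comp hη
        rwa [sub_self, map_zero, Complex.zero_re] at h3
      have := (h1.const_mul (2 * (2 * M / g))).add ((h0n.const_add (δ M)).const_mul ‖L‖)
      simpa using this
    refine ge_of_tendsto hlim2 ?_
    filter_upwards [hrad M hM, hsb, hclose M hM hδM] with i hi hi2 hi3
    set t := 1 - M / T i with ht
    have hq : DifferentiableOn ℂ (fun z => L (φ i z - η)) (ball 0 1) :=
      differentiableOn_functional (hφ i)
    have hpos : ∀ z ∈ ball (0 : ℂ) 1, 0 < (L (φ i z - η)).re := fun z hz => hL _ (hφm i hz)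
    have h1 := re_mul_one_sub_le_of_re_pos hq hpos hi.1 hi.2.1 hi2.2.2
    have hps := hpos _ (ofReal_mem_ball hi2.2.1 hi2.2.2)
    have h2 : (L (φ i t - η)).re ≤ 2 * (2 * M / g) * (L (φ i (s i) - η)).re := by
      have h3 : 0 < 1 - s i := by linarith [hi2.2.2]
      have h4 : 2 * (1 - t) * (L (φ i (s i) - η)).re ≤
          2 * (2 * M / g * (1 - s i)) * (L (φ i (s i) - η)).re := by
        gcongr; exact hi.2.2
      have h5 : (1 - s i) * (L (φ i t - η)).re ≤
          (1 - s i) * (2 * (2 * M / g) * (L (φ i (s i) - η)).re) := by linarith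
      exact le_of_mul_le_mul_left h5 h3
    have h3 : (L (ξ - η)).re = (L (φ i t - η)).re - (L (φ i t - ξ)).re := by
      simp only [map_sub, Complex.sub_re]; ring
    have h4 : -(L (φ i t - ξ)).re ≤ ‖L‖ * (δ M + ‖φ i 0 - ξ‖) := by
      refine ((neg_le_abs _).trans (Complex.abs_re_le_norm _)).trans ((L.le_opNorm _).trans ?_)
      gcongr
    linarith
  have hhη : (Λ (η - ξ)).re ≤ 0 := by
    by_contra! hpos
    have hlim : Tendsto (fun t : ℝ => C * t * ‖η - ξ‖ ^ 2) (𝓝[>] 0) (𝓝 0) := by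
      have : Continuous fun t : ℝ => C * t * ‖η - ξ‖ ^ 2 := by fun_prop
      simpa using (this.tendsto 0).mono_left nhdsWithin_le_nhds
    obtain ⟨t, ht1, ht2⟩ := ((hlim.eventually (gt_mem_nhds hpos)).and
      (Ioo_mem_nhdsGT one_pos)).exists
    have hmem : ξ + t • (η - ξ) ∈ Ω := by
      apply hpar
      rw [add_sub_cancel_left, norm_smul, Real.norm_of_nonneg ht2.1.le, ← Complex.coe_smul,
        map_smul, smul_eq_mul, Complex.re_ofReal_mul]
      have := mul_lt_mul_of_pos_left ht1 ht2.1
      linarith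
    have := hL _ hmem
    have e : ξ + t • (η - ξ) - η = ((1 - t : ℝ) : ℂ) • (ξ - η) := by
      rw [Complex.coe_smul]; module
    rw [e, map_smul, smul_eq_mul, Complex.re_ofReal_mul] at this
    nlinarith [ht2.2]
  have hhy : Tendsto (fun i => (Λ (φ i (s i) - ξ)).re) l (𝓝 0) := by
    have h2 : Continuous fun x : E => (Λ (x - ξ)).re := by fun_prop
    have h3 : Tendsto (fun i => (Λ (φ i (s i) - ξ)).re) l (𝓝 (Λ (η - ξ)).re) :=
      (h2.tendsto η).comp hη
    have h4 : 0 ≤ (Λ (η - ξ)).re := by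
      refine ge_of_tendsto h3 ?_
      filter_upwards [hsb] with i hi
      exact (H.pos _ (hφm i (ofReal_mem_ball hi.2.1 hi.2.2))).le
    rwa [le_antisymm hhη h4] at h3
  have hnorm : ‖η - ξ‖ ≤ 0 := by
    refine ge_of_tendsto hδ0 ?_
    filter_upwards [eventually_ge_atTop g, hδ0.eventually (gt_mem_nhds hρ₁),
      hδ0.eventually (gt_mem_nhds hρ₂)] with M hM hδM hδM2
    set Q := 2 * M / g with hQ
    have hlim2 : Tendsto (fun i => δ M + ‖φ i 0 - ξ‖ +
        A₂ * Q * (2 * Q * (Λ (φ i (s i) - ξ)).re) ^ θ) l (𝓝 (δ M)) := by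
      have h1 := ((hhy.const_mul (2 * Q)).rpow_const (p := θ) (Or.inr hθ0.le)).const_mul (A₂ * Q)
      rw [mul_zero, Real.zero_rpow hθ0.ne', mul_zero] at h1
      simpa using (h0n.const_add (δ M)).add h1
    have hlim1 : Tendsto (fun i => ‖φ i (s i) - ξ‖) l (𝓝 ‖η - ξ‖) := (hη.sub_const ξ).norm
    refine le_of_tendsto_of_tendsto hlim1 hlim2 ?_
    filter_upwards [hrad M hM, hsb, hclose M hM hδM, hlim2.eventually (gt_mem_nhds hδM2)]
      with i hi hi2 hi3 hi4
    have := hgrow₂ (φ i) (hφ i) (hφm i) _ _ Q hi.1 hi.2.1 hi2.2.2 hi.2.2 (by linarith)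
    calc ‖φ i (s i) - ξ‖ = ‖(φ i (s i) - φ i (1 - M / T i : ℝ)) +
          (φ i (1 - M / T i : ℝ) - ξ)‖ := by congr 1; abel
      _ ≤ _ := (norm_add_le _ _).trans (by linarith)
  exact sub_eq_zero.1 (norm_le_zero_iff.1 hnorm)

theorem exists_ball_subset_of_disc [ProperSpace E] (H : IsFiniteTypePoint Ω Λ ξ ℓ) {p : ℝ → E}
    (hp : Tendsto p atTop (𝓝 ξ)) {K : ℝ} (hK : 0 < K)
    (hpK : ∀ᶠ T in atTop, (Λ (p T - ξ)).re ≤ K / T) {g : ℝ} (hg : 0 < g) {m : ℝ} (hm : 0 < m) :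
    ∃ m' > 0, ∀ᶠ T in atTop, ∀ φ : ℂ → E, DifferentiableOn ℂ φ (ball 0 1) →
      MapsTo φ (ball 0 1) Ω → φ 0 = p T → m ≤ ‖φ (T / (T + g) : ℝ) - ξ‖ →
      ball (φ (T / (T + g) : ℝ)) m' ⊆ Ω := by
  by_contra! hcon
  have hseq : ∀ n : ℕ, ∃ T : ℝ, (n : ℝ) + 1 ≤ T ∧ ∃ φ : ℂ → E, DifferentiableOn ℂ φ (ball 0 1) ∧
      MapsTo φ (ball 0 1) Ω ∧ φ 0 = p T ∧ m ≤ ‖φ (T / (T + g) : ℝ) - ξ‖ ∧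
      ¬ ball (φ (T / (T + g) : ℝ)) (1 / (n + 1)) ⊆ Ω := by
    intro n
    have h1 := (hcon (1 / (n + 1)) (by positivity)).and_eventually
      (eventually_ge_atTop ((n : ℝ) + 1))
    obtain ⟨T, ⟨φ, h2, h3, h4, h5, h6⟩, hT⟩ := h1.exists
    exact ⟨T, hT, φ, h2, h3, h4, h5, h6⟩
  choose T hT φ hφ hφm hφ0 hφs hnot using hseq
  have hTtop : Tendsto T atTop atTop :=
    tendsto_atTop_mono hT (tendsto_natCast_atTop_atTop.atTop_add tendsto_const_nhds)
  have hmem : ∀ n, φ n (T n / (T n + g) : ℝ) ∈ Ω := fun n => by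
    have hTn : 0 < T n := lt_of_lt_of_le (by positivity) (hT n)
    exact hφm n (ofReal_mem_ball (by positivity) (by
      rw [div_lt_one (by positivity)]; linarith))
  obtain ⟨η, -, σ, hσ, hlim⟩ := tendsto_subseq_of_bounded H.bounded hmem
  have hηΩ : η ∉ Ω := by
    intro hη
    obtain ⟨ε, hε, hball⟩ := Metric.isOpen_iff.1 H.isOpen η hη
    have h1 : ∀ᶠ n in atTop, dist (φ (σ n) (T (σ n) / (T (σ n) + g) : ℝ)) η < ε / 2 :=
      (Metric.tendsto_nhds.1 hlim) (ε / 2) (half_pos hε)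
    have h2 : ∀ᶠ n in atTop, 1 / ((σ n : ℝ) + 1) < ε / 2 :=
      (tendsto_one_div_add_atTop_nhds_zero_nat.comp hσ.tendsto_atTop).eventually
        (gt_mem_nhds (half_pos hε))
    obtain ⟨n, hn1, hn2⟩ := (h1.and h2).exists
    refine hnot (σ n) ((ball_subset_ball' ?_).trans hball)
    linarith
  have hTσ := hTtop.comp hσ.tendsto_atTop
  have heq := H.eq_of_tendsto_disc (l := atTop) (T := T ∘ σ) hTσ (φ := φ ∘ σ)
    (fun n => hφ _) (fun n => hφm _) (by
      simp only [Function.comp_def, hφ0]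
      exact hp.comp hTσ) hK (by
      simp only [Function.comp_def, hφ0]
      exact hTσ.eventually hpK) hg hlim hηΩ
  have h1 : m ≤ ‖η - ξ‖ := ge_of_tendsto ((hlim.sub_const ξ).norm)
    (Eventually.of_forall fun n => hφs (σ n))
  rw [heq, sub_self, norm_zero] at h1
  linarith

end IsFiniteTypePoint

end Boundary

section EulerPolygon

variable {E : Type*} [NormedAddCommGroup E] [NormedSpace ℂ E] {Ω : Set E} {f : E → E}

/-- The Euler polygon with `k` steps of size `c` for the vector field `f - id`. -/
def eulerPolygon (f : E → E) (x : E) (c : ℂ) : ℕ → E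
  | 0 => x
  | k + 1 => eulerPolygon f x c k + c • (f (eulerPolygon f x c k) - eulerPolygon f x c k)

theorem eulerPolygon_zero_right (x : E) (k : ℕ) : eulerPolygon f x 0 k = x := by
  induction k with
  | zero => rfl
  | succ k ih => simp [eulerPolygon, ih]

theorem differentiableAt_eulerPolygon (hΩo : IsOpen Ω) (hf : DifferentiableOn ℂ f Ω) {x : E} {c : ℂ}
    {k : ℕ} (hmem : ∀ j < k, eulerPolygon f x c j ∈ Ω) :
    DifferentiableAt ℂ (fun c => eulerPolygon f x c k) c := by
  induction k with
  | zero => exact differentiableAt_const x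
  | succ k ih =>
    have h1 := ih fun j hj => hmem j (hj.trans k.lt_succ_self)
    have h2 : DifferentiableAt ℂ f (eulerPolygon f x c k) :=
      hf.differentiableAt (hΩo.mem_nhds (hmem k k.lt_succ_self))
    have h3 : DifferentiableAt ℂ (fun c => f (eulerPolygon f x c k)) c :=
      h2.comp (f := fun c => eulerPolygon f x c k) c h1
    exact h1.add (differentiableAt_id.smul (h3.sub h1))

theorem hasDerivAt_eulerPolygon_zero (hΩo : IsOpen Ω) (hf : DifferentiableOn ℂ f Ω) {x : E}
    (hx : x ∈ Ω) (k : ℕ) :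
    HasDerivAt (fun c => eulerPolygon f x c k) ((k : ℂ) • (f x - x)) 0 := by
  induction k with
  | zero => simpa [eulerPolygon] using hasDerivAt_const (0 : ℂ) x
  | succ k ih =>
    have h2 : DifferentiableAt ℂ f (eulerPolygon f x 0 k) := by
      rw [eulerPolygon_zero_right]; exact hf.differentiableAt (hΩo.mem_nhds hx)
    have h3 : DifferentiableAt ℂ (fun c => f (eulerPolygon f x c k)) 0 :=
      h2.comp (f := fun c => eulerPolygon f x c k) 0 ih.differentiableAt
    have h4 := ih.add ((hasDerivAt_id (0 : ℂ)).smul (h3.sub ih.differentiableAt).hasDerivAt)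
    refine h4.congr_deriv ?_
    simp [eulerPolygon_zero_right, add_smul]

theorem exp_neg_two_mul_le {u : ℝ} (hu : 0 ≤ u) (hu1 : u ≤ 1 / 2) :
    Real.exp (-(2 * u)) ≤ 1 - u := by
  rw [Real.exp_neg]
  have h1 : 2 * u + 1 ≤ Real.exp (2 * u) := Real.add_one_le_exp _
  calc (Real.exp (2 * u))⁻¹ ≤ (2 * u + 1)⁻¹ := by gcongr
    _ ≤ 1 - u := by
      rw [inv_le_iff_one_le_mul₀ (by positivity)]
      nlinarith

/-- If the flow of `f - id` can be followed up to a small error inside a set `S` that stays away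
from the boundary, then Euler polygons of total time `R` exist, so that `f - id` is small. -/
theorem norm_sub_le_of_approx_steps (hΩo : IsOpen Ω) {D : ℝ} (hD0 : 0 ≤ D)
    (hD : ∀ x ∈ Ω, ∀ y ∈ Ω, ‖x - y‖ ≤ D)
    (hf : DifferentiableOn ℂ f Ω) (hfm : MapsTo f Ω Ω) {ξ : E} {A : ℝ} (hA : 0 < A)
    (hG : ∀ y ∈ Ω, ‖f y - y‖ ≤ A * ‖y - ξ‖) {S : Set E} {x : E} (hx : x ∈ S) (hxΩ : x ∈ Ω)
    {R κ ε m m' : ℝ} (hR : 0 < R) (hκ : 0 < κ) (hε : 0 ≤ ε) (hm'0 : 0 < m') (hκA : A * κ ≤ 1 / 2)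
    (hκR : κ ≤ R)
    (hstep : ∀ y ∈ S, ∀ c : ℂ, ‖c‖ ≤ κ → ∃ w ∈ S, ‖w - (y + c • (f y - y))‖ ≤ ε * κ)
    (hball : ∀ y ∈ S, m ≤ ‖y - ξ‖ → ball y m' ⊆ Ω)
    (hm : m + 2 * R * ε ≤ Real.exp (-(2 * (A * R))) * ‖x - ξ‖)
    (hm' : 2 * R * ε * Real.exp ((D / m' + 1) * R) < m') :
    ‖f x - x‖ ≤ (D + 1) / R := by
  set N := ⌈R / κ⌉₊ with hN
  have hN1 : R / κ ≤ N := Nat.le_ceil _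
  have hN2 : (N : ℝ) * κ ≤ 2 * R := by
    have : (N : ℝ) < R / κ + 1 := Nat.ceil_lt_add_one (by positivity)
    have h2 : (N : ℝ) * κ < (R / κ + 1) * κ := by gcongr
    rw [add_mul, div_mul_cancel₀ _ hκ.ne'] at h2
    linarith
  have hN0 : (0 : ℝ) < N := lt_of_lt_of_le (by positivity) hN1
  set L := D / m' + 1 with hL
  have hL0 : 0 < L := by positivity
  have hlip : ∀ y, ball y m' ⊆ Ω → ∀ w ∈ ball y m', ‖(f w - w) - (f y - y)‖ ≤ L * ‖w - y‖ := by
    intro y hy w hw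
    have h1 : ‖f w - f y‖ ≤ D / m' * ‖w - y‖ := by
      have hmaps : MapsTo f (ball y m') (closedBall (f y) D) := by
        intro z hz
        rw [mem_closedBall, dist_eq_norm]
        exact hD _ (hfm (hy hz)) _ (hfm (hy (mem_ball_self hm'0)))
      have := Complex.dist_le_div_mul_dist_of_mapsTo_ball (hf.mono hy) hmaps hw
      rwa [dist_eq_norm, dist_eq_norm] at this
    calc ‖(f w - w) - (f y - y)‖ = ‖(f w - f y) - (w - y)‖ := by congr 1; abel
      _ ≤ ‖f w - f y‖ + ‖w - y‖ := norm_sub_le _ _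
      _ ≤ L * ‖w - y‖ := by rw [hL]; linarith
  have key : ∀ c : ℂ, N * ‖c‖ ≤ R → ∀ k : ℕ, k ≤ N → ∃ y ∈ S,
      Real.exp (-(2 * (A * (k * ‖c‖)))) * ‖x - ξ‖ - k * (ε * κ) ≤ ‖y - ξ‖ ∧
      ‖eulerPolygon f x c k - y‖ ≤ k * (ε * κ) * Real.exp (L * (k * ‖c‖)) ∧
      ball y m' ⊆ Ω ∧ eulerPolygon f x c k ∈ ball y m' := by
    intro c hc k
    have hcκ : ‖c‖ ≤ κ := by
      have h1 : ‖c‖ ≤ R / N := by rw [le_div_iff₀ hN0]; linarith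
      refine h1.trans ?_
      rw [div_le_iff₀ hN0]
      rw [div_le_iff₀ hκ] at hN1
      linarith
    have fin : ∀ k : ℕ, k ≤ N → ∀ y ∈ S,
        Real.exp (-(2 * (A * (k * ‖c‖)))) * ‖x - ξ‖ - k * (ε * κ) ≤ ‖y - ξ‖ →
        ‖eulerPolygon f x c k - y‖ ≤ k * (ε * κ) * Real.exp (L * (k * ‖c‖)) →
        ball y m' ⊆ Ω ∧ eulerPolygon f x c k ∈ ball y m' := by
      intro k hk y hy h1 h2
      have hkN : (k : ℝ) ≤ N := by exact_mod_cast hk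
      have hkc : k * ‖c‖ ≤ R := (by gcongr : k * ‖c‖ ≤ N * ‖c‖).trans hc
      have hkε : k * (ε * κ) ≤ 2 * R * ε := by
        calc k * (ε * κ) ≤ N * (ε * κ) := by gcongr
          _ = N * κ * ε := by ring
          _ ≤ 2 * R * ε := by gcongr
      refine ⟨hball y hy ?_, ?_⟩
      · have : Real.exp (-(2 * (A * R))) * ‖x - ξ‖ ≤
            Real.exp (-(2 * (A * (k * ‖c‖)))) * ‖x - ξ‖ := by gcongr
        linarith
      · rw [mem_ball, dist_eq_norm]
        refine (h2.trans ?_).trans_lt hm'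
        gcongr
    induction k with
    | zero =>
      intro hk
      have h1 : Real.exp (-(2 * (A * ((0 : ℕ) * ‖c‖)))) * ‖x - ξ‖ - (0 : ℕ) * (ε * κ) ≤
        ‖x - ξ‖ := by simp
      have h2 : ‖eulerPolygon f x c 0 - x‖ ≤ (0 : ℕ) * (ε * κ) *
        Real.exp (L * ((0 : ℕ) * ‖c‖)) := by simp [eulerPolygon]
      exact ⟨x, hx, h1, h2, fin 0 hk x hx h1 h2⟩
    | succ k ih =>
      intro hk
      obtain ⟨y, hy, h1, h2, h3, h4⟩ := ih (by omega)
      obtain ⟨w, hw, hwy⟩ := hstep y hy c hcκ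
      have hyΩ : y ∈ Ω := h3 (mem_ball_self hm'0)
      set u := A * ‖c‖ with hu
      have hu0 : 0 ≤ u := by positivity
      have hu1 : u ≤ 1 / 2 := (by gcongr : A * ‖c‖ ≤ A * κ).trans hκA
      have hεκ : 0 ≤ ε * κ := by positivity
      have a1 : Real.exp (-(2 * (A * ((k + 1 : ℕ) * ‖c‖)))) * ‖x - ξ‖ -
          (k + 1 : ℕ) * (ε * κ) ≤ ‖w - ξ‖ := by
        have e1 : Real.exp (-(2 * (A * ((k + 1 : ℕ) * ‖c‖)))) =
            Real.exp (-(2 * u)) * Real.exp (-(2 * (A * (k * ‖c‖)))) := by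
          rw [← Real.exp_add]; congr 1; rw [hu]; push_cast; ring
        have e2 : ‖y - ξ‖ - ‖c‖ * ‖f y - y‖ - ε * κ ≤ ‖w - ξ‖ := by
          have : y - ξ = (w - ξ) - c • (f y - y) - (w - (y + c • (f y - y))) := by abel
          have h5 : ‖y - ξ‖ ≤ ‖w - ξ‖ + ‖c • (f y - y)‖ + ‖w - (y + c • (f y - y))‖ := by
            conv_lhs => rw [this]
            exact (norm_sub_le _ _).trans (by gcongr; exact norm_sub_le _ _)
          rw [norm_smul] at h5
          linarith
        have e3 : ‖c‖ * ‖f y - y‖ ≤ u * ‖y - ξ‖ := by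
          calc ‖c‖ * ‖f y - y‖ ≤ ‖c‖ * (A * ‖y - ξ‖) := by gcongr; exact hG y hyΩ
            _ = u * ‖y - ξ‖ := by rw [hu]; ring
        have e4 : (1 - u) * (Real.exp (-(2 * (A * (k * ‖c‖)))) * ‖x - ξ‖ - k * (ε * κ)) ≤
            (1 - u) * ‖y - ξ‖ := by
          have : 0 ≤ 1 - u := by linarith
          gcongr
        have e5 : Real.exp (-(2 * u)) * (Real.exp (-(2 * (A * (k * ‖c‖)))) * ‖x - ξ‖) ≤
            (1 - u) * (Real.exp (-(2 * (A * (k * ‖c‖)))) * ‖x - ξ‖) := by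
          gcongr; exact exp_neg_two_mul_le hu0 hu1
        have e6 : 0 ≤ u * (k * (ε * κ)) := by positivity
        rw [e1]; push_cast
        nlinarith
      have a2 : ‖eulerPolygon f x c (k + 1) - w‖ ≤ (k + 1 : ℕ) * (ε * κ) *
          Real.exp (L * ((k + 1 : ℕ) * ‖c‖)) := by
        set X := eulerPolygon f x c k with hX
        have e0 : eulerPolygon f x c (k + 1) - w = (X - y) + c • ((f X - X) - (f y - y)) -
            (w - (y + c • (f y - y))) := by
          simp only [eulerPolygon, ← hX]; rw [smul_sub c (f X - X)]; abel
        have e1 : ‖eulerPolygon f x c (k + 1) - w‖ ≤ (1 + ‖c‖ * L) * ‖X - y‖ + ε * κ := by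
          rw [e0]
          have h5 := hlip y h3 X h4
          calc _ ≤ ‖X - y‖ + ‖c‖ * ‖(f X - X) - (f y - y)‖ + ‖w - (y + c • (f y - y))‖ := by
                rw [← norm_smul]
                exact (norm_sub_le _ _).trans (by gcongr; exact norm_add_le _ _)
            _ ≤ ‖X - y‖ + ‖c‖ * (L * ‖X - y‖) + ε * κ := by gcongr
            _ = _ := by ring
        have e2 : Real.exp (L * ((k + 1 : ℕ) * ‖c‖)) =
            Real.exp (‖c‖ * L) * Real.exp (L * (k * ‖c‖)) := by
          rw [← Real.exp_add]; congr 1; push_cast; ring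
        have e3 : 1 + ‖c‖ * L ≤ Real.exp (‖c‖ * L) := by
          linarith [Real.add_one_le_exp (‖c‖ * L)]
        have e4 : 1 ≤ Real.exp (L * ((k + 1 : ℕ) * ‖c‖)) := Real.one_le_exp (by positivity)
        calc _ ≤ (1 + ‖c‖ * L) * ‖X - y‖ + ε * κ := e1
          _ ≤ Real.exp (‖c‖ * L) * (k * (ε * κ) * Real.exp (L * (k * ‖c‖))) +
              ε * κ * Real.exp (L * ((k + 1 : ℕ) * ‖c‖)) := by
            refine add_le_add ?_ (le_mul_of_one_le_right hεκ e4)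
            gcongr
          _ = _ := by rw [e2]; push_cast; ring
      exact ⟨w, hw, a1, a2, fin _ hk w hw a1 a2⟩
  have hmem : ∀ c : ℂ, N * ‖c‖ ≤ R → ∀ k ≤ N, eulerPolygon f x c k ∈ Ω := fun c hc k hk => by
    obtain ⟨y, -, -, -, h3, h4⟩ := key c hc k hk
    exact h3 h4
  have hle : ∀ c ∈ ball (0 : ℂ) (R / N), N * ‖c‖ ≤ R := by
    intro c hc
    rw [mem_ball, dist_zero_right, lt_div_iff₀ hN0] at hc
    linarith
  have hdiff : DifferentiableOn ℂ (fun c => eulerPolygon f x c N) (ball 0 (R / N)) := fun c hc =>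
    (differentiableAt_eulerPolygon hΩo hf fun j hj =>
      hmem c (hle c hc) j hj.le).differentiableWithinAt
  have hmaps : MapsTo (fun c => eulerPolygon f x c N) (ball 0 (R / N))
      (closedBall (eulerPolygon f x 0 N) D) := by
    intro c hc
    rw [mem_closedBall, dist_eq_norm, eulerPolygon_zero_right]
    exact hD _ (hmem c (hle c hc) N le_rfl) _ hxΩ
  have hfin := Complex.norm_deriv_le_div_of_mapsTo_ball hdiff hmaps (by positivity)
  rw [(hasDerivAt_eulerPolygon_zero hΩo hf hxΩ N).deriv, norm_smul, Complex.norm_natCast,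
    div_div_eq_mul_div, le_div_iff₀ hR] at hfin
  rw [le_div_iff₀ hR]
  have : N * (‖f x - x‖ * R) ≤ N * D := by linarith
  linarith [le_of_mul_le_mul_left this hN0]

end EulerPolygon

section DiscFamily

variable {E : Type*} [NormedAddCommGroup E] [NormedSpace ℂ E] {Ω : Set E} {Λ : E →L[ℂ] ℂ} {ξ : E}
  {ℓ : ℕ} {f : E → E}

theorem re_cayley_pos {w : ℂ} (hw : ‖w‖ < 1) : 0 < ((1 - w) / (1 + w)).re := by
  have h1 : 1 + w ≠ 0 := by
    intro h
    have : w = -1 := by linear_combination h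
    rw [this, norm_neg, norm_one] at hw
    exact lt_irrefl _ hw
  have h2 : ((1 - w) / (1 + w)).re = (1 - ‖w‖ ^ 2) / Complex.normSq (1 + w) := by
    rw [Complex.div_re, ← add_div, ← Complex.normSq_eq_norm_sq, Complex.normSq_apply w]
    congr 1
    simp only [Complex.sub_re, Complex.add_re, Complex.one_re, Complex.sub_im, Complex.add_im,
      Complex.one_im]
    ring
  rw [h2]
  have := norm_nonneg w
  exact div_pos (by nlinarith) (Complex.normSq_pos.2 h1)

/-- A Möbius map of a neighbourhood of the closed disc into a half plane, with prescribed values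
at `0` and at `T / (T + g)`. -/
theorem exists_moebius_halfPlane {a : ℂ} {b g T : ℝ} (hg : 0 < g) (hT : 0 < T)
    (ha : a.re = b + g) : ∃ q : ℂ → ℂ, ∃ R > 1, DifferentiableOn ℂ q (ball 0 R) ∧
      (∀ ζ ∈ ball (0 : ℂ) R, b < (q ζ).re) ∧ q 0 = a + T ∧ q (T / (T + g) : ℝ) = a := by
  set R : ℝ := (T + g) / (T + 2 * g) with hR
  have hR0 : 0 < R := by positivity
  have hR1 : R < 1 := by rw [hR, div_lt_one (by positivity)]; linarith
  have hn : ∀ ζ ∈ ball (0 : ℂ) R⁻¹, ‖(R : ℂ) * ζ‖ < 1 := by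
    intro ζ hζ
    rw [mem_ball, dist_zero_right] at hζ
    rw [norm_mul, Complex.norm_real, Real.norm_of_nonneg hR0.le]
    calc R * ‖ζ‖ < R * R⁻¹ := by gcongr
      _ = 1 := mul_inv_cancel₀ hR0.ne'
  refine ⟨fun ζ => b + a.im * Complex.I + ((T + g : ℝ) : ℂ) * ((1 - R * ζ) / (1 + R * ζ)), R⁻¹,
    (one_lt_inv₀ hR0).2 hR1, ?_, ?_, ?_, ?_⟩
  · intro ζ hζ
    have h1 : 1 + R * ζ ≠ 0 := by
      intro h
      have h2 := hn ζ hζ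
      rw [show (R : ℂ) * ζ = -1 by linear_combination h, norm_neg, norm_one] at h2
      exact lt_irrefl _ h2
    have h3 : DifferentiableAt ℂ (fun ζ : ℂ => (1 - R * ζ) / (1 + R * ζ)) ζ :=
      DifferentiableAt.div (by fun_prop) (by fun_prop) h1
    exact ((h3.const_mul _).const_add _).differentiableWithinAt
  · intro ζ hζ
    have h1 := re_cayley_pos (hn ζ hζ)
    simp only [Complex.add_re, Complex.re_ofReal_mul, Complex.ofReal_re, Complex.I_re,
      mul_zero, add_zero]
    have : 0 < (T + g) * ((1 - R * ζ) / (1 + R * ζ)).re := by positivity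
    linarith
  · apply Complex.ext <;> simp [ha]
    ring
  · have h2 : (1 - (R : ℂ) * ((T / (T + g) : ℝ) : ℂ)) / (1 + R * ((T / (T + g) : ℝ) : ℂ)) =
        ((g / (T + g) : ℝ) : ℂ) := by
      rw [hR]
      norm_cast
      field_simp
      ring
    have h3 : (T + g) * (g / (T + g)) = g := by field_simp
    simp only [h2]
    rw [← Complex.ofReal_mul, h3]
    apply Complex.ext <;> simp [ha]

/-- Through every point `x` of the interior paraboloid at `ξ` pass discs centred close to `ξ`. -/
theorem exists_discs_through {C : ℝ} (hC : 0 < C)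
    (hpar : ∀ y, C * ‖y - ξ‖ ^ 2 < (Λ (y - ξ)).re → y ∈ Ω) {x : E}
    (hx : C * ‖x - ξ‖ ^ 2 < (Λ (x - ξ)).re) :
    ∃ p : ℝ → E, ∃ g > 0, ∃ K > 0, ∃ c > 0, ∀ᶠ T in atTop, ‖p T - ξ‖ ≤ K / T ∧
      (Λ (p T - ξ)).re ≤ K / T ∧ ball (p T) (c / T) ⊆ Ω ∧
      ∃ φ : ℂ → E, DiffContOnCl ℂ φ (ball 0 1) ∧ MapsTo φ (closedBall 0 1) Ω ∧ φ 0 = p T ∧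
        φ (T / (T + g) : ℝ) = x := by
  set v := x - ξ with hv
  set a := Λ v with ha
  set b := C * ‖v‖ ^ 2 with hb
  have hb0 : 0 ≤ b := by positivity
  have hapos : 0 < a.re := hb0.trans_lt hx
  have ha0 : a ≠ 0 := fun h => by simp [h] at hapos
  have hna : 0 < ‖a‖ := norm_pos_iff.2 ha0
  set ca := (starRingEnd ℂ) a with hca
  have hcare : ca.re = a.re := Complex.conj_re a
  have hcan : ‖ca‖ = ‖a‖ := Complex.norm_conj a
  have hcaa : ca * a = ((‖a‖ ^ 2 : ℝ) : ℂ) := by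
    rw [hca, mul_comm, Complex.mul_conj, Complex.normSq_eq_norm_sq]
  set g := a.re - b with hg
  have hg0 : 0 < g := sub_pos.2 hx
  set c := ‖a‖ ^ 2 / (8 * (‖Λ‖ + 1)) with hc
  have hc0 : 0 < c := by positivity
  set K := ‖a‖ * ‖v‖ + ‖a‖ ^ 2 with hK
  have hK0 : 0 < K := by positivity
  -- the curve `w ↦ ξ + (ca / w) • v` on the half plane `b < re w`
  have hmem : ∀ w : ℂ, b < w.re → ξ + (ca / w) • v ∈ Ω := by
    intro w hw
    have hw0 : w ≠ 0 := fun h => by rw [h, Complex.zero_re] at hw; linarith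
    have hwn : 0 < ‖w‖ := norm_pos_iff.2 hw0
    refine hpar _ ?_
    rw [add_sub_cancel_left, map_smul, norm_smul, norm_div, hcan, smul_eq_mul, ← ha,
      div_mul_eq_mul_div ca, hcaa, Complex.div_re, Complex.ofReal_re, Complex.ofReal_im, zero_mul,
      zero_div, add_zero, Complex.normSq_eq_norm_sq, mul_pow, div_pow]
    calc C * (‖a‖ ^ 2 / ‖w‖ ^ 2 * ‖v‖ ^ 2) = ‖a‖ ^ 2 * b / ‖w‖ ^ 2 := by rw [hb]; ring
      _ < ‖a‖ ^ 2 * w.re / ‖w‖ ^ 2 := by gcongr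
  refine ⟨fun T => ξ + (ca / (ca + T)) • v, g, hg0, K, hK0, c, hc0, ?_⟩
  filter_upwards [eventually_gt_atTop 0, eventually_ge_atTop ‖a‖,
    eventually_gt_atTop (C * (c + K) ^ 2 * 8 / ‖a‖ ^ 2)] with T hT hTa hTC
  have hreT : (ca + (T : ℂ)).re = a.re + T := by simp [hcare]
  have hnT : T ≤ ‖ca + T‖ := by
    calc T ≤ (ca + (T : ℂ)).re := by rw [hreT]; linarith
      _ ≤ _ := Complex.re_le_norm _
  have hnT0 : 0 < ‖ca + T‖ := hT.trans_le hnT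
  have hnT2 : ‖ca + T‖ ≤ 2 * T := by
    refine (norm_add_le _ _).trans ?_
    rw [hcan, Complex.norm_real, Real.norm_of_nonneg hT.le]
    linarith
  have hnorm : ‖ξ + (ca / (ca + T)) • v - ξ‖ ≤ ‖a‖ * ‖v‖ / T := by
    rw [add_sub_cancel_left, norm_smul, norm_div, hcan, div_mul_eq_mul_div]
    gcongr
  have hre : (Λ (ξ + (ca / (ca + T)) • v - ξ)).re = ‖a‖ ^ 2 * (a.re + T) / ‖ca + T‖ ^ 2 := by
    rw [add_sub_cancel_left, map_smul, smul_eq_mul, ← ha, div_mul_eq_mul_div, hcaa, Complex.div_re,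
      Complex.ofReal_re, Complex.ofReal_im, zero_mul, zero_div, add_zero, hreT,
      Complex.normSq_eq_norm_sq]
  have hreup : (Λ (ξ + (ca / (ca + T)) • v - ξ)).re ≤ ‖a‖ ^ 2 / T := by
    rw [hre, div_le_div_iff₀ (by positivity) hT]
    have h1 : a.re + T ≤ ‖ca + T‖ := hreT ▸ Complex.re_le_norm _
    have : (a.re + T) * T ≤ ‖ca + T‖ ^ 2 := by
      rw [sq]; gcongr
    nlinarith [sq_nonneg ‖a‖]
  have hrelow : ‖a‖ ^ 2 / (4 * T) ≤ (Λ (ξ + (ca / (ca + T)) • v - ξ)).re := by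
    rw [hre, div_le_div_iff₀ (by positivity) (by positivity)]
    have : ‖ca + T‖ ^ 2 ≤ (a.re + T) * (4 * T) := by
      calc ‖ca + T‖ ^ 2 ≤ (2 * T) ^ 2 := by gcongr
        _ ≤ _ := by nlinarith
    nlinarith [sq_nonneg ‖a‖]
  refine ⟨hnorm.trans ?_, hreup.trans ?_, ?_, ?_⟩
  · gcongr; rw [hK]; linarith [sq_nonneg ‖a‖]
  · gcongr; rw [hK]; linarith [mul_nonneg (norm_nonneg a) (norm_nonneg v)]
  · intro y hy
    rw [mem_ball, dist_eq_norm] at hy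
    set q := ξ + (ca / (ca + T)) • v with hq
    refine hpar y ?_
    have h1 : ‖y - ξ‖ ≤ (c + K) / T := by
      calc ‖y - ξ‖ = ‖(y - q) + (q - ξ)‖ := by congr 1; abel
        _ ≤ ‖y - q‖ + ‖q - ξ‖ := norm_add_le _ _
        _ ≤ c / T + K / T := by
          refine add_le_add hy.le (hnorm.trans ?_)
          gcongr; rw [hK]; linarith [sq_nonneg ‖a‖]
        _ = _ := by ring
    have h2 : -(‖a‖ ^ 2 / (8 * T)) ≤ (Λ (y - q)).re := by
      refine neg_le_of_abs_le ((Complex.abs_re_le_norm _).trans ((Λ.le_opNorm _).trans ?_))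
      calc ‖Λ‖ * ‖y - q‖ ≤ (‖Λ‖ + 1) * (c / T) := by gcongr; linarith
        _ = ‖a‖ ^ 2 / (8 * T) := by rw [hc]; field_simp
    have h3 : (Λ (y - ξ)).re = (Λ (y - q)).re + (Λ (q - ξ)).re := by
      simp only [map_sub, Complex.sub_re]; ring
    have h4 : ‖a‖ ^ 2 / (4 * T) = ‖a‖ ^ 2 / (8 * T) + ‖a‖ ^ 2 / (8 * T) := by field_simp; ring
    rw [h3]
    calc C * ‖y - ξ‖ ^ 2 ≤ C * ((c + K) / T) ^ 2 := by gcongr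
      _ < ‖a‖ ^ 2 / (8 * T) := by
        rw [div_lt_iff₀ (by positivity)] at hTC
        rw [div_pow, mul_div_assoc', div_lt_div_iff₀ (by positivity) (by positivity)]
        nlinarith
      _ ≤ _ := by linarith
  · obtain ⟨q, R, hR1, hqd, hqre, hq0, hqs⟩ :=
      exists_moebius_halfPlane (a := ca) (b := b) hg0 hT (by rw [hcare, hg]; ring)
    have hdiff : DifferentiableOn ℂ (fun ζ => ξ + (ca / q ζ) • v) (ball 0 R) := by
      intro ζ hζ
      have h0 : q ζ ≠ 0 := fun h => by
        have := hqre ζ hζ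
        rw [h, Complex.zero_re] at this; linarith
      exact (((differentiableWithinAt_const ca).div (hqd ζ hζ) h0).smul_const v).const_add ξ
    have hsub : closedBall (0 : ℂ) 1 ⊆ ball 0 R := closedBall_subset_ball hR1
    refine ⟨fun ζ => ξ + (ca / q ζ) • v, ?_, fun ζ hζ => hmem _ (hqre ζ (hsub hζ)), ?_, ?_⟩
    · exact (hdiff.mono (closure_ball (0 : ℂ) one_ne_zero ▸ hsub)).diffContOnCl
    · simp only [hq0]
    · have hca0 : ca ≠ 0 := by rw [← norm_pos_iff, hcan]; exact hna
      simp only [hqs, div_self hca0, one_smul, hv, add_sub_cancel]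

end DiscFamily

section Rigidity

variable {E : Type*} [NormedAddCommGroup E] [NormedSpace ℂ E] {Ω : Set E} {Λ : E →L[ℂ] ℂ} {ξ : E}
  {ℓ : ℕ} {f : E → E}

namespace IsFiniteTypePoint

set_option maxHeartbeats 800000 in
theorem exists_approx_step [CompleteSpace E] (H : IsFiniteTypePoint Ω Λ ξ ℓ) {D : ℝ} (hD0 : 0 ≤ D)
    (hD : ∀ x ∈ Ω, ∀ y ∈ Ω, ‖x - y‖ ≤ D) (hf : DifferentiableOn ℂ f Ω) (hfm : MapsTo f Ω Ω)
    (hsmall : ∀ ε > 0, ∃ δ > 0, ∀ z ∈ Ω, ‖z - ξ‖ < δ →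
      ‖f z - z‖ ≤ ε * ‖z - ξ‖ ^ ((4 : ℝ) - (ℓ : ℝ)⁻¹))
    {p : ℝ → E} {g K c : ℝ} (hg : 0 < g) (hK : 0 < K) (hc : 0 < c)
    (hp : ∀ᶠ T in atTop, ‖p T - ξ‖ ≤ K / T ∧ (Λ (p T - ξ)).re ≤ K / T ∧ ball (p T) (c / T) ⊆ Ω)
    {ε : ℝ} (hε : 0 < ε) :
    ∀ᶠ T in atTop, ∀ φ : ℂ → E, DiffContOnCl ℂ φ (ball 0 1) → MapsTo φ (closedBall 0 1) Ω →
      φ 0 = p T → ∀ w : ℂ, ‖w‖ ≤ (1 - T / (T + g)) ^ 2 / 16 →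
      ∃ ψ : ℂ → E, DiffContOnCl ℂ ψ (ball 0 1) ∧ MapsTo ψ (closedBall 0 1) Ω ∧ ψ 0 = p T ∧
        ‖ψ (T / (T + g) : ℝ) - (φ (T / (T + g) : ℝ) +
          w • (f (φ (T / (T + g) : ℝ)) - φ (T / (T + g) : ℝ)))‖ ≤
          ε * ((1 - T / (T + g)) ^ 2 / 16) := by
  obtain ⟨Cd, hCd, ρd, hρd, hder⟩ := H.exists_deriv_le
  set θ : ℝ := (ℓ : ℝ)⁻¹ with hθ
  have hθ0 : 0 < θ := inv_pos.2 (Nat.cast_pos.2 (Nat.pos_of_ne_zero H.ne_zero))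
  have hθ1 : θ ≤ 1 := inv_le_one_of_one_le₀ (Nat.one_le_cast.2 (Nat.one_le_iff_ne_zero.2 H.ne_zero))
  set Q := c + K with hQ
  have hQ0 : 0 < Q := by positivity
  set B := Q ^ 3 * (1 + 2 * Cd * Q / c) with hB
  have hB0 : 0 < B := by positivity
  set η₀ := ε * g ^ 2 / (64 * (2 * D + 1)) with hη₀
  have hη₀0 : 0 < η₀ := by positivity
  obtain ⟨δ, hδ, hsm⟩ := hsmall (η₀ * c / (2 * B)) (by positivity)
  filter_upwards [hp, eventually_gt_atTop 0, eventually_ge_atTop g, eventually_ge_atTop c,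
    eventually_ge_atTop (2 * η₀ + 1), eventually_gt_atTop (Q / δ), eventually_gt_atTop (K / ρd),
    eventually_ge_atTop Q]
    with T hpT hT hTg hTc hTη hTδ hTρ hTQ φ hφ hφm hφ0 w hw
  obtain ⟨hp1, hp2, hp3⟩ := hpT
  set s := T / (T + g) with hs
  have h1s : 1 - s = g / (T + g) := by rw [hs]; field_simp; ring
  have hs1 : s < 1 := by
    have : 0 < 1 - s := by rw [h1s]; positivity
    linarith
  have hshalf : 1 / 2 ≤ s := by
    rw [hs, div_le_div_iff₀ (by norm_num) (by positivity)]; linarith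
  set ε₁ := η₀ * c / (2 * B) with hε₁
  have hε₁0 : 0 < ε₁ := by positivity
  have hpΩ : p T ∈ Ω := hp3 (mem_ball_self (by positivity))
  -- smallness of `f - id` near the centre of the disc
  set M := ε₁ * (Q / T) ^ (4 - θ) with hM
  have hG : ∀ z ∈ ball (p T) (c / T), ‖f z - z‖ ≤ M := by
    intro z hz
    have hzξ : ‖z - ξ‖ ≤ Q / T := by
      rw [mem_ball, dist_eq_norm] at hz
      calc ‖z - ξ‖ = ‖(z - p T) + (p T - ξ)‖ := by congr 1; abel
        _ ≤ c / T + K / T := (norm_add_le _ _).trans (add_le_add hz.le hp1)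
        _ = Q / T := by rw [hQ]; ring
    have hQδ : Q / T < δ := by
      rw [div_lt_iff₀ hδ] at hTδ
      rw [div_lt_iff₀ hT]; linarith
    refine (hsm z (hp3 hz) (hzξ.trans_lt hQδ)).trans ?_
    rw [hM]
    gcongr
    linarith
  have hQT0 : 0 < Q / T := by positivity
  have hQT1 : Q / T ≤ 1 := (div_le_one hT).2 hTQ
  have hM0 : 0 ≤ M := by positivity
  have hGd : DifferentiableOn ℂ (fun z => f z - z) Ω := hf.sub differentiableOn_id
  have hfd : ‖fderiv ℂ (fun z => f z - z) (p T)‖ ≤ 2 * M / (c / T) := by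
    refine Complex.norm_fderiv_le_div_of_mapsTo_ball (hGd.mono hp3) (fun z hz => ?_) (by positivity)
    rw [mem_closedBall, dist_eq_norm]
    have h1 := hG z hz
    have h2 := hG (p T) (mem_ball_self (by positivity))
    exact (norm_sub_le _ _).trans (by linarith)
  have hφd : ‖deriv φ 0‖ ≤ Cd * (Q / T) ^ θ := by
    have h1 := hder φ hφ.differentiableOn (hφm.mono_left ball_subset_closedBall) 0 le_rfl one_pos
    simp only [Complex.ofReal_zero, hφ0, sub_zero, one_mul] at h1
    have h2 : ‖p T - ξ‖ < ρd := by
      refine hp1.trans_lt ?_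
      rw [div_lt_iff₀ hρd] at hTρ
      rw [div_lt_iff₀ hT]; linarith
    refine (h1 h2).le.trans ?_
    have h3 := (H.pos _ hpΩ).le
    have h4 : K ≤ Q := by rw [hQ]; linarith
    gcongr
    exact hp2.trans (by gcongr)
  have hcomp : deriv (fun ζ => f (φ ζ) - φ ζ) 0 =
      fderiv ℂ (fun z => f z - z) (p T) (deriv φ 0) := by
    have h1 : HasFDerivAt (fun z => f z - z) (fderiv ℂ (fun z => f z - z) (p T)) (φ 0) := by
      rw [hφ0]
      exact (hGd.differentiableAt (H.isOpen.mem_nhds hpΩ)).hasFDerivAt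
    have h2 := (hφ.differentiableAt isOpen_ball (mem_ball_self one_pos)).hasDerivAt
    exact (h1.comp_hasDerivAt (0 : ℂ) h2).deriv
  have hMle : M ≤ ε₁ * (Q / T) ^ 3 := by
    rw [hM, ← Real.rpow_natCast]
    gcongr ?_ * ?_
    refine Real.rpow_le_rpow_of_exponent_ge hQT0 hQT1 ?_
    push_cast; linarith
  have hMθ : M * (Q / T) ^ θ = ε₁ * (Q / T) ^ 4 := by
    rw [hM, mul_assoc, ← Real.rpow_add hQT0, sub_add_cancel, ← Real.rpow_natCast]
    norm_num
  have hA : ‖f (φ 0) - φ 0‖ + ‖deriv (fun ζ => f (φ ζ) - φ ζ) 0‖ ≤ η₀ / T ^ 2 * (c / T) / 2 := by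
    rw [hφ0, hcomp]
    calc _ ≤ M + 2 * M / (c / T) * (Cd * (Q / T) ^ θ) := by
          refine add_le_add (hG _ (mem_ball_self (by positivity))) ?_
          refine (ContinuousLinearMap.le_opNorm _ _).trans ?_
          gcongr
      _ = M + 2 * Cd * T / c * (M * (Q / T) ^ θ) := by field_simp
      _ ≤ ε₁ * (Q / T) ^ 3 + 2 * Cd * T / c * (ε₁ * (Q / T) ^ 4) := by rw [hMθ]; gcongr
      _ = ε₁ * B / T ^ 3 := by rw [hB]; field_simp
      _ = η₀ / T ^ 2 * (c / T) / 2 := by rw [hε₁]; field_simp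
  have hη1 : η₀ / T ^ 2 ≤ 1 / 2 := by
    have h1 : T ≤ T ^ 2 := le_self_pow₀ (by linarith) two_ne_zero
    rw [div_le_div_iff₀ (by positivity) (by norm_num)]
    linarith
  obtain ⟨ψ, hψ, hψm, hψ0, hψs⟩ := exists_disc_step H.isOpen H.convex hD hf hfm hφ hφm hshalf hs1
    (ρ := c / T) (η := η₀ / T ^ 2) (by positivity) ((div_le_one hT).2 hTc) (hφ0 ▸ hp3)
    (by positivity) hη1 hA hw
  refine ⟨ψ, hψ, hψm, hψ0.trans hφ0, hψs.trans ?_⟩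
  rw [h1s, hη₀]
  have h2 : (T + g) ^ 2 ≤ 4 * T ^ 2 := by
    calc (T + g) ^ 2 ≤ (T + T) ^ 2 := by gcongr
      _ = 4 * T ^ 2 := by ring
  calc ε * g ^ 2 / (64 * (2 * D + 1)) / T ^ 2 * (2 * D + 1) = ε * g ^ 2 / (16 * (4 * T ^ 2)) := by
        field_simp; ring
    _ ≤ ε * g ^ 2 / (16 * (T + g) ^ 2) := by gcongr
    _ = ε * ((g / (T + g)) ^ 2 / 16) := by field_simp

theorem exists_norm_sub_le (H : IsFiniteTypePoint Ω Λ ξ ℓ) {D : ℝ} (hD0 : 0 ≤ D)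
    (hD : ∀ x ∈ Ω, ∀ y ∈ Ω, ‖x - y‖ ≤ D) (hfm : MapsTo f Ω Ω)
    (hsmall : ∀ ε > 0, ∃ δ > 0, ∀ z ∈ Ω, ‖z - ξ‖ < δ →
      ‖f z - z‖ ≤ ε * ‖z - ξ‖ ^ ((4 : ℝ) - (ℓ : ℝ)⁻¹)) :
    ∃ A > 0, ∀ y ∈ Ω, ‖f y - y‖ ≤ A * ‖y - ξ‖ := by
  obtain ⟨δ, hδ, hsm⟩ := hsmall 1 one_pos
  have hθ1 : (ℓ : ℝ)⁻¹ ≤ 1 :=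
    inv_le_one_of_one_le₀ (Nat.one_le_cast.2 (Nat.one_le_iff_ne_zero.2 H.ne_zero))
  have hδ' : 0 < min δ 1 := lt_min hδ one_pos
  refine ⟨1 + D / min δ 1, by positivity, fun y hy => ?_⟩
  have hyξ : 0 < ‖y - ξ‖ := by
    rw [norm_pos_iff]
    intro h
    have := H.pos y hy
    simp [h] at this
  rcases lt_or_ge ‖y - ξ‖ (min δ 1) with h | h
  · have h1 := hsm y hy (h.trans_le (min_le_left _ _))
    have h2 : ‖y - ξ‖ ^ ((4 : ℝ) - (ℓ : ℝ)⁻¹) ≤ ‖y - ξ‖ ^ (1 : ℝ) :=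
      Real.rpow_le_rpow_of_exponent_ge hyξ (h.le.trans (min_le_right _ _)) (by linarith)
    rw [Real.rpow_one] at h2
    have : 0 ≤ D / min δ 1 * ‖y - ξ‖ := by positivity
    linarith
  · have h1 : D ≤ D / min δ 1 * ‖y - ξ‖ := by
      rw [div_mul_eq_mul_div, le_div_iff₀ hδ']
      gcongr
    have := hD _ (hfm hy) _ hy
    linarith

theorem eq_of_mem_paraboloid [ProperSpace E] (H : IsFiniteTypePoint Ω Λ ξ ℓ)
    (hf : DifferentiableOn ℂ f Ω) (hfm : MapsTo f Ω Ω)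
    (hsmall : ∀ ε > 0, ∃ δ > 0, ∀ z ∈ Ω, ‖z - ξ‖ < δ →
      ‖f z - z‖ ≤ ε * ‖z - ξ‖ ^ ((4 : ℝ) - (ℓ : ℝ)⁻¹))
    {C : ℝ} (hC : 0 < C) (hpar : ∀ y, C * ‖y - ξ‖ ^ 2 < (Λ (y - ξ)).re → y ∈ Ω) {x : E}
    (hx : C * ‖x - ξ‖ ^ 2 < (Λ (x - ξ)).re) : f x = x := by
  set D := diam Ω with hDdef
  have hD0 : 0 ≤ D := diam_nonneg
  have hD : ∀ x ∈ Ω, ∀ y ∈ Ω, ‖x - y‖ ≤ D := fun x hx y hy => by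
    rw [← dist_eq_norm]; exact dist_le_diam_of_mem H.bounded hx hy
  obtain ⟨A, hA, hG⟩ := H.exists_norm_sub_le hD0 hD hfm hsmall
  obtain ⟨p, g, hg, K, hK, c, hc, hp⟩ := exists_discs_through hC hpar hx
  have hxΩ : x ∈ Ω := hpar x hx
  have hxξ : 0 < ‖x - ξ‖ := by
    rw [norm_pos_iff]
    intro h
    have := H.pos x hxΩ
    simp [h] at this
  have hpξ : Tendsto p atTop (𝓝 ξ) := by
    rw [tendsto_iff_norm_sub_tendsto_zero]
    exact squeeze_zero' (Eventually.of_forall fun _ => norm_nonneg _) (hp.mono fun T h => h.1)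
      (tendsto_const_nhds.div_atTop tendsto_id)
  have key : ∀ R : ℝ, 0 < R → ‖f x - x‖ ≤ (D + 1) / R := by
    intro R hR
    set m := Real.exp (-(2 * (A * R))) * ‖x - ξ‖ / 2 with hm
    have hm0 : 0 < m := by positivity
    obtain ⟨m', hm', hball⟩ :=
      H.exists_ball_subset_of_disc hpξ hK (hp.mono fun T h => h.2.1) hg hm0
    set X := Real.exp ((D / m' + 1) * R) with hX
    have hX0 : 0 < X := Real.exp_pos _
    set ε := min (m / (2 * R)) (m' / (4 * R * X)) with hε
    have hε0 : 0 < ε := by positivity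
    have hεm : 2 * R * ε ≤ m := by
      have : ε ≤ m / (2 * R) := min_le_left _ _
      rw [le_div_iff₀ (by positivity)] at this
      linarith
    have hεm' : 2 * R * ε * X < m' := by
      have : ε ≤ m' / (4 * R * X) := min_le_right _ _
      rw [le_div_iff₀ (by positivity)] at this
      nlinarith
    have hstep := H.exists_approx_step hD0 hD hf hfm hsmall hg hK hc
      (hp.mono fun T h => ⟨h.1, h.2.1, h.2.2.1⟩) hε0
    have hκ : Tendsto (fun T : ℝ => (1 - T / (T + g)) ^ 2 / 16) atTop (𝓝 0) := by
      have h1 : Tendsto (fun T : ℝ => g / (T + g)) atTop (𝓝 0) :=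
        tendsto_const_nhds.div_atTop (tendsto_atTop_add_const_right _ _ tendsto_id)
      have h2 : Tendsto (fun T : ℝ => (g / (T + g)) ^ 2 / 16) atTop (𝓝 0) := by
        simpa using (h1.pow 2).div_const 16
      refine h2.congr' ?_
      filter_upwards [eventually_gt_atTop 0] with T hT
      have : 1 - T / (T + g) = g / (T + g) := by field_simp; ring
      rw [this]
    obtain ⟨T, hT, hpT, hballT, hstepT, hκ1, hκ2⟩ := ((eventually_gt_atTop (0 : ℝ)).and
      (hp.and (hball.and (hstep.and ((hκ.eventually (gt_mem_nhds
        (by positivity : 0 < 1 / (2 * A)))).and (hκ.eventually (gt_mem_nhds hR))))))).exists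
    obtain ⟨-, -, -, φ, hφ, hφm, hφ0, hφx⟩ := hpT
    have h1s : 1 - T / (T + g) = g / (T + g) := by field_simp; ring
    refine norm_sub_le_of_approx_steps H.isOpen hD0 hD hf hfm hA hG
      (S := {y | ∃ φ : ℂ → E, DiffContOnCl ℂ φ (ball 0 1) ∧ MapsTo φ (closedBall 0 1) Ω ∧
        φ 0 = p T ∧ φ (T / (T + g) : ℝ) = y}) ⟨φ, hφ, hφm, hφ0, hφx⟩ hxΩ hR
      (κ := (1 - T / (T + g)) ^ 2 / 16) (by rw [h1s]; positivity) hε0.le hm' ?_ hκ2.le ?_ ?_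
      (m := m) (by linarith) hεm'
    · rw [lt_div_iff₀ (by positivity)] at hκ1
      linarith
    · rintro _ ⟨φ, hφ, hφm, hφ0, rfl⟩ w hw
      obtain ⟨ψ, hψ, hψm, hψ0, hψs⟩ := hstepT φ hφ hφm hφ0 w hw
      exact ⟨_, ⟨ψ, hψ, hψm, hψ0, rfl⟩, hψs⟩
    · rintro _ ⟨φ, hφ, hφm, hφ0, rfl⟩ hy
      exact hballT φ hφ.differentiableOn (hφm.mono_left ball_subset_closedBall) hφ0 hy
  have hlim : Tendsto (fun R : ℝ => (D + 1) / R) atTop (𝓝 0) :=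
    tendsto_const_nhds.div_atTop tendsto_id
  have := ge_of_tendsto hlim ((eventually_gt_atTop 0).mono key)
  exact sub_eq_zero.1 (norm_le_zero_iff.1 this)

theorem eqOn_id [ProperSpace E] (H : IsFiniteTypePoint Ω Λ ξ ℓ) (hne : Ω.Nonempty)
    (hf : DifferentiableOn ℂ f Ω) (hfm : MapsTo f Ω Ω)
    (hsmall : ∀ ε > 0, ∃ δ > 0, ∀ z ∈ Ω, ‖z - ξ‖ < δ →
      ‖f z - z‖ ≤ ε * ‖z - ξ‖ ^ ((4 : ℝ) - (ℓ : ℝ)⁻¹)) : EqOn f id Ω := by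
  obtain ⟨C, hC, hpar⟩ := H.paraboloid
  have hfix : ∀ x, C * ‖x - ξ‖ ^ 2 < (Λ (x - ξ)).re → f x = x := fun x hx =>
    H.eq_of_mem_paraboloid hf hfm hsmall hC hpar hx
  obtain ⟨x, hx⟩ : ∃ x, C * ‖x - ξ‖ ^ 2 < (Λ (x - ξ)).re := by
    obtain ⟨y, hy⟩ := hne
    have hlim : Tendsto (fun t : ℝ => C * t * ‖y - ξ‖ ^ 2) (𝓝[>] 0) (𝓝 0) := by
      have : Continuous fun t : ℝ => C * t * ‖y - ξ‖ ^ 2 := by fun_prop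
      simpa using (this.tendsto 0).mono_left nhdsWithin_le_nhds
    obtain ⟨t, ht1, ht2⟩ := ((hlim.eventually (gt_mem_nhds (H.pos y hy))).and
      (Ioo_mem_nhdsGT one_pos)).exists
    refine ⟨ξ + (t : ℂ) • (y - ξ), ?_⟩
    rw [add_sub_cancel_left, map_smul, norm_smul, Complex.norm_real, Real.norm_of_nonneg ht2.1.le,
      smul_eq_mul, Complex.re_ofReal_mul]
    calc C * (t * ‖y - ξ‖) ^ 2 = t * (C * t * ‖y - ξ‖ ^ 2) := by ring
      _ < _ := mul_lt_mul_of_pos_left ht1 ht2.1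
  intro y hy
  set γ : ℂ → E := fun τ => x + τ • (y - x) with hγ
  have hγc : Continuous γ := by fun_prop
  have hγd : Differentiable ℂ γ := by fun_prop
  have hVo : IsOpen (γ ⁻¹' Ω) := H.isOpen.preimage hγc
  have hVc : Convex ℝ (γ ⁻¹' Ω) := by
    intro τ₁ h₁ τ₂ h₂ a b ha hb hab
    have := H.convex h₁ h₂ ha hb hab
    rw [mem_preimage]
    convert this using 1
    simp only [hγ]
    rw [smul_add, smul_add, add_smul, smul_assoc, smul_assoc, add_add_add_comm, ← add_smul, hab,
      one_smul]
  have han : AnalyticOnNhd ℂ (fun τ => f (γ τ) - γ τ) (γ ⁻¹' Ω) :=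
    ((hf.comp hγd.differentiableOn (mapsTo_preimage γ Ω)).sub
      hγd.differentiableOn).analyticOnNhd hVo
  have h0 : (0 : ℂ) ∈ γ ⁻¹' Ω := by
    have : γ 0 = x := by simp [hγ]
    rw [mem_preimage, this]; exact hpar x hx
  have hev : (fun τ => f (γ τ) - γ τ) =ᶠ[𝓝 0] 0 := by
    have hc1 : Continuous fun τ => C * ‖γ τ - ξ‖ ^ 2 := by fun_prop
    have hc2 : Continuous fun τ => (Λ (γ τ - ξ)).re := by fun_prop
    have hx' : C * ‖γ 0 - ξ‖ ^ 2 < (Λ (γ 0 - ξ)).re := by simpa [hγ] using hx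
    filter_upwards [(isOpen_lt hc1 hc2).mem_nhds hx'] with τ hτ
    simp [hfix _ hτ]
  have h1 : γ 1 = y := by simp [hγ]
  have := han.eqOn_zero_of_preconnected_of_eventuallyEq_zero hVc.isPreconnected h0 hev
    (show (1 : ℂ) ∈ γ ⁻¹' Ω by rw [mem_preimage, h1]; exact hy)
  simp only [h1, Pi.zero_apply] at this
  exact sub_eq_zero.1 this

end IsFiniteTypePoint

end Rigidity

theorem isFiniteTypePoint_of_lineType {E : Type*} [NormedAddCommGroup E] [NormedSpace ℂ E]
    [FiniteDimensional ℝ E] {Ω U : Set E} {r : E → ℝ} {ξ : E} (hΩo : IsOpen Ω)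
    (hΩc : Convex ℝ Ω) (hΩb : Bornology.IsBounded Ω) (hUcl : closure Ω ⊆ U)
    (hUo : IsOpen U) (hr : ContDiffOn ℝ (⊤ : ℕ∞) r U) (hΩdef : Ω = {z | z ∈ U ∧ r z < 0})
    (hξ : ξ ∈ frontier Ω) (hgrad : fderiv ℝ r ξ ≠ 0) {ℓ : ℕ} (hℓ : lineType r ξ = ℓ) :
    ∃ Λ : E →L[ℂ] ℂ, IsFiniteTypePoint Ω Λ ξ ℓ := by
  obtain ⟨hξU, -, hr0⟩ := frontier_defining_function hΩo hUcl hUo hr hΩdef hξ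
  obtain ⟨Λ, hΛ⟩ : ∃ Λ : E →L[ℂ] ℂ, ∀ v, (Λ v).re = -fderiv ℝ r ξ v :=
    ⟨StrongDual.extendRCLike (-fderiv ℝ r ξ), fun v =>
      StrongDual.re_extendRCLike_apply (𝕜 := ℂ) (-fderiv ℝ r ξ) v⟩
  refine ⟨Λ, hΩo, hΩc, hΩb, fun y hy => ?_, ?_, ?_, ?_⟩
  · rw [hΛ]
    linarith [fderiv_neg_of_mem hΩo hΩc hUcl hUo hr hΩdef hξ hgrad hy]
  · rintro rfl
    have := one_le_lineType hUo hr hξU hr0 hgrad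
    simp [hℓ] at this
  · simp only [hΛ]
    exact exists_norm_pow_le hΩo hΩc hΩb hUcl hUo hr hΩdef hξ hgrad hℓ
  · simp only [hΛ]
    exact exists_interior_paraboloid hΩo hUcl hUo hr hΩdef hξ

/-- If `Ω ⊂ ℂ^d` is a bounded convex domain with `C^∞` boundary,
`f : Ω → Ω` is holomorphic, `ξ₀ ∈ ∂Ω` has finite line type `ℓ`, and
`f(z) = z + o(‖z - ξ₀‖^(4 - 1/ℓ))`, then `f = id`. -/
theorem statement1 {d : ℕ} (Ω U : Set (EuclideanSpace ℂ (Fin d))) (r : EuclideanSpace ℂ (Fin d) → ℝ)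
    (hΩo : IsOpen Ω) (hΩne : Ω.Nonempty) (hΩb : Bornology.IsBounded Ω) (hΩc : Convex ℝ Ω)
    (hUo : IsOpen U) (hUcl : closure Ω ⊆ U) (hr : ContDiffOn ℝ (⊤ : ℕ∞) r U)
    (hΩdef : Ω = {z | z ∈ U ∧ r z < 0}) (hgrad : ∀ z ∈ frontier Ω, fderiv ℝ r z ≠ 0)
    (f : EuclideanSpace ℂ (Fin d) → EuclideanSpace ℂ (Fin d))
    (hf : DifferentiableOn ℂ f Ω) (hfm : MapsTo f Ω Ω)
    (ξ₀ : EuclideanSpace ℂ (Fin d)) (hξ : ξ₀ ∈ frontier Ω)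
    (ℓ : ℕ) (hℓ : lineType r ξ₀ = (ℓ : ℕ∞))
    (hlim : Tendsto (fun z => ‖f z - z‖ / ‖z - ξ₀‖ ^ ((4:ℝ) - 1/(ℓ:ℝ)))
      (𝓝[Ω] ξ₀) (𝓝 0)) :
    EqOn f id Ω := by
  have : FiniteDimensional ℝ (EuclideanSpace ℂ (Fin d)) := FiniteDimensional.complexToReal _
  obtain ⟨Λ, H⟩ := isFiniteTypePoint_of_lineType hΩo hΩc hΩb hUcl hUo hr hΩdef hξ (hgrad ξ₀ hξ) hℓ
  refine H.eqOn_id hΩne hf hfm fun ε hε => ?_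
  obtain ⟨δ, hδ, h⟩ := nhdsWithin_basis_ball.eventually_iff.1
    (hlim.eventually (gt_mem_nhds hε))
  refine ⟨δ, hδ, fun z hz hzδ => ?_⟩
  have hzξ : 0 < ‖z - ξ₀‖ := by
    rw [norm_pos_iff]
    intro h0
    have := H.pos z hz
    simp [h0] at this
  have := (h ⟨mem_ball_iff_norm.2 hzδ, hz⟩).le
  rwa [div_le_iff₀ (Real.rpow_pos_of_pos hzξ _), one_div] at this

end
end
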